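/- Let p ∈ [1,∞) and let ((λ_n)_{n∈ℤ}, (μ_n)_{n∈ℤ}) be an arbitrary element of SD_p. Then there exists a unique Dirac-form potential Q with real-valued q₁, q₂ ∈ L_p(0,1) such that the set of eigenvalues of the associated Dirac operator A₁ is exactly {λ_n : n ∈ ℤ} and the set of eigenvalues of A₂ is exactly {μ_n : n ∈ ℤ}. -/

import Mathlib

open MeasureTheory Complex Filter Set
open scoped Matrix.Norms.L2Operator ENNReal

noncomputable section

abbrev M2 := Matrix (Fin 2) (Fin 2) ℂ

def Bmat : M2 := !![0, 1; -1, 0]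

def Jmat : M2 := !![1, 0; 0, -1]

/-- `expB τ = e^{-τ B} = [[cos τ, -sin τ],[sin τ, cos τ]]`. -/
def expB (τ : ℂ) : M2 := !![Complex.cos τ, -Complex.sin τ; Complex.sin τ, Complex.cos τ]

/-- Lebesgue measure restricted to `(0,1)`. -/
def μ01 : Measure ℝ := volume.restrict (Set.Ioo 0 1)

/-- Lebesgue measure restricted to `(-1,1)`. -/
def μ11 : Measure ℝ := volume.restrict (Set.Ioo (-1) 1)

/-- A Dirac-form potential `Q = [[q₁,q₂],[q₂,-q₁]]`. -/
def IsDiracForm (Q : ℝ → M2) : Prop :=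
  ∃ q1 q2 : ℝ → ℂ, ∀ x, Q x = !![q1 x, q2 x; q2 x, -q1 x]

/-- A Dirac-form potential with real-valued entries. -/
def IsRealDiracForm (Q : ℝ → M2) : Prop :=
  ∃ q1 q2 : ℝ → ℝ, ∀ x, Q x = !![(q1 x : ℂ), (q2 x : ℂ); (q2 x : ℂ), -(q1 x : ℂ)]

/-- `U` is an absolutely continuous matrix solution of `B U' + Q U = λ U` a.e. on `(0,1)`. -/
def IsMatSolution (Q : ℝ → M2) (l : ℂ) (U : ℝ → M2) : Prop :=
  ∃ U' : ℝ → M2, IntegrableOn U' (Set.Ioo 0 1) ∧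
    (∀ x ∈ Set.Icc (0:ℝ) 1, U x = U 0 + ∫ t in (0:ℝ)..x, U' t) ∧
    (∀ᵐ x ∂μ01, Bmat * U' x + Q x * U x = l • U x)

/-- `u` is an absolutely continuous `ℂ²`-valued solution of `B u' + Q u = λ u` a.e. on `(0,1)`. -/
def IsVecSolution (Q : ℝ → M2) (l : ℂ) (u : ℝ → Fin 2 → ℂ) : Prop :=
  ∃ u' : ℝ → Fin 2 → ℂ, IntegrableOn u' (Set.Ioo 0 1) ∧
    (∀ x ∈ Set.Icc (0:ℝ) 1, u x = u 0 + ∫ t in (0:ℝ)..x, u' t) ∧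
    (∀ᵐ x ∂μ01, Bmat.mulVec (u' x) + (Q x).mulVec (u x) = l • u x)

/-- `λ` is an eigenvalue of the Dirac operator `A_j` (`j = 0` for `A₁`, `j = 1` for `A₂`):
there is a nonzero AC solution with `u₂(0) = 0` and `u_j(1) = 0`. -/
def IsEigenvalue (Q : ℝ → M2) (j : Fin 2) (l : ℝ) : Prop :=
  ∃ u : ℝ → Fin 2 → ℂ, IsVecSolution Q (l : ℂ) u ∧
    (∃ x ∈ Set.Icc (0:ℝ) 1, u x ≠ 0) ∧ u 0 1 = 0 ∧ u 1 j = 0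

/-- `c₀(·,λ) = (cos λx, sin λx)ᵗ`. -/
def c0 (l : ℂ) (x : ℝ) : Fin 2 → ℂ := ![Complex.cos (l * x), Complex.sin (l * x)]

/-- n-th Fourier coefficient `e_n(g) = ∫₀¹ e^{-2πinx} g(x) dx`. -/
def fc (g : ℝ → ℂ) (n : ℤ) : ℂ :=
  ∫ x in (0:ℝ)..1, Complex.exp (-2 * Real.pi * Complex.I * n * x) * g x

/-- The square of the `ℍ = L₂((0,1),ℂ²)` norm of `u`. -/
def hnormSq (u : ℝ → Fin 2 → ℂ) : ℝ :=
  ∫ x in Set.Ioo (0:ℝ) 1, (‖u x 0‖ ^ 2 + ‖u x 1‖ ^ 2)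

/-- The `ℂ²` inner product `⟨v,w⟩ = v₁ w̄₁ + v₂ w̄₂`. -/
def ip2 (v w : Fin 2 → ℂ) : ℂ := v 0 * star (w 0) + v 1 * star (w 1)

/-- The eigenvalue asymptotics `λ_n = π(n+1/2) + e_n(g)` for some `g ∈ L_p(0,1)`. -/
def LamAsymp (p : ℝ≥0∞) (lam : ℤ → ℝ) : Prop :=
  ∃ g : ℝ → ℂ, MemLp g p μ01 ∧
    ∀ n : ℤ, (lam n : ℂ) = Real.pi * (n + 1/2) + fc g n

/-- The eigenvalue asymptotics `μ_n = πn + e_n(g)` for some `g ∈ L_p(0,1)`. -/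
def MuAsymp (p : ℝ≥0∞) (mu : ℤ → ℝ) : Prop :=
  ∃ g : ℝ → ℂ, MemLp g p μ01 ∧
    ∀ n : ℤ, (mu n : ℂ) = Real.pi * n + fc g n

/-- The norming-constant asymptotics `α_n = 1 + e_n(g)` for some `g ∈ L_p(0,1)`. -/
def AlAsymp (p : ℝ≥0∞) (al : ℤ → ℝ) : Prop :=
  ∃ g : ℝ → ℂ, MemLp g p μ01 ∧ ∀ n : ℤ, (al n : ℂ) = 1 + fc g n

/-- Membership in the class `SD_p` of spectral data. -/
def MemSD (p : ℝ≥0∞) (lam mu : ℤ → ℝ) : Prop :=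
  (∀ n : ℤ, lam (n - 1) < mu n ∧ mu n < lam n) ∧ LamAsymp p lam ∧ MuAsymp p mu

/-- Membership in the kernel space `G_p(M₂)`: all slices lie in `L_p` and the slice maps are
continuous from `[0,1]` to `L_p((0,1),M₂)`. -/
def MemGp (p : ℝ≥0∞) (K : ℝ → ℝ → M2) : Prop :=
  (∀ x ∈ Set.Icc (0:ℝ) 1, MemLp (K x) p μ01) ∧
  (∀ t ∈ Set.Icc (0:ℝ) 1, MemLp (fun x => K x t) p μ01) ∧
  (∀ x₀ ∈ Set.Icc (0:ℝ) 1, ∀ ε > (0:ℝ), ∃ δ > (0:ℝ), ∀ x ∈ Set.Icc (0:ℝ) 1,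
    |x - x₀| < δ → eLpNorm (fun t => K x t - K x₀ t) p μ01 < ENNReal.ofReal ε) ∧
  (∀ t₀ ∈ Set.Icc (0:ℝ) 1, ∀ ε > (0:ℝ), ∃ δ > (0:ℝ), ∀ t ∈ Set.Icc (0:ℝ) 1,
    |t - t₀| < δ → eLpNorm (fun x => K x t - K x t₀) p μ01 < ENNReal.ofReal ε)

/-- The norm of the space `G_p(M₂)` (as an extended real number). -/
def gpNorm (p : ℝ≥0∞) (K : ℝ → ℝ → M2) : ℝ≥0∞ :=
  max (⨆ x ∈ Set.Icc (0:ℝ) 1, eLpNorm (K x) p μ01)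
      (⨆ t ∈ Set.Icc (0:ℝ) 1, eLpNorm (fun x => K x t) p μ01)


set_option linter.unusedSectionVars false
set_option linter.unusedSimpArgs false
open scoped ComplexConjugate Topology Interval


/-- `f` is a primitive of the integrable function `f'` on `[0,1]`. -/
def AC1 (f f' : ℝ → ℂ) : Prop :=
  IntervalIntegrable f' volume 0 1 ∧ ∀ x ∈ Icc (0:ℝ) 1, f x = f 0 + ∫ s in (0:ℝ)..x, f' s

theorem uIcc01 : uIcc (0:ℝ) 1 = Icc 0 1 := uIcc_of_le zero_le_one

theorem ii_sub {E : Type*} [NormedAddCommGroup E] {f : ℝ → E} (h : IntervalIntegrable f volume 0 1)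
    {x y : ℝ} (hx : x ∈ Icc (0:ℝ) 1) (hy : y ∈ Icc (0:ℝ) 1) : IntervalIntegrable f volume x y :=
  h.mono_set (by rw [uIcc01]; exact Set.uIcc_subset_Icc hx hy)

theorem ac_complex {f' : ℝ → ℂ} (h : IntervalIntegrable f' volume 0 1) :
    AbsolutelyContinuousOnInterval (fun x => ∫ s in (0:ℝ)..x, f' s) 0 1 := by
  have hre : IntervalIntegrable (fun s => (f' s).re) volume 0 1 :=
    ⟨h.1.re, h.2.re⟩
  have him : IntervalIntegrable (fun s => (f' s).im) volume 0 1 :=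
    ⟨h.1.im, h.2.im⟩
  have h0 : (0:ℝ) ∈ uIcc (0:ℝ) 1 := by simp
  have A := hre.absolutelyContinuousOnInterval_intervalIntegral h0
  have Bq := him.absolutelyContinuousOnInterval_intervalIntegral h0
  have c1 : AbsolutelyContinuousOnInterval (fun _ : ℝ => (1:ℂ)) 0 1 :=
    ((LipschitzWith.const (1:ℂ)).lipschitzOnWith (s := uIcc 0 1)).absolutelyContinuousOnInterval
  have cI : AbsolutelyContinuousOnInterval (fun _ : ℝ => Complex.I) 0 1 :=
    ((LipschitzWith.const Complex.I).lipschitzOnWith (s := uIcc 0 1)).absolutelyContinuousOnInterval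
  have key := (A.smul c1).add (Bq.smul cI)
  rw [absolutelyContinuousOnInterval_iff] at key ⊢
  intro ε hε
  obtain ⟨δ, hδ, H⟩ := key ε hε
  refine ⟨δ, hδ, fun E hE hlt => ?_⟩
  refine lt_of_le_of_lt (le_of_eq ?_) (H E hE hlt)
  refine Finset.sum_congr rfl fun i hi => ?_
  have e : ∀ x ∈ Icc (0:ℝ) 1, (∫ s in (0:ℝ)..x, f' s) =
      ((fun x => ∫ s in (0:ℝ)..x, (f' s).re) • (fun _ : ℝ => (1:ℂ)) +
        (fun x => ∫ s in (0:ℝ)..x, (f' s).im) • (fun _ : ℝ => Complex.I)) x := by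
    intro x hx
    have hi := ii_sub h (left_mem_Icc.2 zero_le_one) hx
    apply Complex.ext
    · have := Complex.reCLM.intervalIntegral_comp_comm hi
      simp at this ⊢
      exact this.symm
    · have := Complex.imCLM.intervalIntegral_comp_comm hi
      simp at this ⊢
      exact this.symm
  have := hE.1 i hi
  rw [uIcc01] at this
  rw [e _ this.1, e _ this.2]

namespace AC1

variable {f f' g g' : ℝ → ℂ}

theorem ac (h : AC1 f f') : AbsolutelyContinuousOnInterval f 0 1 := by
  have key := (((LipschitzWith.const (f 0)).lipschitzOnWith
    (s := uIcc (0:ℝ) 1)).absolutelyContinuousOnInterval).add (ac_complex h.1)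
  rw [absolutelyContinuousOnInterval_iff] at key ⊢
  intro ε hε
  obtain ⟨δ, hδ, H⟩ := key ε hε
  refine ⟨δ, hδ, fun E hE hlt => ?_⟩
  refine lt_of_le_of_lt (le_of_eq ?_) (H E hE hlt)
  refine Finset.sum_congr rfl fun i hi => ?_
  have := hE.1 i hi
  rw [uIcc01] at this
  rw [h.2 _ this.1, h.2 _ this.2]
  simp

theorem continuousOn (h : AC1 f f') : ContinuousOn f (Icc 0 1) := by
  have := h.ac.continuousOn
  rwa [uIcc01] at this

theorem ae_deriv (h : AC1 f f') : ∀ᵐ x, x ∈ Icc (0:ℝ) 1 → HasDerivAt f (f' x) x := by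
  have h1 : ∀ᵐ x : ℝ, x ≠ 0 := by simp [ae_iff, measure_singleton]
  have h2 : ∀ᵐ x : ℝ, x ≠ 1 := by simp [ae_iff, measure_singleton]
  filter_upwards [h.1.ae_hasDerivAt_integral, h1, h2] with x hx h1 h2 hm
  have hd := (hx (by rwa [uIcc01]) 0 (by simp)).const_add (f 0)
  refine hd.congr_of_eventuallyEq ?_
  have : Ioo (0:ℝ) 1 ∈ 𝓝 x :=
    Ioo_mem_nhds (lt_of_le_of_ne hm.1 (Ne.symm h1)) (lt_of_le_of_ne hm.2 h2)
  filter_upwards [this] with y hy using h.2 y ⟨hy.1.le, hy.2.le⟩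

theorem of_ac (hac : AbsolutelyContinuousOnInterval f 0 1) (hi : IntervalIntegrable f' volume 0 1)
    (hd : ∀ᵐ x, x ∈ Icc (0:ℝ) 1 → HasDerivAt f (f' x) x) : AC1 f f' := by
  refine ⟨hi, ?_⟩
  have h1 := hac.sub (ac_complex hi)
  have hF : AC1 (fun x => ∫ s in (0:ℝ)..x, f' s) f' := ⟨hi, fun x _ => by simp⟩
  obtain ⟨C, hC⟩ := h1.const_of_ae_hasDerivAt_zero (by
    filter_upwards [hd, hF.ae_deriv] with x h1 h2 hx
    rw [uIcc01] at hx
    have := (h1 hx).sub (h2 hx)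
    rwa [sub_self] at this)
  intro x hx
  have e0 := hC 0 (by simp)
  have ex := hC x (by rwa [uIcc01])
  simp at e0 ex
  rw [e0, ← ex]; ring

theorem mul (hf : AC1 f f') (hg : AC1 g g') :
    AC1 (fun x => f x * g x) (fun x => f' x * g x + f x * g' x) := by
  refine of_ac (hf.ac.smul hg.ac) ?_ ?_
  · exact (hf.1.mul_continuousOn (by rw [uIcc01]; exact hg.continuousOn)).add
      (hg.1.continuousOn_mul (by rw [uIcc01]; exact hf.continuousOn))
  · filter_upwards [hf.ae_deriv, hg.ae_deriv] with x h1 h2 hx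
    exact (h1 hx).mul (h2 hx)

theorem add (hf : AC1 f f') (hg : AC1 g g') :
    AC1 (fun x => f x + g x) (fun x => f' x + g' x) := by
  refine ⟨hf.1.add hg.1, fun x hx => ?_⟩
  have h0 : (0:ℝ) ∈ Icc (0:ℝ) 1 := by simp
  rw [intervalIntegral.integral_add (ii_sub hf.1 h0 hx) (ii_sub hg.1 h0 hx)]
  show f x + g x = f 0 + g 0 + _
  rw [hf.2 x hx, hg.2 x hx]
  ring

theorem const_mul (c : ℂ) (hf : AC1 f f') : AC1 (fun x => c * f x) (fun x => c * f' x) := by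
  refine ⟨hf.1.const_mul c, fun x hx => ?_⟩
  rw [intervalIntegral.integral_const_mul]
  show c * f x = c * f 0 + _
  rw [hf.2 x hx]; ring

theorem cconj (hf : AC1 f f') : AC1 (fun x => conj (f x)) (fun x => conj (f' x)) := by
  refine ⟨⟨?_, ?_⟩, fun x hx => ?_⟩
  · exact (Complex.conjCLE : ℂ →L[ℝ] ℂ).integrable_comp hf.1.1
  · exact (Complex.conjCLE : ℂ →L[ℝ] ℂ).integrable_comp hf.1.2
  · have := (Complex.conjCLE : ℂ →L[ℝ] ℂ).intervalIntegral_comp_comm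
      (ii_sub hf.1 (left_mem_Icc.2 zero_le_one) hx)
    simp at this
    rw [this]
    show conj (f x) = conj (f 0) + _
    rw [hf.2 x hx]; simp

theorem congr_ae {f'' : ℝ → ℂ} (hf : AC1 f f') (h : ∀ᵐ x, x ∈ Icc (0:ℝ) 1 → f' x = f'' x) :
    AC1 f f'' := by
  refine of_ac hf.ac ?_ ?_
  · refine hf.1.congr_ae ?_
    rw [uIoc_of_le zero_le_one, Filter.EventuallyEq, ae_restrict_iff' measurableSet_Ioc]
    filter_upwards [h] with x hx hm using hx ⟨hm.1.le, hm.2⟩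
  · filter_upwards [hf.ae_deriv, h] with x h1 h2 hx
    rw [← h2 hx]; exact h1 hx

theorem of_cont (hc : Continuous g) : AC1 (fun x => ∫ s in (0:ℝ)..x, g s) g :=
  ⟨hc.intervalIntegrable _ _, fun x _ => by simp⟩

theorem of_hasDeriv (hd : ∀ x ∈ Icc (0:ℝ) 1, HasDerivWithinAt f (f' x) (Icc 0 1) x)
    (hc : ContinuousOn f' (Icc 0 1)) : AC1 f f' := by
  have hi : IntervalIntegrable f' volume 0 1 :=
    ContinuousOn.intervalIntegrable (by rwa [uIcc01])
  refine ⟨hi, fun x hx => ?_⟩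
  have := intervalIntegral.integral_eq_sub_of_hasDerivAt_of_le (f := f) (f' := f') hx.1
    (fun y hy => ((hd y ⟨hy.1, hy.2.trans hx.2⟩).continuousWithinAt).mono
      (Icc_subset_Icc_right hx.2))
    (fun y hy => (hd y ⟨hy.1.le, hy.2.le.trans hx.2⟩).hasDerivAt
      (Icc_mem_nhds hy.1 (hy.2.trans_le hx.2)))
    (ii_sub hi (left_mem_Icc.2 zero_le_one) hx)
  rw [this]; ring

end AC1

theorem exists_kappa {m : ℝ → ℝ} (hm0 : ∀ s, 0 ≤ m s) (hm : IntervalIntegrable m volume 0 1) :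
    ∃ κ : ℝ, 0 ≤ κ ∧ ∀ x ∈ Icc (0:ℝ) 1, ∫ s in (0:ℝ)..x, m s * Real.exp (-(κ * (x - s))) ≤ 1/2 := by
  have hlim : Tendsto (fun K : ℕ => ∫ s in (0:ℝ)..1, (m s - min (m s) K)) atTop (𝓝 0) := by
    have := intervalIntegral.tendsto_integral_filter_of_dominated_convergence (μ := volume)
      (a := (0:ℝ)) (b := 1) (l := atTop)
      (F := fun (K : ℕ) s => m s - min (m s) K) (f := fun _ => (0:ℝ)) m ?_ ?_ hm ?_
    · simpa using this
    · refine Eventually.of_forall fun K => ?_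
      have := hm.1.aestronglyMeasurable
      rw [uIoc_of_le zero_le_one]
      exact this.sub (this.inf aestronglyMeasurable_const)
    · refine Eventually.of_forall fun K => Eventually.of_forall fun s _ => ?_
      rw [Real.norm_eq_abs, abs_of_nonneg (by simp)]
      have : 0 ≤ min (m s) K := le_min (hm0 s) (Nat.cast_nonneg K)
      linarith
    · refine Eventually.of_forall fun s _ => ?_
      refine tendsto_const_nhds.congr' ?_
      obtain ⟨N, hN⟩ := exists_nat_ge (m s)
      filter_upwards [eventually_ge_atTop N] with K hK
      have : m s ≤ K := hN.trans (by exact_mod_cast hK)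
      simp [min_eq_left this]
  obtain ⟨K, hK⟩ := (hlim.eventually (gt_mem_nhds (show (0:ℝ) < 1/4 by norm_num))).exists
  have hκ : (0:ℝ) < 4 * K + 1 := by positivity
  refine ⟨4 * K + 1, hκ.le, fun x hx => ?_⟩
  set κ : ℝ := 4 * K + 1
  have h0 : (0:ℝ) ∈ Icc (0:ℝ) 1 := by simp
  have hmin : IntervalIntegrable (fun s => m s - min (m s) K) volume 0 1 := by
    refine hm.mono_fun ?_ ?_
    · have := hm.1.aestronglyMeasurable
      rw [uIoc_of_le zero_le_one]
      exact this.sub (this.inf aestronglyMeasurable_const)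
    · refine Eventually.of_forall fun s => ?_
      have : 0 ≤ min (m s) K := le_min (hm0 s) (Nat.cast_nonneg K)
      simp only [Real.norm_eq_abs]
      rw [abs_of_nonneg (by simp), abs_of_nonneg (hm0 s)]
      linarith
  have hcont : Continuous fun s : ℝ => Real.exp (-(κ * (x - s))) := by fun_prop
  have step1 : ∫ s in (0:ℝ)..x, m s * Real.exp (-(κ * (x - s))) ≤
      ∫ s in (0:ℝ)..x, ((m s - min (m s) K) + K * Real.exp (-(κ * (x - s)))) := by
    refine intervalIntegral.integral_mono_on hx.1 ?_ ?_ ?_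
    · exact (ii_sub hm h0 hx).mul_continuousOn hcont.continuousOn
    · exact (ii_sub hmin h0 hx).add ((hcont.const_mul _).intervalIntegrable _ _)
    · intro s hs
      have e1 : Real.exp (-(κ * (x - s))) ≤ 1 :=
        Real.exp_le_one_iff.2 (by have := mul_nonneg hκ.le (sub_nonneg.2 hs.2); linarith)
      have e2 := Real.exp_pos (-(κ * (x - s)))
      have e3 : min (m s) K ≤ K := min_le_right _ _
      have e4 : min (m s) K ≤ m s := min_le_left _ _
      nlinarith [mul_nonneg (sub_nonneg.2 e4) (sub_nonneg.2 e1), mul_nonneg (sub_nonneg.2 e3) e2.le]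
  have step2 : ∫ s in (0:ℝ)..x, (m s - min (m s) K) ≤ ∫ s in (0:ℝ)..1, (m s - min (m s) K) := by
    refine intervalIntegral.integral_mono_interval le_rfl hx.1 hx.2 ?_ hmin
    exact Eventually.of_forall fun s => by simp
  have step3 : ∫ s in (0:ℝ)..x, K * Real.exp (-(κ * (x - s))) ≤ 1/4 := by
    have hd : ∀ s ∈ uIcc 0 x, HasDerivAt (fun s => K / κ * Real.exp (-(κ * (x - s))))
        (K * Real.exp (-(κ * (x - s)))) s := by
      intro s _
      have h1 : HasDerivAt (fun s : ℝ => -(κ * (x - s))) κ s := by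
        have := (((hasDerivAt_id s).const_sub x).const_mul κ).fun_neg
        simpa using this
      have := (h1.exp).const_mul (K / κ)
      refine this.congr_deriv ?_
      have : κ ≠ 0 := hκ.ne'
      field_simp
    rw [intervalIntegral.integral_eq_sub_of_hasDerivAt hd
      ((hcont.const_mul _).intervalIntegrable _ _)]
    have e2 := Real.exp_pos (-(κ * (x - 0)))
    have : (K:ℝ) / κ ≤ 1/4 := by
      rw [div_le_iff₀ hκ]; simp only [κ]; linarith
    have hk : 0 ≤ (K:ℝ)/κ := by positivity
    simp only [sub_self, mul_zero, neg_zero, Real.exp_zero, mul_one]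
    nlinarith [mul_nonneg hk e2.le]
  rw [intervalIntegral.integral_add (ii_sub hmin h0 hx)
    ((hcont.const_mul _).intervalIntegrable _ _)] at step1
  linarith

/-- A form of Gronwall's inequality which does not need measurability of `o`. -/
theorem gronwall {m : ℝ → ℝ} (hm0 : ∀ s, 0 ≤ m s) (hm : IntervalIntegrable m volume 0 1) :
    ∃ κ : ℝ, 0 ≤ κ ∧ ∀ (o : ℝ → ℝ) (a b : ℝ), 0 ≤ a →
      (∀ x ∈ Icc (0:ℝ) 1, 0 ≤ o x) → (∀ x ∈ Icc (0:ℝ) 1, o x ≤ b) →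
      (∀ x ∈ Icc (0:ℝ) 1, o x ≤ a + ∫ s in (0:ℝ)..x, m s * o s) →
      ∀ x ∈ Icc (0:ℝ) 1, o x ≤ 2 * a * Real.exp κ := by
  obtain ⟨κ, hκ, H⟩ := exists_kappa hm0 hm
  refine ⟨κ, hκ, fun o a b ha ho hb hi => ?_⟩
  have h0 : (0:ℝ) ∈ Icc (0:ℝ) 1 := by simp
  have hb0 : 0 ≤ b := (ho 0 h0).trans (hb 0 h0)
  have key : ∀ n : ℕ, ∀ x ∈ Icc (0:ℝ) 1, o x ≤ (2 * a + b * (1/2)^n) * Real.exp (κ * x) := by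
    intro n
    induction n with
    | zero =>
      intro x hx
      have : 1 ≤ Real.exp (κ * x) := Real.one_le_exp (mul_nonneg hκ hx.1)
      have := hb x hx
      simp only [pow_zero, mul_one]
      nlinarith
    | succ n ih =>
      intro x hx
      set A := 2 * a + b * (1/2)^n
      have hA : 0 ≤ A := by positivity
      refine (hi x hx).trans ?_
      have e1 : ∫ s in (0:ℝ)..x, m s * o s ≤
          ∫ s in (0:ℝ)..x, (A * Real.exp (κ * x)) * (m s * Real.exp (-(κ * (x - s)))) := by
        have hcont : Continuous fun s : ℝ => Real.exp (-(κ * (x - s))) := by fun_prop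
        have hint : IntervalIntegrable (fun s => (A * Real.exp (κ * x)) *
            (m s * Real.exp (-(κ * (x - s))))) volume 0 x :=
          ((ii_sub hm h0 hx).mul_continuousOn hcont.continuousOn).const_mul _
        rw [intervalIntegral.integral_of_le hx.1, intervalIntegral.integral_of_le hx.1]
        refine integral_mono_of_nonneg ?_ hint.1 ?_
        · rw [EventuallyLE, ae_restrict_iff' measurableSet_Ioc]
          exact Eventually.of_forall fun s hs =>
            mul_nonneg (hm0 s) (ho s ⟨hs.1.le, hs.2.trans hx.2⟩)
        · rw [EventuallyLE, ae_restrict_iff' measurableSet_Ioc]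
          refine Eventually.of_forall fun s hs => ?_
          have := ih s ⟨hs.1.le, hs.2.trans hx.2⟩
          have e : Real.exp (κ * x) * Real.exp (-(κ * (x - s))) = Real.exp (κ * s) := by
            rw [← Real.exp_add]; ring_nf
          calc m s * o s ≤ m s * (A * Real.exp (κ * s)) := mul_le_mul_of_nonneg_left this (hm0 s)
            _ = _ := by rw [← e]; ring
      rw [intervalIntegral.integral_const_mul] at e1
      have e2 := H x hx
      have e3 : 1 ≤ Real.exp (κ * x) := Real.one_le_exp (mul_nonneg hκ hx.1)
      have e4 : (A * Real.exp (κ * x)) * (∫ s in (0:ℝ)..x, m s * Real.exp (-(κ * (x - s))))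
          ≤ (A * Real.exp (κ * x)) * (1/2) := mul_le_mul_of_nonneg_left e2 (by positivity)
      have e5 : 2 * a + b * (1/2)^(n+1) = a + A / 2 := by simp only [A, pow_succ]; ring
      rw [e5]
      nlinarith
  intro x hx
  have l1 : Tendsto (fun n : ℕ => (2 * a + b * (1/2:ℝ)^n) * Real.exp (κ * x)) atTop
      (𝓝 ((2 * a + b * 0) * Real.exp (κ * x))) :=
    (tendsto_const_nhds.add (tendsto_const_nhds.mul
      (tendsto_pow_atTop_nhds_zero_of_lt_one (by norm_num) (by norm_num)))).mul_const _
  have := ge_of_tendsto' l1 (fun n => key n x hx)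
  refine this.trans ?_
  rw [mul_zero, add_zero]
  refine mul_le_mul_of_nonneg_left (Real.exp_le_exp.2 ?_) (by positivity)
  nlinarith [hx.2]

theorem volterra {E : Type*} [NormedAddCommGroup E] [NormedSpace ℝ E] [CompleteSpace E]
    {m : ℝ → ℝ} (hm0 : ∀ s, 0 ≤ m s) (hm : IntervalIntegrable m volume 0 1) (Φ : ℝ → E → E)
    (hL : ∀ s ∈ Icc (0:ℝ) 1, ∀ e e', ‖Φ s e - Φ s e'‖ ≤ m s * ‖e - e'‖) (h0 : ∀ s, Φ s 0 = 0)
    (hmeas : ∀ f : ℝ → E, Continuous f →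
      AEStronglyMeasurable (fun s => Φ s (f s)) (volume.restrict (Ioc 0 1)))
    (g : ℝ → E) (hg : Continuous g) :
    ∃ f : ℝ → E, Continuous f ∧ IntervalIntegrable (fun s => Φ s (f s)) volume 0 1 ∧
      ∀ x ∈ Icc (0:ℝ) 1, f x = g x + ∫ s in (0:ℝ)..x, Φ s (f s) := by
  obtain ⟨κ, hκ, H⟩ := exists_kappa hm0 hm
  have zm : (0:ℝ) ∈ Icc (0:ℝ) 1 := by simp
  have hint : ∀ f : ℝ → E, Continuous f → IntervalIntegrable (fun s => Φ s (f s)) volume 0 1 := by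
    intro f hf
    have hb : IntervalIntegrable (fun s => m s * ‖f s‖) volume 0 1 :=
      hm.mul_continuousOn hf.norm.continuousOn
    refine hb.mono_fun' (by rw [uIoc_of_le zero_le_one]; exact hmeas f hf) ?_
    rw [uIoc_of_le zero_le_one, EventuallyLE, ae_restrict_iff' measurableSet_Ioc]
    refine Eventually.of_forall fun s hs => ?_
    have := hL s ⟨hs.1.le, hs.2⟩ (f s) 0
    simpa [h0] using this
  let ext : C(Icc (0:ℝ) 1, E) → ℝ → E := fun F s => Real.exp (κ * s) • F (projIcc 0 1 zero_le_one s)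
  have hext : ∀ F, Continuous (ext F) := fun F => by
    have : Continuous fun s => F (projIcc (0:ℝ) 1 zero_le_one s) :=
      F.continuous.comp continuous_projIcc
    exact (by fun_prop : Continuous fun s : ℝ => Real.exp (κ * s)).smul this
  have hprim : ∀ F, ContinuousOn (fun x => ∫ s in (0:ℝ)..x, Φ s (ext F s)) (Icc 0 1) := by
    intro F
    have := intervalIntegral.continuousOn_primitive_interval
      (f := fun s => Φ s (ext F s)) (a := (0:ℝ)) (b := 1) (μ := volume)
      (by
        have := (hint _ (hext F))
        rw [intervalIntegrable_iff_integrableOn_Icc_of_le zero_le_one] at this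
        rwa [uIcc01])
    rwa [uIcc01] at this
  let Tm : C(Icc (0:ℝ) 1, E) → C(Icc (0:ℝ) 1, E) := fun F =>
    ⟨fun x => Real.exp (-(κ * (x:ℝ))) • (g x + ∫ s in (0:ℝ)..x, Φ s (ext F s)), by
      have h1 : Continuous fun x : Icc (0:ℝ) 1 => ∫ s in (0:ℝ)..(x:ℝ), Φ s (ext F s) :=
        continuousOn_iff_continuous_restrict.1 (hprim F)
      have h2 : Continuous fun x : Icc (0:ℝ) 1 => Real.exp (-(κ * (x:ℝ))) := by fun_prop
      exact h2.smul ((hg.comp continuous_subtype_val).add h1)⟩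
  have hT : ContractingWith (1/2) Tm := by
    refine ⟨by norm_num, LipschitzWith.of_dist_le_mul fun F G => ?_⟩
    rw [ContinuousMap.dist_le (by positivity)]
    intro x
    rw [dist_eq_norm, dist_eq_norm]
    have ix := ii_sub (hint _ (hext F)) zm x.2
    have iy := ii_sub (hint _ (hext G)) zm x.2
    have e : Tm F x - Tm G x = Real.exp (-(κ * (x:ℝ))) •
        ∫ s in (0:ℝ)..x, (Φ s (ext F s) - Φ s (ext G s)) := by
      rw [intervalIntegral.integral_sub ix iy]
      simp only [Tm, ContinuousMap.coe_mk]
      rw [← smul_sub]; congr 1; abel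
    rw [e, norm_smul, Real.norm_eq_abs, abs_of_pos (Real.exp_pos _)]
    have hc : Continuous fun s : ℝ => Real.exp (-(κ * ((x:ℝ) - s))) := by fun_prop
    have b1 : ‖∫ s in (0:ℝ)..x, (Φ s (ext F s) - Φ s (ext G s))‖ ≤
        ∫ s in (0:ℝ)..x, (Real.exp (κ * x) * ‖F - G‖) * (m s * Real.exp (-(κ * ((x:ℝ) - s)))) := by
      refine intervalIntegral.norm_integral_le_of_norm_le x.2.1 ?_
        (((ii_sub hm zm x.2).mul_continuousOn hc.continuousOn).const_mul _)
      refine Eventually.of_forall fun s hs => ?_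
      refine (hL s ⟨hs.1.le, hs.2.trans x.2.2⟩ _ _).trans ?_
      have e1 : ‖ext F s - ext G s‖ ≤ Real.exp (κ * s) * ‖F - G‖ := by
        simp only [ext]
        rw [← smul_sub, norm_smul, Real.norm_eq_abs, abs_of_pos (Real.exp_pos _)]
        refine mul_le_mul_of_nonneg_left ?_ (Real.exp_pos _).le
        exact (F - G).norm_coe_le_norm _
      have e : Real.exp (κ * x) * Real.exp (-(κ * (x - s))) = Real.exp (κ * s) := by
        rw [← Real.exp_add]; ring_nf
      calc m s * ‖ext F s - ext G s‖ ≤ m s * (Real.exp (κ * s) * ‖F - G‖) :=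
            mul_le_mul_of_nonneg_left e1 (hm0 s)
        _ = _ := by rw [← e]; ring
    rw [intervalIntegral.integral_const_mul] at b1
    have b2 := mul_le_mul_of_nonneg_left (H x x.2)
      (show 0 ≤ Real.exp (κ * x) * ‖F - G‖ by positivity)
    have e : Real.exp (-(κ * (x:ℝ))) * Real.exp (κ * x) = 1 := by
      rw [← Real.exp_add]; simp
    calc _ ≤ Real.exp (-(κ * (x:ℝ))) * (Real.exp (κ * x) * ‖F - G‖ * (1/2)) :=
          mul_le_mul_of_nonneg_left (b1.trans b2) (Real.exp_pos _).le
      _ = (Real.exp (-(κ * (x:ℝ))) * Real.exp (κ * x)) * ‖F - G‖ * (1/2) := by ring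
      _ = _ := by rw [e]; push_cast; ring
  obtain ⟨F, hF⟩ : ∃ F, Tm F = F := ⟨_, hT.fixedPoint_isFixedPt⟩
  refine ⟨ext F, hext F, hint _ (hext F), fun x hx => ?_⟩
  have : (Tm F) ⟨x, hx⟩ = F ⟨x, hx⟩ := by rw [hF]
  show Real.exp (κ * x) • F (projIcc 0 1 zero_le_one x) = _
  rw [projIcc_of_mem zero_le_one hx, ← this]
  simp only [Tm, ContinuousMap.coe_mk]
  rw [smul_smul, ← Real.exp_add]; simp



theorem AC1.clm {f f' : ℝ → ℂ} (L : ℂ →L[ℝ] ℂ) (hf : AC1 f f') :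
    AC1 (fun x => L (f x)) (fun x => L (f' x)) := by
  refine ⟨⟨L.integrable_comp hf.1.1, L.integrable_comp hf.1.2⟩, fun x hx => ?_⟩
  rw [L.intervalIntegral_comp_comm (ii_sub hf.1 (left_mem_Icc.2 zero_le_one) hx)]
  show L (f x) = L (f 0) + _
  rw [hf.2 x hx]; simp

theorem AC1.im {f f' : ℝ → ℂ} (hf : AC1 f f') :
    AC1 (fun x => ((f x).im : ℂ)) (fun x => ((f' x).im : ℂ)) :=
  hf.clm (ofRealCLM.comp imCLM)

theorem AC1.re {f f' : ℝ → ℂ} (hf : AC1 f f') :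
    AC1 (fun x => ((f x).re : ℂ)) (fun x => ((f' x).re : ℂ)) :=
  hf.clm (ofRealCLM.comp reCLM)

theorem AC1.congr {f f' g g' : ℝ → ℂ} (hf : AC1 f f') (h : ∀ x ∈ Icc (0:ℝ) 1, f x = g x)
    (h' : ∀ x ∈ Icc (0:ℝ) 1, f' x = g' x) : AC1 g g' := by
  have h2 := hf.congr_ae (f'' := g') (Eventually.of_forall fun x hx => h' x hx)
  refine ⟨h2.1, fun x hx => ?_⟩
  rw [← h x hx, ← h 0 (by simp)]
  exact h2.2 x hx

theorem AC1.const_of_zero {f f' : ℝ → ℂ} (hf : AC1 f f') (h : ∀ x ∈ Icc (0:ℝ) 1, f' x = 0) :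
    ∀ x ∈ Icc (0:ℝ) 1, f x = f 0 := by
  have := hf.congr (g' := fun _ => 0) (fun x _ => rfl) h
  intro x hx
  rw [this.2 x hx]; simp

/-- `v` solves `v' = i l v + ψ conj v`. -/
def IsSol (ψ : ℝ → ℂ) (l : ℝ) (v : ℝ → ℂ) : Prop :=
  AC1 v (fun s => I * l * v s + ψ s * conj (v s))

theorem IsSol.congr {ψ : ℝ → ℂ} {l : ℝ} {v w : ℝ → ℂ} (h : IsSol ψ l v)
    (e : ∀ x ∈ Icc (0:ℝ) 1, v x = w x) : IsSol ψ l w :=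
  AC1.congr h e fun x hx => by rw [e x hx]

theorem IsSol.lin {ψ : ℝ → ℂ} {l : ℝ} {v w : ℝ → ℂ} (hv : IsSol ψ l v) (hw : IsSol ψ l w)
    (a b : ℝ) : IsSol ψ l (fun x => a * v x + b * w x) := by
  refine AC1.congr ((hv.const_mul (a:ℂ)).add (hw.const_mul (b:ℂ))) (fun x _ => rfl) fun x _ => ?_
  simp only [map_add, map_mul, conj_ofReal]; ring

theorem sol_lip {ψ : ℝ → ℂ} (hψ : IntervalIntegrable ψ volume 0 1) (R : ℝ) (hR : 0 ≤ R) :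
    ∃ κ : ℝ, 0 ≤ κ ∧ ∀ (l l' : ℝ) (v w : ℝ → ℂ), |l| ≤ R → IsSol ψ l v → IsSol ψ l' w →
      v 0 = w 0 → ∀ b : ℝ, (∀ x ∈ Icc (0:ℝ) 1, ‖w x‖ ≤ b) →
      ∀ x ∈ Icc (0:ℝ) 1, ‖v x - w x‖ ≤ 2 * (|l - l'| * b) * Real.exp κ := by
  have hm : IntervalIntegrable (fun s => R + ‖ψ s‖) volume 0 1 :=
    (intervalIntegrable_const).add hψ.norm
  obtain ⟨κ, hκ, H⟩ := gronwall (m := fun s => R + ‖ψ s‖) (fun s => by positivity) hm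
  refine ⟨κ, hκ, fun l l' v w hl hv hw h0 b hb => ?_⟩
  have zm : (0:ℝ) ∈ Icc (0:ℝ) 1 := by simp
  have hb0 : 0 ≤ b := (norm_nonneg _).trans (hb 0 zm)
  have hcont : ContinuousOn (fun x => ‖v x - w x‖) (Icc 0 1) :=
    (hv.continuousOn.sub hw.continuousOn).norm
  obtain ⟨c, hc⟩ := isCompact_Icc.bddAbove_image hcont
  refine H (fun x => ‖v x - w x‖) (|l - l'| * b) c (by positivity) (fun x _ => norm_nonneg _)
    (fun x hx => hc (mem_image_of_mem _ hx)) fun x hx => ?_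
  have e : v x - w x = ∫ s in (0:ℝ)..x, ((I * l * v s + ψ s * conj (v s)) -
      (I * l' * w s + ψ s * conj (w s))) := by
    rw [intervalIntegral.integral_sub (ii_sub hv.1 zm hx) (ii_sub hw.1 zm hx), hv.2 x hx,
      hw.2 x hx, h0]; ring
  have hi : IntervalIntegrable (fun s => (R + ‖ψ s‖) * ‖v s - w s‖) volume 0 x :=
    (ii_sub hm zm hx).mul_continuousOn (hcont.mono (by
      rw [uIcc_of_le hx.1]; exact Icc_subset_Icc_right hx.2))
  have b1 : ‖v x - w x‖ ≤ ∫ s in (0:ℝ)..x, (|l - l'| * b + (R + ‖ψ s‖) * ‖v s - w s‖) := by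
    rw [e]
    refine intervalIntegral.norm_integral_le_of_norm_le hx.1 (Eventually.of_forall fun s hs => ?_)
      ((intervalIntegrable_const).add hi)
    have e2 : (I * l * v s + ψ s * conj (v s)) - (I * l' * w s + ψ s * conj (w s)) =
        I * ((l - l' : ℝ) : ℂ) * w s + (I * l * (v s - w s) + ψ s * conj (v s - w s)) := by
      simp only [map_sub, ofReal_sub]; ring
    rw [e2]
    refine (norm_add_le _ _).trans (add_le_add ?_ ((norm_add_le _ _).trans ?_))
    · rw [norm_mul, norm_mul, norm_I, one_mul, norm_real, Real.norm_eq_abs]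
      exact mul_le_mul_of_nonneg_left (hb s ⟨hs.1.le, hs.2.trans hx.2⟩) (abs_nonneg _)
    · rw [norm_mul, norm_mul, norm_mul, norm_I, one_mul, norm_real, Real.norm_eq_abs,
        Complex.norm_conj, add_mul]
      gcongr
  rw [intervalIntegral.integral_add intervalIntegrable_const hi] at b1
  refine b1.trans ?_
  gcongr
  rw [intervalIntegral.integral_const, smul_eq_mul, sub_zero]
  exact mul_le_of_le_one_left (by positivity) hx.2

theorem sol_unique {ψ : ℝ → ℂ} (hψ : IntervalIntegrable ψ volume 0 1) {l : ℝ} {v w : ℝ → ℂ}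
    (hv : IsSol ψ l v) (hw : IsSol ψ l w) (h0 : v 0 = w 0) :
    ∀ x ∈ Icc (0:ℝ) 1, v x = w x := by
  obtain ⟨κ, -, H⟩ := sol_lip hψ |l| (abs_nonneg _)
  obtain ⟨b, hb⟩ := isCompact_Icc.bddAbove_image hw.continuousOn.norm
  intro x hx
  have := H l l v w le_rfl hv hw h0 b (fun x hx => hb (mem_image_of_mem _ hx)) x hx
  simp only [sub_self, abs_zero, zero_mul, mul_zero] at this
  exact sub_eq_zero.1 (norm_le_zero_iff.1 this)

theorem exists_sol {ψ : ℝ → ℂ} (hψ : IntervalIntegrable ψ volume 0 1) (l : ℝ) (c : ℂ) :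
    ∃ v : ℝ → ℂ, Continuous v ∧ v 0 = c ∧ IsSol ψ l v := by
  have hm : IntervalIntegrable (fun s => |l| + ‖ψ s‖) volume 0 1 :=
    (intervalIntegrable_const).add hψ.norm
  obtain ⟨f, hf, hi, H⟩ := volterra (m := fun s => |l| + ‖ψ s‖) (fun s => by positivity) hm
    (fun s e => I * l * e + ψ s * conj e) (fun s _ e e' => by
      have : I * l * e + ψ s * conj e - (I * l * e' + ψ s * conj e') =
        I * l * (e - e') + ψ s * conj (e - e') := by simp only [map_sub]; ring
      rw [this]
      refine (norm_add_le _ _).trans (le_of_eq ?_)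
      rw [norm_mul, norm_mul, norm_mul, norm_I, one_mul, norm_real, Real.norm_eq_abs,
        Complex.norm_conj, add_mul]) (fun s => by simp)
    (fun f hf => by
      have h1 := hψ.1.aestronglyMeasurable
      have h2 : Continuous fun s => conj (f s) := continuous_conj.comp hf
      exact ((continuous_const.mul hf).aestronglyMeasurable).add (h1.mul h2.aestronglyMeasurable))
    (fun _ => c) continuous_const
  have f0 : f 0 = c := by simpa using H 0 (by simp)
  exact ⟨f, hf, f0, hi, fun x hx => by rw [f0]; exact H x hx⟩

/-- The solution with `v 0 = c`, extended constantly outside `[0,1]`. -/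
def Sol (ψ : ℝ → ℂ) (c : ℂ) (l : ℝ) (x : ℝ) : ℂ := by
  classical
  exact if h : ∃ v : ℝ → ℂ, Continuous v ∧ v 0 = c ∧ IsSol ψ l v then
    h.choose (projIcc 0 1 zero_le_one x) else 0

section
variable {ψ : ℝ → ℂ} (hψ : IntervalIntegrable ψ volume 0 1)

theorem Sol_zero (c : ℂ) (l : ℝ) (hψ : IntervalIntegrable ψ volume 0 1) : Sol ψ c l 0 = c := by
  unfold Sol
  rw [dif_pos (exists_sol hψ l c)]
  rw [projIcc_of_mem zero_le_one (by simp : (0:ℝ) ∈ Icc (0:ℝ) 1)]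
  exact (exists_sol hψ l c).choose_spec.2.1

theorem Sol_proj (c : ℂ) (l : ℝ) (hψ : IntervalIntegrable ψ volume 0 1) (x : ℝ) :
    Sol ψ c l x = Sol ψ c l (projIcc 0 1 zero_le_one x) := by
  unfold Sol
  rw [dif_pos (exists_sol hψ l c), dif_pos (exists_sol hψ l c)]
  rw [projIcc_val]

theorem Sol_sol (c : ℂ) (l : ℝ) (hψ : IntervalIntegrable ψ volume 0 1) :
    IsSol ψ l (Sol ψ c l) := by
  refine (exists_sol hψ l c).choose_spec.2.2.congr fun x hx => ?_
  unfold Sol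
  rw [dif_pos (exists_sol hψ l c), projIcc_of_mem zero_le_one hx]

theorem Sol_cont_x (c : ℂ) (l : ℝ) (hψ : IntervalIntegrable ψ volume 0 1) :
    Continuous (Sol ψ c l) := by
  unfold Sol
  simp only [dif_pos (exists_sol hψ l c)]
  exact (exists_sol hψ l c).choose_spec.1.comp (continuous_subtype_val.comp continuous_projIcc)

theorem Sol_eq {c : ℂ} {l : ℝ} (hψ : IntervalIntegrable ψ volume 0 1) {v : ℝ → ℂ}
    (hv : IsSol ψ l v) (h0 : v 0 = c) : ∀ x ∈ Icc (0:ℝ) 1, v x = Sol ψ c l x :=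
  sol_unique hψ hv (Sol_sol c l hψ) (by rw [Sol_zero c l hψ, h0])

theorem Sol_cont (c : ℂ) (hψ : IntervalIntegrable ψ volume 0 1) :
    Continuous fun q : ℝ × ℝ => Sol ψ c q.1 q.2 := by
  rw [continuous_iff_continuousAt]
  rintro ⟨l', x'⟩
  obtain ⟨κ, -, H⟩ := sol_lip hψ (|l'| + 1) (by positivity)
  obtain ⟨b, hb⟩ := isCompact_Icc.bddAbove_image (Sol_sol c l' hψ).continuousOn.norm
  have key : ∀ l x : ℝ, |l - l'| ≤ 1 → ‖Sol ψ c l x - Sol ψ c l' x‖ ≤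
      2 * (|l - l'| * b) * Real.exp κ := by
    intro l x hl
    rw [Sol_proj c l hψ x, Sol_proj c l' hψ x]
    refine H l l' _ _ ?_ (Sol_sol c l hψ) (Sol_sol c l' hψ) ?_ b
      (fun x hx => hb (mem_image_of_mem _ hx)) _ (projIcc 0 1 zero_le_one x).2
    · have := abs_sub_abs_le_abs_sub l l'; linarith
    · rw [Sol_zero c l hψ, Sol_zero c l' hψ]
  have t1 : Tendsto (fun q : ℝ × ℝ => Sol ψ c q.1 q.2 - Sol ψ c l' q.2) (𝓝 (l', x')) (𝓝 0) := by
    have hlim : Tendsto (fun q : ℝ × ℝ => 2 * (|q.1 - l'| * b) * Real.exp κ) (𝓝 (l', x')) (𝓝 0) := by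
      have : Continuous fun q : ℝ × ℝ => 2 * (|q.1 - l'| * b) * Real.exp κ := by fun_prop
      have := this.tendsto (l', x')
      simpa using this
    refine squeeze_zero_norm' ?_ hlim
    have : ∀ᶠ q : ℝ × ℝ in 𝓝 (l', x'), |q.1 - l'| < 1 := by
      have h : Continuous fun q : ℝ × ℝ => |q.1 - l'| := by fun_prop
      have := h.tendsto (l', x')
      simp only [sub_self, abs_zero] at this
      exact this.eventually (gt_mem_nhds one_pos)
    filter_upwards [this] with q hq using key _ _ hq.le
  have t2 : Tendsto (fun q : ℝ × ℝ => Sol ψ c l' q.2) (𝓝 (l', x')) (𝓝 (Sol ψ c l' x')) :=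
    ((Sol_cont_x c l' hψ).comp continuous_snd).tendsto (l', x')
  have := t1.add t2
  simpa [ContinuousAt] using this

end

attribute [irreducible] Sol

/-- The Wronskian identity. -/
theorem wron {ψ : ℝ → ℂ} {ν ν' : ℝ} {z y : ℝ → ℂ} (hz : IsSol ψ ν z) (hy : IsSol ψ ν' y) :
    AC1 (fun x => ((conj (z x) * y x).im : ℂ))
      (fun x => (((ν' - ν) * (conj (z x) * y x).re : ℝ) : ℂ)) := by
  refine AC1.congr (hz.cconj.mul hy).im (fun x _ => rfl) fun x _ => ?_
  congr 1
  simp only [map_add, map_mul, conj_I, conj_ofReal, conj_conj, add_im, mul_im, mul_re, add_re,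
    conj_re, conj_im, I_re, I_im, ofReal_re, ofReal_im, neg_re, neg_im]
  ring

theorem wron_const {ψ : ℝ → ℂ} {ν : ℝ} {z y : ℝ → ℂ} (hz : IsSol ψ ν z) (hy : IsSol ψ ν y) :
    ∀ x ∈ Icc (0:ℝ) 1, (conj (z x) * y x).im = (conj (z 0) * y 0).im := by
  intro x hx
  have := (wron hz hy).const_of_zero (fun x _ => by simp) x hx
  exact_mod_cast this

theorem sol_ne_zero {ψ : ℝ → ℂ} (hψ : IntervalIntegrable ψ volume 0 1) {l : ℝ} {v : ℝ → ℂ}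
    (hv : IsSol ψ l v) {x₀ : ℝ} (hx₀ : x₀ ∈ Icc (0:ℝ) 1) (h : v x₀ = 0) :
    ∀ x ∈ Icc (0:ℝ) 1, v x = 0 := by
  have h1 := wron_const hv (Sol_sol 1 l hψ) x₀ hx₀
  have h2 := wron_const hv (Sol_sol I l hψ) x₀ hx₀
  rw [h, Sol_zero _ _ hψ] at h1 h2
  simp at h1 h2
  have e : v 0 = 0 := Complex.ext h2.symm h1
  have hz : IsSol ψ l (fun _ => (0:ℂ)) :=
    ⟨by simp, fun x _ => by simp⟩
  exact sol_unique hψ hv hz e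

/-- Characteristic function value: `v(1)` for the solution with `v(0) = 1`. -/
def V1 (ψ : ℝ → ℂ) (l : ℝ) : ℂ := Sol ψ 1 l 1

theorem V1_ne_zero {ψ : ℝ → ℂ} (hψ : IntervalIntegrable ψ volume 0 1) (l : ℝ) : V1 ψ l ≠ 0 := by
  intro h
  have := sol_ne_zero hψ (Sol_sol 1 l hψ) (by simp : (1:ℝ) ∈ Icc (0:ℝ) 1) h 0 (by simp)
  rw [Sol_zero _ _ hψ] at this
  exact one_ne_zero this

theorem V1_cont {ψ : ℝ → ℂ} (hψ : IntervalIntegrable ψ volume 0 1) : Continuous (V1 ψ) := by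
  have h := Sol_cont (1:ℂ) hψ
  have h2 : Continuous fun l : ℝ => (l, (1:ℝ)) := by fun_prop
  have h3 : V1 ψ = (fun q : ℝ × ℝ => Sol ψ 1 q.1 q.2) ∘ (fun l : ℝ => (l, (1:ℝ))) := by
    funext l; simp only [V1, Function.comp]
  rw [h3]
  exact h.comp h2

/-- The solution with prescribed value `ω` at `1`. -/
def SolEnd (ψ : ℝ → ℂ) (ω : ℂ) (l x : ℝ) : ℂ :=
  ((conj ω * Sol ψ I l 1).im : ℝ) * Sol ψ 1 l x + ((conj (Sol ψ 1 l 1) * ω).im : ℝ) * Sol ψ I l x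

theorem SolEnd_sol {ψ : ℝ → ℂ} (hψ : IntervalIntegrable ψ volume 0 1) (ω : ℂ) (l : ℝ) :
    IsSol ψ l (SolEnd ψ ω l) := (Sol_sol 1 l hψ).lin (Sol_sol I l hψ) _ _

theorem SolEnd_one {ψ : ℝ → ℂ} (hψ : IntervalIntegrable ψ volume 0 1) (ω : ℂ) (l : ℝ) :
    SolEnd ψ ω l 1 = ω := by
  have h := wron_const (Sol_sol 1 l hψ) (Sol_sol I l hψ) 1 (by simp)
  rw [Sol_zero _ _ hψ, Sol_zero _ _ hψ] at h
  simp only [SolEnd]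
  generalize Sol ψ 1 l 1 = A at *
  generalize Sol ψ I l 1 = D at *
  simp only [mul_im, conj_re, conj_im, map_one, one_mul, I_im, one_re, one_im, neg_zero, I_re,
    mul_zero, zero_add, add_zero] at h
  apply Complex.ext
  · simp only [add_re, mul_re, ofReal_re, ofReal_im, mul_im, conj_re, conj_im]
    linear_combination ω.re * h
  · simp only [add_im, mul_re, ofReal_re, ofReal_im, mul_im, conj_re, conj_im]
    linear_combination ω.im * h

theorem SolEnd_cont {ψ : ℝ → ℂ} (ω : ℂ) (hψ : IntervalIntegrable ψ volume 0 1) :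
    Continuous fun q : ℝ × ℝ => SolEnd ψ ω q.1 q.2 := by
  have c1 := Sol_cont 1 hψ
  have c2 := Sol_cont I hψ
  have d1 : Continuous fun q : ℝ × ℝ => Sol ψ 1 q.1 1 :=
    c1.comp (by fun_prop : Continuous fun q : ℝ × ℝ => (q.1, (1:ℝ)))
  have d2 : Continuous fun q : ℝ × ℝ => Sol ψ I q.1 1 :=
    c2.comp (by fun_prop : Continuous fun q : ℝ × ℝ => (q.1, (1:ℝ)))
  unfold SolEnd
  have e1 : Continuous fun q : ℝ × ℝ => (conj ω * Sol ψ I q.1 1).im :=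
    continuous_im.comp (continuous_const.mul d2)
  have e2 : Continuous fun q : ℝ × ℝ => (conj (Sol ψ 1 q.1 1) * ω).im :=
    continuous_im.comp ((continuous_conj.comp d1).mul continuous_const)
  exact ((continuous_ofReal.comp e1).mul c1).add ((continuous_ofReal.comp e2).mul c2)


theorem pos_on_uIcc {f : ℝ → ℝ} (hf : Continuous f) {a b : ℝ} (h : ∀ x ∈ uIcc a b, f x ≠ 0)
    (ha : 0 < f a) : ∀ x ∈ uIcc a b, 0 < f x := by
  intro x hx
  by_contra hn
  have hle := not_lt.1 hn
  obtain ⟨c, hc, h0⟩ := (isPreconnected_uIcc (a := a) (b := b)).intermediate_value hx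
    (left_mem_uIcc) hf.continuousOn ⟨hle, ha.le⟩
  exact h c hc h0

theorem SolEnd_proj {ψ : ℝ → ℂ} (hψ : IntervalIntegrable ψ volume 0 1) (ω : ℂ) (l x : ℝ) :
    SolEnd ψ ω l x = SolEnd ψ ω l (projIcc 0 1 zero_le_one x) := by
  simp only [SolEnd]
  rw [Sol_proj 1 l hψ x, Sol_proj I l hψ x]

theorem SolEnd_cont_x {ψ : ℝ → ℂ} (hψ : IntervalIntegrable ψ volume 0 1) (ω : ℂ) (l : ℝ) :
    Continuous (SolEnd ψ ω l) := by
  have h := SolEnd_cont ω hψ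
  have h2 : Continuous fun x : ℝ => (l, x) := by fun_prop
  exact h.comp h2

theorem darboux_W {ψ : ℝ → ℂ} (hψ : IntervalIntegrable ψ volume 0 1) (ω : ℂ) (hω : ω ≠ 0)
    (ν ν' : ℝ) (him : ∀ l ∈ uIcc ν ν', (conj ω * V1 ψ l).im ≠ 0) :
    ∀ x ∈ Icc (0:ℝ) 1, (conj (Sol ψ 1 ν x) * SolEnd ψ ω ν' x).im ≠ 0 := by
  set w1 : ℝ := (conj (V1 ψ ν) * ω).im with hw1
  have zm : (0:ℝ) ∈ Icc (0:ℝ) 1 := by simp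
  have om : (1:ℝ) ∈ Icc (0:ℝ) 1 := by simp
  have hw1' : ∀ l, (conj (V1 ψ l) * ω).im = -(conj ω * V1 ψ l).im := by
    intro l; simp only [mul_im, conj_re, conj_im]; ring
  have w1ne : w1 ≠ 0 := by rw [hw1, hw1']; exact neg_ne_zero.2 (him ν left_mem_uIcc)
  let W : ℝ → ℝ → ℝ := fun l x => w1 * (conj (Sol ψ 1 ν x) * SolEnd ψ ω l x).im
  have hWc : Continuous fun q : ℝ × ℝ => W q.1 q.2 := by
    have h1 : Continuous fun q : ℝ × ℝ => Sol ψ 1 ν q.2 :=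
      (Sol_cont_x 1 ν hψ).comp continuous_snd
    exact continuous_const.mul (continuous_im.comp
      ((continuous_conj.comp h1).mul (SolEnd_cont ω hψ)))
  have hW1 : ∀ l, W l 1 = w1 * w1 := by
    intro l; simp only [W]; rw [SolEnd_one hψ]; rfl
  have hW1pos : 0 < w1 * w1 := mul_self_pos.2 w1ne
  have hW0 : ∀ l, W l 0 = -(w1 * (conj ω * V1 ψ l).im) := by
    intro l; simp only [W, SolEnd]
    rw [Sol_zero 1 _ hψ, Sol_zero 1 _ hψ, Sol_zero I _ hψ, map_one, one_mul, ← mul_neg, ← hw1' l]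
    simp [V1]
  have hWν : ∀ x ∈ Icc (0:ℝ) 1, W ν x = w1 * w1 := by
    intro x hx
    have a1 := wron_const (Sol_sol 1 ν hψ) (SolEnd_sol hψ ω ν) x hx
    have a2 := wron_const (Sol_sol 1 ν hψ) (SolEnd_sol hψ ω ν) 1 om
    rw [← hW1 ν]; simp only [W]; rw [a1, a2]
  have hW0c : Continuous fun l => W l 0 :=
    hWc.comp (by fun_prop : Continuous fun l : ℝ => (l, (0:ℝ)))
  have hW0pos : ∀ l ∈ uIcc ν ν', 0 < W l 0 := by
    refine pos_on_uIcc hW0c (fun l hl => ?_) (by rw [hWν 0 zm]; exact hW1pos)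
    rw [hW0]; exact neg_ne_zero.2 (mul_ne_zero w1ne (him l hl))
  let u : Set ℝ := {l | ∀ x ∈ Icc (0:ℝ) 1, 0 < W l x}
  have hu : IsOpen u := by
    rw [isOpen_iff_mem_nhds]
    intro l hl
    refine isCompact_Icc.eventually_forall_of_forall_eventually fun x hx => ?_
    exact hWc.continuousAt.eventually (lt_mem_nhds (hl x hx))
  have hcl : closure u ⊆ {l | ∀ x ∈ Icc (0:ℝ) 1, 0 ≤ W l x} := by
    refine closure_minimal (fun l hl x hx => (hl x hx).le) ?_
    have : {l | ∀ x ∈ Icc (0:ℝ) 1, 0 ≤ W l x} = ⋂ x ∈ Icc (0:ℝ) 1, {l | 0 ≤ W l x} := by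
      ext; simp
    rw [this]
    refine isClosed_biInter fun x _ => ?_
    have : Continuous fun l => W l x := hWc.comp (by fun_prop : Continuous fun l : ℝ => (l, x))
    exact isClosed_le continuous_const this
  have hsub : uIcc ν ν' ⊆ u := by
    refine isPreconnected_uIcc.subset_of_closure_inter_subset hu
      ⟨ν, left_mem_uIcc, fun x hx => by rw [hWν x hx]; exact hW1pos⟩ ?_
    rintro l ⟨hl, hlm⟩ x hx
    have hnn := hcl hl
    refine lt_of_le_of_ne (hnn x hx) fun hzero => ?_
    have hx0 : x ≠ 0 := fun h => by rw [h] at hzero; exact (hW0pos l hlm).ne hzero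
    have hx1 : x ≠ 1 := fun h => by rw [h, hW1] at hzero; exact hW1pos.ne hzero
    have hxo : x ∈ Ioo (0:ℝ) 1 := ⟨lt_of_le_of_ne hx.1 hx0.symm, lt_of_le_of_ne hx.2 hx1⟩
    have hWx : (conj (Sol ψ 1 ν x) * SolEnd ψ ω l x).im = 0 := by
      have : W l x = 0 := hzero.symm
      exact (mul_eq_zero.1 this).resolve_left w1ne
    have hcr : Continuous fun s => (l - ν) * (conj (Sol ψ 1 ν s) * SolEnd ψ ω l s).re :=
      continuous_const.mul (continuous_re.comp ((continuous_conj.comp (Sol_cont_x 1 ν hψ)).mul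
        (SolEnd_cont_x hψ ω l)))
    have hw := wron (Sol_sol 1 ν hψ) (SolEnd_sol hψ ω l)
    have hform : ∀ s ∈ Icc (0:ℝ) 1, W l s = W l 0 + w1 *
        ∫ t in (0:ℝ)..s, (l - ν) * (conj (Sol ψ 1 ν t) * SolEnd ψ ω l t).re := by
      intro s hs
      have h := hw.2 s hs
      rw [intervalIntegral.integral_ofReal] at h
      have h' := congrArg Complex.re h
      simp only [ofReal_re, add_re] at h'
      simp only [W]; rw [h']; ring
    have hd : HasDerivAt (W l) (w1 * ((l - ν) * (conj (Sol ψ 1 ν x) * SolEnd ψ ω l x).re)) x := by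
      have h1 := (((hcr.integral_hasStrictDerivAt 0 x).hasDerivAt).const_mul w1).const_add (W l 0)
      refine h1.congr_of_eventuallyEq ?_
      filter_upwards [Icc_mem_nhds hxo.1 hxo.2] with s hs using hform s hs
    have hmin : IsLocalMin (W l) x := by
      filter_upwards [Icc_mem_nhds hxo.1 hxo.2] with s hs
      rw [← hzero]; exact hnn s hs
    have hz := hmin.hasDerivAt_eq_zero hd
    by_cases hlν : l = ν
    · rw [hlν, hWν x hx] at hzero; exact hW1pos.ne hzero
    · have hre : (conj (Sol ψ 1 ν x) * SolEnd ψ ω l x).re = 0 := by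
        have := (mul_eq_zero.1 hz).resolve_left w1ne
        exact (mul_eq_zero.1 this).resolve_left (sub_ne_zero.2 hlν)
      have hprod : conj (Sol ψ 1 ν x) * SolEnd ψ ω l x = 0 := Complex.ext hre hWx
      rcases mul_eq_zero.1 hprod with h | h
      · have h' : Sol ψ 1 ν x = 0 := by simpa using h
        have := sol_ne_zero hψ (Sol_sol 1 ν hψ) hx h' 0 zm
        rw [Sol_zero _ _ hψ] at this
        exact one_ne_zero this
      · have := sol_ne_zero hψ (SolEnd_sol hψ ω l) hx h 1 om
        rw [SolEnd_one hψ] at this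
        exact hω this
  intro x hx h0
  have := hsub right_mem_uIcc x hx
  simp only [W] at this
  rw [h0, mul_zero] at this
  exact lt_irrefl _ this

theorem AC1.inv_of_cont {W W' : ℝ → ℝ} (hW' : Continuous W')
    (h : ∀ x ∈ Icc (0:ℝ) 1, W x = W 0 + ∫ s in (0:ℝ)..x, W' s)
    (hne : ∀ x ∈ Icc (0:ℝ) 1, W x ≠ 0) :
    AC1 (fun x => (((W x)⁻¹ : ℝ) : ℂ)) (fun x => ((-W' x / W x ^ 2 : ℝ) : ℂ)) := by
  let Wt : ℝ → ℝ := fun x => W 0 + ∫ s in (0:ℝ)..x, W' s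
  have hd : ∀ x, HasDerivAt Wt (W' x) x := fun x =>
    ((hW'.integral_hasStrictDerivAt 0 x).hasDerivAt).const_add (W 0)
  have hWt : Continuous Wt := continuous_iff_continuousAt.2 fun x => (hd x).continuousAt
  have hne' : ∀ x ∈ Icc (0:ℝ) 1, Wt x ≠ 0 := fun x hx => by
    rw [← show W x = Wt x from h x hx]; exact hne x hx
  have := AC1.of_hasDeriv (f := fun x => (((Wt x)⁻¹ : ℝ) : ℂ))
    (f' := fun x => ((-W' x / Wt x ^ 2 : ℝ) : ℂ))
    (fun x hx => ((hd x).fun_inv (hne' x hx)).ofReal_comp.hasDerivWithinAt)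
    (by
      refine continuous_ofReal.comp_continuousOn ?_
      exact (hW'.neg.continuousOn).div (hWt.pow 2).continuousOn
        fun x hx => pow_ne_zero 2 (hne' x hx))
  refine this.congr (fun x hx => ?_) (fun x hx => ?_)
  · rw [← show W x = Wt x from h x hx]
  · rw [← show W x = Wt x from h x hx]

theorem darboux {ψ : ℝ → ℂ} (hψ : IntervalIntegrable ψ volume 0 1) (ω : ℂ) (hω : conj ω * ω = 1)
    (ν ν' : ℝ) (hre : (conj ω * V1 ψ ν).re = 0)
    (him : ∀ l ∈ uIcc ν ν', (conj ω * V1 ψ l).im ≠ 0) :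
    ∃ χ : ℝ → ℂ, Continuous χ ∧ ∀ φ : ℝ → ℂ, φ = (fun x => ψ x + χ x) →
      (∀ l, (conj ω * V1 φ l).im = (conj ω * V1 ψ l).im) ∧
      (∀ l, (l - ν) * (conj ω * V1 φ l).re = (l - ν') * (conj ω * V1 ψ l).re) ∧
      (ν ≠ ν' → (conj ω * V1 φ ν).re ≠ 0) := by
  have hω0 : ω ≠ 0 := by rintro rfl; simp at hω
  have zm : (0:ℝ) ∈ Icc (0:ℝ) 1 := by simp
  have om : (1:ℝ) ∈ Icc (0:ℝ) 1 := by simp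
  have hWne := darboux_W hψ ω hω0 ν ν' him
  set z := Sol ψ 1 ν with hz
  set y := SolEnd ψ ω ν' with hy
  have zs : IsSol ψ ν z := Sol_sol 1 ν hψ
  have ys : IsSol ψ ν' y := SolEnd_sol hψ ω ν'
  have zc : Continuous z := Sol_cont_x 1 ν hψ
  have yc : Continuous y := SolEnd_cont_x hψ ω ν'
  have z0 : z 0 = 1 := Sol_zero 1 ν hψ
  have y1 : y 1 = ω := SolEnd_one hψ ω ν'
  let W : ℝ → ℝ := fun x => (conj (z x) * y x).im
  have hWc : Continuous W := continuous_im.comp ((continuous_conj.comp zc).mul yc)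
  have hWne' : ∀ x, W x ≠ 0 := by
    intro x
    simp only [W]
    rw [hz, hy, Sol_proj 1 ν hψ x, SolEnd_proj hψ ω ν' x]
    exact hWne _ (projIcc 0 1 zero_le_one x).2
  let χ : ℝ → ℂ := fun x => ((ν - ν' : ℝ) : ℂ) * y x * z x * (((W x)⁻¹ : ℝ) : ℂ)
  have hχ : Continuous χ := by
    have : Continuous fun x => (((W x)⁻¹ : ℝ) : ℂ) := continuous_ofReal.comp (hWc.inv₀ hWne')
    exact ((continuous_const.mul yc).mul zc).mul this
  refine ⟨χ, hχ, fun φ hφ => ?_⟩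
  have hφi : IntervalIntegrable φ volume 0 1 := by
    rw [hφ]; exact hψ.add (hχ.intervalIntegrable _ _)
  have hW'c : Continuous fun s => (ν' - ν) * (conj (z s) * y s).re :=
    continuous_const.mul (continuous_re.comp ((continuous_conj.comp zc).mul yc))
  have hWinv : AC1 (fun x => (((W x)⁻¹ : ℝ) : ℂ))
      (fun x => ((-((ν' - ν) * (conj (z x) * y x).re) / W x ^ 2 : ℝ) : ℂ)) := by
    refine AC1.inv_of_cont hW'c (fun s hs => ?_) (fun x _ => hWne' x)
    have h := (wron zs ys).2 s hs
    rw [intervalIntegral.integral_ofReal] at h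
    have h' := congrArg Complex.re h
    simpa only [ofReal_re, add_re] using h'
  have key : ∀ l, ∃ G : ℝ, (G = ∫ s in (0:ℝ)..1, (conj (z s) * Sol ψ 1 l s).re) ∧
      (conj (z 1) * V1 ψ l).im = (l - ν) * G ∧
      V1 φ l = V1 ψ l + ((ν - ν') * G * (W 1)⁻¹ : ℝ) * ω := by
    intro l
    set v := Sol ψ 1 l with hv
    have vs : IsSol ψ l v := Sol_sol 1 l hψ
    have vc : Continuous v := Sol_cont_x 1 l hψ
    have v0 : v 0 = 1 := Sol_zero 1 l hψ
    have hrc : Continuous fun s => (conj (z s) * v s).re :=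
      continuous_re.comp ((continuous_conj.comp zc).mul vc)
    let G : ℝ → ℝ := fun x => ∫ s in (0:ℝ)..x, (conj (z s) * v s).re
    have hG : AC1 (fun x => (G x : ℂ)) (fun x => (((conj (z x) * v x).re : ℝ) : ℂ)) := by
      have := AC1.of_cont (continuous_ofReal.comp hrc)
      refine this.congr (fun x _ => ?_) (fun x _ => rfl)
      simp only [G, Function.comp]
      rw [intervalIntegral.integral_ofReal]
    have hGim : ∀ x ∈ Icc (0:ℝ) 1, (conj (z x) * v x).im = (l - ν) * G x := by
      intro x hx
      have h := (wron zs vs).2 x hx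
      rw [intervalIntegral.integral_ofReal] at h
      have h' := congrArg Complex.re h
      simp only [ofReal_re, add_re] at h'
      rw [h', z0, v0, intervalIntegral.integral_const_mul]
      simp [G]
    let vh : ℝ → ℂ := fun x => v x + ((ν - ν' : ℝ) : ℂ) * ((y x * (G x : ℂ)) * (((W x)⁻¹ : ℝ) : ℂ))
    have hvh : IsSol φ l vh := by
      refine AC1.congr (vs.add ((((AC1.mul ys hG).mul hWinv)).const_mul ((ν - ν' : ℝ) : ℂ)))
        (fun x _ => rfl) fun x hx => ?_
      have hw : ((W x : ℝ) : ℂ) ≠ 0 := ofReal_ne_zero.2 (hWne' x)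
      have e1 : (((conj (z x) * y x).re : ℝ) : ℂ) = z x * conj (y x) + I * (W x : ℂ) := by
        apply Complex.ext <;> simp [W] <;> ring
      have e2 : (((conj (z x) * v x).re : ℝ) : ℂ) =
          z x * conj (v x) + I * (((l - ν) * G x : ℝ) : ℂ) := by
        rw [← hGim x hx]
        apply Complex.ext <;> simp <;> ring
      simp only [hφ, vh, χ, map_add, map_mul, conj_ofReal]
      have e3 : ((-((ν' - ν) * (conj (z x) * y x).re) / W x ^ 2 : ℝ) : ℂ) =
          -(((ν':ℂ) - ν) * (((conj (z x) * y x).re : ℝ) : ℂ)) / (W x : ℂ) ^ 2 := by push_cast; ring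
      rw [e3, e1, e2]
      push_cast
      field_simp
      ring
    have vh0 : vh 0 = 1 := by simp [vh, G, v0]
    have e := Sol_eq hφi hvh vh0 1 om
    refine ⟨G 1, rfl, hGim 1 om, ?_⟩
    show Sol φ 1 l 1 = v 1 + _
    rw [← e]
    simp only [vh, y1]
    push_cast
    ring
  have hz1 : z 1 = V1 ψ ν := rfl
  have ω2 : ω.re ^ 2 + ω.im ^ 2 = 1 := by
    have := congrArg Complex.re hω
    simp at this; nlinarith
  have hW1 : W 1 = -(conj ω * V1 ψ ν).im := by
    simp only [W, y1, hz1, mul_im, conj_re, conj_im]; ring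
  have hF : V1 ψ ν = I * ω * ((conj ω * V1 ψ ν).im : ℝ) := by
    have h1 : conj ω * V1 ψ ν = I * ((conj ω * V1 ψ ν).im : ℝ) := by
      apply Complex.ext
      · rw [hre]; simp
      · simp
    calc V1 ψ ν = (conj ω * ω) * V1 ψ ν := by rw [hω, one_mul]
      _ = ω * (conj ω * V1 ψ ν) := by ring
      _ = _ := by rw [h1]; simp; ring
  refine ⟨fun l => ?_, fun l => ?_, fun hne => ?_⟩
  · obtain ⟨G, -, -, h⟩ := key l
    rw [h]
    generalize ((ν - ν') * G * (W 1)⁻¹ : ℝ) = r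
    simp only [mul_im, add_im, add_re, mul_re, conj_re, conj_im, ofReal_re, ofReal_im]; ring
  · obtain ⟨G, -, h1, h⟩ := key l
    have e1 : (conj ω * V1 φ l).re = (conj ω * V1 ψ l).re + (ν - ν') * G * (W 1)⁻¹ := by
      rw [h]
      generalize ((ν - ν') * G * (W 1)⁻¹ : ℝ) = r
      simp only [mul_im, add_im, add_re, mul_re, conj_re, conj_im, ofReal_re, ofReal_im]
      linear_combination r * ω2
    have e2 : (conj (z 1) * V1 ψ l).im = W 1 * (conj ω * V1 ψ l).re := by
      rw [hz1, hF, hW1]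
      generalize (conj ω * V1 ψ ν).im = r
      simp only [mul_im, add_im, add_re, mul_re, conj_re, conj_im, ofReal_re, ofReal_im, map_mul,
        conj_I, conj_ofReal, I_re, I_im, neg_re, neg_im]
      ring
    rw [e1]
    have e3 : (l - ν) * G = W 1 * (conj ω * V1 ψ l).re := by rw [← h1, e2]
    have := hWne' 1
    field_simp
    linear_combination (ν - ν') * e3
  · obtain ⟨G, hG, -, h⟩ := key ν
    have e1 : (conj ω * V1 φ ν).re = (conj ω * V1 ψ ν).re + (ν - ν') * G * (W 1)⁻¹ := by
      rw [h]
      generalize ((ν - ν') * G * (W 1)⁻¹ : ℝ) = r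
      simp only [mul_im, add_im, add_re, mul_re, conj_re, conj_im, ofReal_re, ofReal_im]
      linear_combination r * ω2
    rw [e1, hre, zero_add]
    have hGpos : 0 < G := by
      rw [hG]
      have hrc : Continuous fun s => (conj (z s) * z s).re :=
        continuous_re.comp ((continuous_conj.comp zc).mul zc)
      refine intervalIntegral.intervalIntegral_pos_of_pos_on (hrc.intervalIntegrable _ _)
        (fun x hx => ?_) zero_lt_one
      have hzx : z x ≠ 0 := fun h0 => by
        have := sol_ne_zero hψ zs ⟨hx.1.le, hx.2.le⟩ h0 0 zm
        rw [z0] at this; exact one_ne_zero this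
      have : (conj (z x) * z x).re = normSq (z x) := by
        simp [normSq_apply]
      show 0 < (conj (z x) * z x).re
      rw [this]; exact normSq_pos.2 hzx
    exact mul_ne_zero (mul_ne_zero (sub_ne_zero.2 hne) hGpos.ne') (inv_ne_zero (hWne' 1))


/-- The complex potential attached to `q₁, q₂`. -/
def psiOf (q1 q2 : ℝ → ℝ) (x : ℝ) : ℂ := (q2 x : ℂ) - I * (q1 x : ℂ)

theorem ae01 {P : ℝ → Prop} (h : ∀ᵐ x ∂μ01, P x) : ∀ᵐ x, x ∈ Icc (0:ℝ) 1 → P x := by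
  have h1 : ∀ᵐ x : ℝ, x ≠ 0 := by simp [ae_iff, measure_singleton]
  have h2 : ∀ᵐ x : ℝ, x ≠ 1 := by simp [ae_iff, measure_singleton]
  rw [μ01, ae_restrict_iff' measurableSet_Ioo] at h
  filter_upwards [h, h1, h2] with x hx h1 h2 hm
  exact hx ⟨lt_of_le_of_ne hm.1 (Ne.symm h1), lt_of_le_of_ne hm.2 h2⟩

theorem ii_of_Ioo {E : Type*} [NormedAddCommGroup E] {f : ℝ → E} (h : IntegrableOn f (Ioo 0 1)) :
    IntervalIntegrable f volume 0 1 := by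
  rw [intervalIntegrable_iff_integrableOn_Ioc_of_le zero_le_one,
    integrableOn_Ioc_iff_integrableOn_Ioo]
  exact h

theorem comp_AC1 {u u' : ℝ → Fin 2 → ℂ} (hi : IntegrableOn u' (Ioo 0 1))
    (h : ∀ x ∈ Set.Icc (0:ℝ) 1, u x = u 0 + ∫ t in (0:ℝ)..x, u' t) (i : Fin 2) :
    AC1 (fun x => u x i) (fun x => u' x i) := by
  let L : (Fin 2 → ℂ) →L[ℝ] ℂ := ContinuousLinearMap.proj (R := ℝ) i
  have hii := ii_of_Ioo hi
  refine ⟨⟨L.integrable_comp hii.1, L.integrable_comp hii.2⟩, fun x hx => ?_⟩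
  have := L.intervalIntegral_comp_comm (ii_sub hii (left_mem_Icc.2 zero_le_one) hx)
  have e : ∫ s in (0:ℝ)..x, u' s i = (∫ s in (0:ℝ)..x, u' s) i := this
  rw [e]
  show u x i = u 0 i + _
  rw [h x hx]; rfl

theorem scal_eq {Q : ℝ → M2} {q1 q2 : ℝ → ℝ}
    (hQ : ∀ x, Q x = !![(q1 x : ℂ), (q2 x : ℂ); (q2 x : ℂ), -(q1 x : ℂ)]) {l : ℝ}
    (w w' : Fin 2 → ℂ) (x : ℝ) :
    (Bmat.mulVec w' + (Q x).mulVec w = (l:ℂ) • w) ↔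
      (w' 0 = q2 x * w 0 - q1 x * w 1 - l * w 1 ∧ w' 1 = l * w 0 - q1 x * w 0 - q2 x * w 1) := by
  rw [hQ x, Bmat, funext_iff]
  simp only [Fin.forall_fin_two, Pi.add_apply, Pi.smul_apply, Matrix.mulVec, dotProduct,
    Fin.sum_univ_two, Matrix.of_apply, Matrix.cons_val_zero, Matrix.cons_val_one, smul_eq_mul,
    Matrix.cons_val', Matrix.cons_val_fin_one]
  constructor
  · rintro ⟨h1, h2⟩
    exact ⟨by linear_combination -h2, by linear_combination h1⟩
  · rintro ⟨h1, h2⟩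
    exact ⟨by linear_combination h2, by linear_combination -h1⟩

theorem eig_iff {Q : ℝ → M2} {q1 q2 : ℝ → ℝ}
    (hQ : ∀ x, Q x = !![(q1 x : ℂ), (q2 x : ℂ); (q2 x : ℂ), -(q1 x : ℂ)])
    (hψ : IntervalIntegrable (psiOf q1 q2) volume 0 1) (l : ℝ) :
    (IsEigenvalue Q 0 l ↔ (V1 (psiOf q1 q2) l).re = 0) ∧
    (IsEigenvalue Q 1 l ↔ (V1 (psiOf q1 q2) l).im = 0) := by
  set ψ := psiOf q1 q2 with hψd
  have om : (1:ℝ) ∈ Icc (0:ℝ) 1 := by simp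
  have zm : (0:ℝ) ∈ Icc (0:ℝ) 1 := by simp
  have fwd : ∀ u, IsVecSolution Q (l:ℂ) u → (∃ x ∈ Set.Icc (0:ℝ) 1, u x ≠ 0) → u 0 1 = 0 →
      ∃ c : ℂ, c ≠ 0 ∧ u 1 0 = c * (V1 ψ l).re ∧ u 1 1 = c * (V1 ψ l).im := by
    rintro u ⟨u', hi, hu, hae⟩ ⟨x₀, hx₀, hne⟩ h01
    have a0 := comp_AC1 hi hu 0
    have a1 := comp_AC1 hi hu 1
    have hae' := ae01 hae
    have s1 : IsSol ψ l (fun x => ((u x 0).re : ℂ) + I * ((u x 1).re : ℂ)) := by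
      refine (a0.re.add (a1.re.const_mul I)).congr_ae ?_
      filter_upwards [hae'] with x hx hm
      obtain ⟨e0, e1⟩ := (scal_eq hQ _ _ _).1 (hx hm)
      rw [e0, e1]
      apply Complex.ext <;> simp [hψd, psiOf] <;> ring
    have s2 : IsSol ψ l (fun x => ((u x 0).im : ℂ) + I * ((u x 1).im : ℂ)) := by
      refine (a0.im.add (a1.im.const_mul I)).congr_ae ?_
      filter_upwards [hae'] with x hx hm
      obtain ⟨e0, e1⟩ := (scal_eq hQ _ _ _).1 (hx hm)
      rw [e0, e1]
      apply Complex.ext <;> simp [hψd, psiOf] <;> ring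
    have t := (Sol_sol 1 l hψ)
    have e1 : ∀ x ∈ Icc (0:ℝ) 1, ((u x 0).re : ℂ) + I * ((u x 1).re : ℂ) =
        (u 0 0).re * Sol ψ 1 l x := by
      intro x hx
      have := sol_unique hψ s1 (t.lin t (u 0 0).re 0)
        (by rw [Sol_zero 1 l hψ, h01]; simp) x hx
      rw [this]; simp
    have e2 : ∀ x ∈ Icc (0:ℝ) 1, ((u x 0).im : ℂ) + I * ((u x 1).im : ℂ) =
        (u 0 0).im * Sol ψ 1 l x := by
      intro x hx
      have := sol_unique hψ s2 (t.lin t (u 0 0).im 0)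
        (by rw [Sol_zero 1 l hψ, h01]; simp) x hx
      rw [this]; simp
    have e3 : ∀ x ∈ Icc (0:ℝ) 1, u x 0 = u 0 0 * (Sol ψ 1 l x).re ∧
        u x 1 = u 0 0 * (Sol ψ 1 l x).im := by
      intro x hx
      have r1 := congrArg Complex.re (e1 x hx)
      have r2 := congrArg Complex.im (e1 x hx)
      have r3 := congrArg Complex.re (e2 x hx)
      have r4 := congrArg Complex.im (e2 x hx)
      simp at r1 r2 r3 r4
      constructor <;> apply Complex.ext <;> simp [r1, r2, r3, r4]
    refine ⟨u 0 0, fun h => hne ?_, (e3 1 om).1, (e3 1 om).2⟩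
    funext i
    fin_cases i
    · simpa [h] using (e3 x₀ hx₀).1
    · simpa [h] using (e3 x₀ hx₀).2
  have bwd : ∃ u, IsVecSolution Q (l:ℂ) u ∧ (∃ x ∈ Set.Icc (0:ℝ) 1, u x ≠ 0) ∧ u 0 1 = 0 ∧
      u 1 0 = (V1 ψ l).re ∧ u 1 1 = (V1 ψ l).im := by
    have t := (Sol_sol 1 l hψ)
    set v := Sol ψ 1 l with hv
    have v0 : v 0 = 1 := Sol_zero 1 l hψ
    let u : ℝ → Fin 2 → ℂ := fun x => ![((v x).re : ℂ), ((v x).im : ℂ)]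
    let v' : ℝ → ℂ := fun s => I * l * v s + ψ s * conj (v s)
    let u' : ℝ → Fin 2 → ℂ := fun x => ![((v' x).re : ℂ), ((v' x).im : ℂ)]
    have hre := t.re
    have him := t.im
    have hi : IntervalIntegrable u' volume 0 1 := by
      rw [intervalIntegrable_iff_integrableOn_Ioc_of_le zero_le_one]
      refine Integrable.of_eval fun i => ?_
      fin_cases i
      · exact hre.1.1
      · exact him.1.1
    refine ⟨u, ⟨u', ?_, ?_, ?_⟩, ⟨0, zm, ?_⟩, ?_, rfl, rfl⟩
    · exact hi.1.mono_set Ioo_subset_Ioc_self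
    · intro x hx
      funext i
      let L : (Fin 2 → ℂ) →L[ℝ] ℂ := ContinuousLinearMap.proj (R := ℝ) i
      have := L.intervalIntegral_comp_comm (ii_sub hi (left_mem_Icc.2 zero_le_one) hx)
      have e : ∫ s in (0:ℝ)..x, u' s i = (∫ s in (0:ℝ)..x, u' s) i := this
      rw [Pi.add_apply, ← e]
      fin_cases i
      · exact hre.2 x hx
      · exact him.2 x hx
    · refine Eventually.of_forall fun x => (scal_eq hQ _ _ _).2 ⟨?_, ?_⟩
      · apply Complex.ext <;> simp [u, u', v', hψd, psiOf] <;> ring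
      · apply Complex.ext <;> simp [u, u', v', hψd, psiOf] <;> ring
    · intro h
      have := congrFun h 0
      simp [u, v0] at this
    · simp [u, v0]
  constructor
  · constructor
    · rintro ⟨u, h1, h2, h3, h4⟩
      obtain ⟨c, hc, h5, -⟩ := fwd u h1 h2 h3
      rw [h5] at h4
      exact_mod_cast (mul_eq_zero.1 h4).resolve_left hc
    · intro h
      obtain ⟨u, h1, h2, h3, h4, -⟩ := bwd
      exact ⟨u, h1, h2, h3, by rw [h4, h]; simp⟩
  · constructor
    · rintro ⟨u, h1, h2, h3, h4⟩
      obtain ⟨c, hc, -, h5⟩ := fwd u h1 h2 h3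
      rw [h5] at h4
      exact_mod_cast (mul_eq_zero.1 h4).resolve_left hc
    · intro h
      obtain ⟨u, h1, h2, h3, -, h4⟩ := bwd
      exact ⟨u, h1, h2, h3, by rw [h4, h]; simp⟩

theorem memLp_of_Q {p : ℝ≥0∞} {Q : ℝ → M2} {q1 q2 : ℝ → ℝ}
    (hQ : ∀ x, Q x = !![(q1 x : ℂ), (q2 x : ℂ); (q2 x : ℂ), -(q1 x : ℂ)]) :
    MemLp Q p μ01 ↔ MemLp (psiOf q1 q2) p μ01 := by
  constructor
  · intro h
    let L0 : M2 →L[ℂ] ℂ := LinearMap.toContinuousLinearMap (Matrix.entryLinearMap ℂ ℂ 0 0)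
    let L1 : M2 →L[ℂ] ℂ := LinearMap.toContinuousLinearMap (Matrix.entryLinearMap ℂ ℂ 0 1)
    have h0 := L0.comp_memLp' h
    have h1 := L1.comp_memLp' h
    have := h1.sub (h0.const_mul I)
    refine (memLp_congr_ae (Eventually.of_forall fun x => ?_)).1 this
    simp [L0, L1, hQ, psiOf]
  · intro h
    have h1 : MemLp (fun x => (((psiOf q1 q2 x).re : ℝ) : ℂ)) p μ01 :=
      (ofRealCLM.comp reCLM).comp_memLp' h
    have h2 : MemLp (fun x => (((psiOf q1 q2 x).im : ℝ) : ℂ)) p μ01 :=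
      (ofRealCLM.comp imCLM).comp_memLp' h
    have h3 := (ContinuousLinearMap.toSpanSingleton ℂ (!![0, 1; 1, 0] : M2)).comp_memLp' h1
    have h4 := (ContinuousLinearMap.toSpanSingleton ℂ (!![-1, 0; 0, 1] : M2)).comp_memLp' h2
    refine (memLp_congr_ae (Eventually.of_forall fun x => ?_)).1 (h3.add h4)
    simp only [Pi.add_apply, Function.comp, ContinuousLinearMap.toSpanSingleton_apply, hQ]
    ext i j
    fin_cases i <;> fin_cases j <;> simp [psiOf]

theorem ii_of_memLp {p : ℝ≥0∞} (hp : 1 ≤ p) {ψ : ℝ → ℂ} (h : MemLp ψ p μ01) :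
    IntervalIntegrable ψ volume 0 1 := by
  have : IsFiniteMeasure μ01 := by unfold μ01; infer_instance
  exact ii_of_Ioo (h.integrable hp)


def MoveClosed (P : (ℤ → ℝ) → Prop) : Prop :=
  ∀ (a : ℤ → ℝ) (k : ℤ) (t : ℝ), StrictMono a → StrictMono (Function.update a k t) → P a →
    P (Function.update a k t)

theorem chain_up {P : (ℤ → ℝ) → Prop} (hP : MoveClosed P) (N : ℕ) : ∀ (a b : ℤ → ℝ)
    (s : Finset ℤ), s.card = N → StrictMono a → StrictMono b → (∀ k, a k ≤ b k) →
    (∀ k, k ∉ s → a k = b k) → P a → P b := by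
  induction N with
  | zero =>
    intro a b s hs _ _ _ h hPa
    have : a = b := funext fun k => h k (by simp [Finset.card_eq_zero.1 hs])
    rwa [← this]
  | succ N ih =>
    intro a b s hs ha hb hle h hPa
    have hne : s.Nonempty := Finset.card_pos.1 (by omega)
    set k := s.max' hne with hk
    have hks : k ∈ s := s.max'_mem hne
    have habove : ∀ j, k < j → a j = b j := fun j hj => h j fun hjs =>
      absurd (s.le_max' j hjs) (not_le.2 hj)
    have hsm : StrictMono (Function.update a k (b k)) := by
      intro i j hij
      by_cases hi : i = k
      · rw [hi] at hij ⊢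
        rw [Function.update_self, Function.update_of_ne hij.ne', habove j hij]
        exact hb hij
      · rw [Function.update_of_ne hi]
        by_cases hj : j = k
        · rw [hj] at hij ⊢
          rw [Function.update_self]
          exact (ha hij).trans_le (hle k)
        · rw [Function.update_of_ne hj]; exact ha hij
    refine ih (Function.update a k (b k)) b (s.erase k) ?_ hsm hb ?_ ?_ (hP a k _ ha hsm hPa)
    · rw [Finset.card_erase_of_mem hks]; omega
    · intro j
      by_cases hj : j = k
      · rw [hj, Function.update_self]
      · rw [Function.update_of_ne hj]; exact hle j
    · intro j hj
      by_cases hjk : j = k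
      · rw [hjk, Function.update_self]
      · rw [Function.update_of_ne hjk]
        exact h j fun hjs => hj (Finset.mem_erase.2 ⟨hjk, hjs⟩)

theorem chain_down {P : (ℤ → ℝ) → Prop} (hP : MoveClosed P) (N : ℕ) : ∀ (a b : ℤ → ℝ)
    (s : Finset ℤ), s.card = N → StrictMono a → StrictMono b → (∀ k, b k ≤ a k) →
    (∀ k, k ∉ s → a k = b k) → P a → P b := by
  induction N with
  | zero =>
    intro a b s hs _ _ _ h hPa
    have : a = b := funext fun k => h k (by simp [Finset.card_eq_zero.1 hs])
    rwa [← this]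
  | succ N ih =>
    intro a b s hs ha hb hle h hPa
    have hne : s.Nonempty := Finset.card_pos.1 (by omega)
    set k := s.min' hne with hk
    have hks : k ∈ s := s.min'_mem hne
    have hbelow : ∀ j, j < k → a j = b j := fun j hj => h j fun hjs =>
      absurd (s.min'_le j hjs) (not_le.2 hj)
    have hsm : StrictMono (Function.update a k (b k)) := by
      intro i j hij
      by_cases hi : i = k
      · rw [hi] at hij ⊢
        rw [Function.update_self, Function.update_of_ne hij.ne']
        exact (hle k).trans_lt (ha hij)
      · rw [Function.update_of_ne hi]
        by_cases hj : j = k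
        · rw [hj] at hij ⊢
          rw [Function.update_self, hbelow i hij]
          exact hb hij
        · rw [Function.update_of_ne hj]; exact ha hij
    refine ih (Function.update a k (b k)) b (s.erase k) ?_ hsm hb ?_ ?_ (hP a k _ ha hsm hPa)
    · rw [Finset.card_erase_of_mem hks]; omega
    · intro j
      by_cases hj : j = k
      · rw [hj, Function.update_self]
      · rw [Function.update_of_ne hj]; exact hle j
    · intro j hj
      by_cases hjk : j = k
      · rw [hjk, Function.update_self]
      · rw [Function.update_of_ne hjk]
        exact h j fun hjs => hj (Finset.mem_erase.2 ⟨hjk, hjs⟩)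

theorem chain {P : (ℤ → ℝ) → Prop} (hP : MoveClosed P) {a b : ℤ → ℝ} (ha : StrictMono a)
    (hb : StrictMono b) (s : Finset ℤ) (h : ∀ k, k ∉ s → a k = b k) (hPa : P a) : P b := by
  have hm : StrictMono (fun k => max (a k) (b k)) := fun i j hij => max_lt_max (ha hij) (hb hij)
  refine chain_down hP _ _ b s rfl hm hb (fun k => le_max_right _ _)
    (fun k hk => by simp [h k hk]) ?_
  exact chain_up hP _ a _ s rfl ha hm (fun k => le_max_left _ _) (fun k hk => by simp [h k hk]) hPa

/-- The spectral data of `ψ` is the interlacing sequence `a`. -/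
def Data (ψ : ℝ → ℂ) (a : ℤ → ℝ) : Prop :=
  (∀ l, (V1 ψ l).re = 0 ↔ ∃ n : ℤ, a (2 * n + 1) = l) ∧
  (∀ l, (V1 ψ l).im = 0 ↔ ∃ n : ℤ, a (2 * n) = l)

theorem between {a : ℤ → ℝ} (ha : StrictMono a) {k j : ℤ} {t : ℝ}
    (hu : StrictMono (Function.update a k t)) (hj : a j ∈ uIcc (a k) t) : j = k := by
  by_contra hne
  rcases lt_or_gt_of_ne hne with h | h
  · have h1 := ha h
    have h2 := hu h
    rw [Function.update_self, Function.update_of_ne hne] at h2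
    rcases mem_uIcc.1 hj with h3 | h3
    · linarith [h3.1]
    · linarith [h3.1]
  · have h1 := ha h
    have h2 := hu h
    rw [Function.update_self, Function.update_of_ne hne] at h2
    rcases mem_uIcc.1 hj with h3 | h3
    · linarith [h3.2]
    · linarith [h3.2]

/-- abstract zero-set bookkeeping for one move -/
theorem zeros_move {f g : ℝ → ℝ} {b : ℤ → ℝ} (hb : Function.Injective b) {n : ℤ} {t : ℝ}
    (hf : ∀ l, f l = 0 ↔ ∃ m : ℤ, b m = l)
    (hfg : ∀ l, (l - b n) * g l = (l - t) * f l) (hne : b n ≠ t → g (b n) ≠ 0) (ht : b n ≠ t) :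
    ∀ l, g l = 0 ↔ ∃ m : ℤ, Function.update b n t m = l := by
  intro l
  constructor
  · intro h
    have h1 := hfg l
    rw [h, mul_zero] at h1
    rcases mul_eq_zero.1 h1.symm with h2 | h2
    · exact ⟨n, by rw [Function.update_self]; linarith⟩
    · obtain ⟨m, hm⟩ := (hf l).1 h2
      have : m ≠ n := fun e => hne ht (by rw [← e, hm]; exact h)
      exact ⟨m, by rw [Function.update_of_ne this, hm]⟩
  · rintro ⟨m, hm⟩
    by_cases hmn : m = n
    · rw [hmn, Function.update_self] at hm
      have h1 := hfg l
      rw [hm, sub_self, zero_mul] at h1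
      refine (mul_eq_zero.1 h1).resolve_left ?_
      rw [← hm]; exact sub_ne_zero.2 ht.symm
    · rw [Function.update_of_ne hmn] at hm
      have h1 := hfg l
      rw [(hf l).2 ⟨m, hm⟩, mul_zero] at h1
      refine (mul_eq_zero.1 h1).resolve_left ?_
      rw [← hm]; exact sub_ne_zero.2 (fun e => hmn (hb e))

theorem data_move {ψ : ℝ → ℂ} (hψ : IntervalIntegrable ψ volume 0 1) {a : ℤ → ℝ} {k : ℤ} {t : ℝ}
    (ha : StrictMono a) (hu : StrictMono (Function.update a k t)) (hd : Data ψ a) (ht : a k ≠ t) :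
    ∃ χ : ℝ → ℂ, Continuous χ ∧ Data (fun x => ψ x + χ x) (Function.update a k t) ∧
      (∀ l, (k % 2 = 1 → (V1 (fun x => ψ x + χ x) l).im = (V1 ψ l).im ∧
        (l - a k) * (V1 (fun x => ψ x + χ x) l).re = (l - t) * (V1 ψ l).re) ∧
       (k % 2 = 0 → (V1 (fun x => ψ x + χ x) l).re = (V1 ψ l).re ∧
        (l - a k) * (V1 (fun x => ψ x + χ x) l).im = (l - t) * (V1 ψ l).im)) := by
  rcases Int.emod_two_eq_zero_or_one k with hk | hk
  · obtain ⟨n, rfl⟩ : ∃ n, k = 2 * n := ⟨k / 2, by omega⟩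
    have e1 : ∀ V : ℂ, (conj I * V).re = V.im := fun V => by simp
    have e2 : ∀ V : ℂ, (conj I * V).im = -V.re := fun V => by simp
    obtain ⟨χ, hχ, H⟩ := darboux hψ I (by simp) (a (2 * n)) t
      (by rw [e1]; exact (hd.2 _).2 ⟨n, rfl⟩) (by
        intro l hl h0
        rw [e2] at h0
        obtain ⟨m, hm⟩ := (hd.1 l).1 (neg_eq_zero.1 h0)
        rw [← hm] at hl
        have := between ha hu hl
        omega)
    obtain ⟨h1, h2, h3⟩ := H _ rfl
    simp only [e1, e2, neg_inj] at h1 h2 h3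
    refine ⟨χ, hχ, ⟨?_, ?_⟩, fun l => ⟨fun h => by omega, fun _ => ⟨h1 l, h2 l⟩⟩⟩
    · intro l
      rw [h1, hd.1 l]
      refine exists_congr fun m => ?_
      rw [Function.update_of_ne (by omega)]
    · have := zeros_move (b := fun n => a (2 * n)) (n := n) (t := t)
        (fun i j h => by have := ha.injective h; omega) hd.2 h2 h3 ht
      intro l
      rw [this l]
      refine exists_congr fun m => ?_
      by_cases hm : m = n
      · rw [hm, Function.update_self, Function.update_self]
      · rw [Function.update_of_ne hm, Function.update_of_ne (by omega)]
  · obtain ⟨n, rfl⟩ : ∃ n, k = 2 * n + 1 := ⟨k / 2, by omega⟩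
    have e1 : ∀ V : ℂ, (conj (1:ℂ) * V).re = V.re := fun V => by simp
    have e2 : ∀ V : ℂ, (conj (1:ℂ) * V).im = V.im := fun V => by simp
    obtain ⟨χ, hχ, H⟩ := darboux hψ 1 (by simp) (a (2 * n + 1)) t
      (by rw [e1]; exact (hd.1 _).2 ⟨n, rfl⟩) (by
        intro l hl h0
        rw [e2] at h0
        obtain ⟨m, hm⟩ := (hd.2 l).1 h0
        rw [← hm] at hl
        have := between ha hu hl
        omega)
    obtain ⟨h1, h2, h3⟩ := H _ rfl
    simp only [e1, e2, neg_inj] at h1 h2 h3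
    refine ⟨χ, hχ, ⟨?_, ?_⟩, fun l => ⟨fun _ => ⟨h1 l, h2 l⟩, fun h => by omega⟩⟩
    · have := zeros_move (b := fun n => a (2 * n + 1)) (n := n) (t := t)
        (fun i j h => by have := ha.injective h; omega) hd.1 h2 h3 ht
      intro l
      rw [this l]
      refine exists_congr fun m => ?_
      by_cases hm : m = n
      · rw [hm, Function.update_self, Function.update_self]
      · rw [Function.update_of_ne hm, Function.update_of_ne (by omega)]
    · intro l
      rw [h1, hd.2 l]
      refine exists_congr fun m => ?_
      rw [Function.update_of_ne (by omega)]

theorem cont_memLp {χ : ℝ → ℂ} (h : Continuous χ) (p : ℝ≥0∞) : MemLp χ p μ01 := by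
  have : IsFiniteMeasure μ01 := by unfold μ01; infer_instance
  obtain ⟨C, hC⟩ := (isCompact_Icc (a := (0:ℝ)) (b := 1)).bddAbove_image h.norm.continuousOn
  refine MemLp.of_bound h.aestronglyMeasurable C ?_
  rw [μ01, ae_restrict_iff' measurableSet_Ioo]
  exact Eventually.of_forall fun x hx => hC (mem_image_of_mem _ ⟨hx.1.le, hx.2.le⟩)

theorem ex_closed {p : ℝ≥0∞} (hp : 1 ≤ p) :
    MoveClosed (fun a => ∃ ψ, MemLp ψ p μ01 ∧ Data ψ a) := by
  rintro a k t ha hu ⟨ψ, hψ, hd⟩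
  by_cases ht : a k = t
  · rw [← ht, Function.update_eq_self]; exact ⟨ψ, hψ, hd⟩
  obtain ⟨χ, hχ, h1, -⟩ := data_move (ii_of_memLp hp hψ) ha hu hd ht
  exact ⟨_, hψ.add (cont_memLp hχ p), h1⟩

def UniqV (a : ℤ → ℝ) : Prop := ∀ ψ ψ' : ℝ → ℂ, IntervalIntegrable ψ volume 0 1 →
  IntervalIntegrable ψ' volume 0 1 → Data ψ a → Data ψ' a → ∀ l, V1 ψ l = V1 ψ' l

theorem eq_of_factor {f g h : ℝ → ℝ} (hf : Continuous f) (hg : Continuous g) (t s : ℝ)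
    (h1 : ∀ l, (l - s) * h l = (l - t) * f l) (h2 : ∀ l, (l - s) * h l = (l - t) * g l) :
    ∀ l, f l = g l := by
  have hd : Dense ({t}ᶜ : Set ℝ) := dense_compl_singleton t
  have : f = g := Continuous.ext_on hd hf hg fun l hl => by
    have : (l - t) * f l = (l - t) * g l := by rw [← h1, h2]
    exact mul_left_cancel₀ (sub_ne_zero.2 hl) this
  exact fun l => congrFun this l

theorem uniq_closed : MoveClosed UniqV := by
  intro a k t ha hu hU
  by_cases ht : a k = t
  · rw [← ht, Function.update_eq_self]; exact hU
  intro ψ ψ' hψ hψ' hd hd'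
  set b := Function.update a k t with hb
  have hba : Function.update b k (a k) = a := by rw [hb]; simp
  have hbk : b k = t := by rw [hb]; simp
  have hne : b k ≠ a k := by rw [hbk]; exact fun h => ht h.symm
  have hu' : StrictMono (Function.update b k (a k)) := by rw [hba]; exact ha
  obtain ⟨χ, hχ, h1, h2⟩ := data_move hψ hu hu' hd hne
  obtain ⟨χ', hχ', h1', h2'⟩ := data_move hψ' hu hu' hd' hne
  rw [hba] at h1 h1'
  have hV := hU _ _ (hψ.add (hχ.intervalIntegrable _ _)) (hψ'.add (hχ'.intervalIntegrable _ _)) h1 h1'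
  have cr : ∀ {φ : ℝ → ℂ}, IntervalIntegrable φ volume 0 1 → Continuous fun l => (V1 φ l).re :=
    fun h => continuous_re.comp (V1_cont h)
  have ci : ∀ {φ : ℝ → ℂ}, IntervalIntegrable φ volume 0 1 → Continuous fun l => (V1 φ l).im :=
    fun h => continuous_im.comp (V1_cont h)
  rcases Int.emod_two_eq_zero_or_one k with hk | hk
  · have g := fun l => (h2 l).2 hk
    have g' := fun l => (h2' l).2 hk
    intro l
    apply Complex.ext
    · rw [← (g l).1, ← (g' l).1, hV]
    · refine eq_of_factor (ci hψ) (ci hψ') (a k) (b k) (fun l => (g l).2) (fun l => ?_) l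
      rw [hV]; exact (g' l).2
  · have g := fun l => (h2 l).1 hk
    have g' := fun l => (h2' l).1 hk
    intro l
    apply Complex.ext
    · refine eq_of_factor (cr hψ) (cr hψ') (a k) (b k) (fun l => (g l).2) (fun l => ?_) l
      rw [hV]; exact (g' l).2
    · rw [← (g l).1, ← (g' l).1, hV]


section mulLp
variable {α : Type*} [MeasurableSpace α] {μ : Measure α} {p : ℝ≥0∞}

theorem mul_memLp {m f : α → ℂ} (hm : AEStronglyMeasurable m μ) (hb : ∀ x, ‖m x‖ ≤ 1)
    (hf : MemLp f p μ) : MemLp (fun x => m x * f x) p μ := by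
  refine hf.of_le (hm.mul hf.1) (Eventually.of_forall fun x => ?_)
  rw [norm_mul]
  exact mul_le_of_le_one_left (norm_nonneg _) (hb x)

variable [Fact (1 ≤ p)]

/-- multiplication by a bounded measurable function. -/
def mulLp (m : α → ℂ) (hm : AEStronglyMeasurable m μ) (hb : ∀ x, ‖m x‖ ≤ 1) :
    Lp ℂ p μ →L[ℂ] Lp ℂ p μ :=
  LinearMap.mkContinuous
    { toFun := fun f => (mul_memLp hm hb (Lp.memLp f)).toLp
      map_add' := fun f g => by
        rw [← MemLp.toLp_add]
        apply MemLp.toLp_congr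
        filter_upwards [Lp.coeFn_add f g] with x hx
        simp only [hx, Pi.add_apply, mul_add]
      map_smul' := fun c f => by
        rw [RingHom.id_apply, ← MemLp.toLp_const_smul]
        apply MemLp.toLp_congr
        filter_upwards [Lp.coeFn_smul c f] with x hx
        simp [hx]; ring } 1 (fun f => by
    rw [one_mul]
    apply Lp.norm_le_norm_of_ae_le
    filter_upwards [(mul_memLp hm hb (Lp.memLp f)).coeFn_toLp] with x hx
    simp only [LinearMap.coe_mk, AddHom.coe_mk]
    rw [hx, norm_mul]
    exact mul_le_of_le_one_left (norm_nonneg _) (hb x))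

theorem mulLp_coe {m : α → ℂ} (hm : AEStronglyMeasurable m μ) (hb : ∀ x, ‖m x‖ ≤ 1) (f : Lp ℂ p μ) :
    (mulLp m hm hb f : α → ℂ) =ᵐ[μ] fun x => m x * f x :=
  (mul_memLp hm hb (Lp.memLp f)).coeFn_toLp

theorem mulLp_norm {m : α → ℂ} (hm : AEStronglyMeasurable m μ) (hb : ∀ x, ‖m x‖ ≤ 1) :
    ‖(mulLp m hm hb : Lp ℂ p μ →L[ℂ] Lp ℂ p μ)‖ ≤ 1 :=
  LinearMap.mkContinuous_norm_le _ zero_le_one _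

theorem mulLp_pow {m : α → ℂ} (hm : AEStronglyMeasurable m μ) (hb : ∀ x, ‖m x‖ ≤ 1) (j : ℕ)
    (f : Lp ℂ p μ) :
    (((mulLp m hm hb : Lp ℂ p μ →L[ℂ] Lp ℂ p μ) ^ j) f : α → ℂ) =ᵐ[μ] fun x => m x ^ j * f x := by
  induction j with
  | zero => simp
  | succ j ih =>
    rw [pow_succ', mul_apply_eq_comp]
    filter_upwards [mulLp_coe hm hb (((mulLp m hm hb : Lp ℂ p μ →L[ℂ] Lp ℂ p μ) ^ j) f), ih] with x h1 h2
    rw [h1, h2]; ring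

variable [IsProbabilityMeasure μ]

theorem Lp_int1 (f : Lp ℂ p μ) : Integrable f μ :=
  (Lp.memLp f).integrable Fact.out

theorem Lp_norm1 (f : Lp ℂ p μ) : ∫ x, ‖f x‖ ∂μ ≤ ‖f‖ := by
  rw [integral_norm_eq_lintegral_enorm (Lp.aestronglyMeasurable f), ← eLpNorm_one_eq_lintegral_enorm,
    Lp.norm_def]
  exact ENNReal.toReal_mono (Lp.eLpNorm_ne_top f)
    (eLpNorm_le_eLpNorm_of_exponent_le Fact.out (Lp.aestronglyMeasurable f))

/-- integral as a continuous functional. -/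
def intLp : Lp ℂ p μ →L[ℂ] ℂ :=
  LinearMap.mkContinuous
    { toFun := fun f => ∫ x, f x ∂μ
      map_add' := fun f g => by
        rw [← integral_add (Lp_int1 f) (Lp_int1 g)]
        exact integral_congr_ae (Lp.coeFn_add f g)
      map_smul' := fun c f => by
        rw [RingHom.id_apply, ← integral_smul]
        exact integral_congr_ae (Lp.coeFn_smul c f) } 1 (fun f => by
    rw [one_mul]
    exact (norm_integral_le_integral_norm _).trans (Lp_norm1 f))

theorem intLp_apply (f : Lp ℂ p μ) : intLp f = ∫ x, f x ∂μ := rfl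
end mulLp

/-- Normalised Haar measure on the unit circle. -/
abbrev hT : Measure (AddCircle (1:ℝ)) := AddCircle.haarAddCircle

/-- the representative in (0,1]. -/
def tau (t : AddCircle (1:ℝ)) : ℝ := ((AddCircle.equivIoc (1:ℝ) 0 t : Ioc (0:ℝ) (0+1)) : ℝ)

theorem tau_coe {x : ℝ} (hx : x ∈ Ioc (0:ℝ) 1) : tau (x : AddCircle (1:ℝ)) = x :=
  AddCircle.equivIoc_coe_of_mem (by simpa using hx)

theorem coe_tau (t : AddCircle (1:ℝ)) : ((tau t : ℝ) : AddCircle (1:ℝ)) = t :=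
  AddCircle.coe_equivIoc

theorem tau_mem (t : AddCircle (1:ℝ)) : tau t ∈ Ioc (0:ℝ) 1 := by
  have := (AddCircle.equivIoc (1:ℝ) 0 t).2
  simpa [tau] using this

theorem tau_meas : Measurable tau :=
  measurable_subtype_coe.comp (AddCircle.measurableEquivIoc (1:ℝ) 0).measurable

theorem vol_eq_hT : (volume : Measure (AddCircle (1:ℝ))) = hT := by
  rw [AddCircle.volume_eq_smul_haarAddCircle]; simp

theorem mu01_Ioc : μ01 = volume.restrict (Ioc (0:ℝ) 1) := by
  rw [μ01]; exact (Measure.restrict_congr_set Ioo_ae_eq_Ioc)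

theorem mk_mp : MeasurePreserving (fun x : ℝ => (x : AddCircle (1:ℝ))) μ01 hT := by
  rw [mu01_Ioc, ← vol_eq_hT]
  have := AddCircle.measurePreserving_mk (1:ℝ) 0
  simpa using this

theorem tau_mp : MeasurePreserving tau hT μ01 := by
  refine ⟨tau_meas, ?_⟩
  rw [← mk_mp.map_eq, Measure.map_map tau_meas mk_mp.measurable, mu01_Ioc]
  conv_rhs => rw [← Measure.map_id (μ := volume.restrict (Ioc (0:ℝ) 1))]
  refine Measure.map_congr ?_
  filter_upwards [ae_restrict_mem measurableSet_Ioc] with x hx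
  exact tau_coe hx

instance : IsProbabilityMeasure μ01 := ⟨by rw [mu01_Ioc]; simp⟩

theorem int_circ {F : AddCircle (1:ℝ) → ℂ} (hF : AEStronglyMeasurable F hT) :
    ∫ t, F t ∂hT = ∫ x in (0:ℝ)..1, F x := by
  rw [intervalIntegral.integral_of_le zero_le_one, ← mu01_Ioc, ← mk_mp.map_eq,
    integral_map mk_mp.measurable.aemeasurable (by rw [mk_mp.map_eq]; exact hF)]

theorem int_tau {g : ℝ → ℂ} (hg : AEStronglyMeasurable g μ01) :
    ∫ t, g (tau t) ∂hT = ∫ x in (0:ℝ)..1, g x := by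
  rw [intervalIntegral.integral_of_le zero_le_one, ← mu01_Ioc, ← tau_mp.map_eq,
    integral_map tau_meas.aemeasurable (by rw [tau_mp.map_eq]; exact hg)]


section circ
variable {p : ℝ≥0∞} [Fact (1 ≤ p)]

theorem fourier_nm (n : ℤ) (t : AddCircle (1:ℝ)) : ‖(fourier n t : ℂ)‖ ≤ 1 := by
  exact ((fourier n).norm_coe_le_norm t).trans (fourier_norm n).le

theorem fourier_aesm (n : ℤ) : AEStronglyMeasurable (fun t : AddCircle (1:ℝ) => (fourier n t : ℂ)) hT :=
  (fourier n).continuous.aestronglyMeasurable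

/-- Fourier coefficient functional. -/
def eF (n : ℤ) : Lp ℂ p hT →L[ℂ] ℂ :=
  intLp.comp (mulLp (fun t => fourier (-n) t) (fourier_aesm _) (fourier_nm _))

theorem eF_apply (n : ℤ) (f : Lp ℂ p hT) : eF n f = ∫ t, (fourier (-n) t : ℂ) * f t ∂hT := by
  simp only [eF, ContinuousLinearMap.comp_apply, intLp_apply]
  exact integral_congr_ae (mulLp_coe _ _ f)

theorem sub_mp (s : AddCircle (1:ℝ)) : MeasurePreserving (fun t => t - s) hT hT :=
  measurePreserving_sub_right _ s

/-- translation. -/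
def trL (s : AddCircle (1:ℝ)) (f : Lp ℂ p hT) : Lp ℂ p hT :=
  Lp.compMeasurePreserving (fun t => t - s) (sub_mp s) f

theorem trL_norm (s) (f : Lp ℂ p hT) : ‖trL s f‖ = ‖f‖ := Lp.norm_compMeasurePreserving _ _

theorem trL_add (s) (f g : Lp ℂ p hT) : trL s (f + g) = trL s f + trL s g := map_add _ _ _

theorem trL_smul (s) (c : ℂ) (f : Lp ℂ p hT) : trL s (c • f) = c • trL s f := by
  exact map_smul (Lp.compMeasurePreservingₗ ℂ (fun t => t - s) (sub_mp s)) c f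

theorem trL_cont (hp : p ≠ ∞) (f : Lp ℂ p hT) : Continuous (fun s => trL s f) := by
  have hg : Continuous (fun s : AddCircle (1:ℝ) =>
      (⟨fun t => t - s, by fun_prop⟩ : C(AddCircle (1:ℝ), AddCircle (1:ℝ)))) :=
    ContinuousMap.continuous_of_continuous_uncurry _ (by
      simp only [Function.uncurry_def, ContinuousMap.coe_mk]; fun_prop)
  exact Continuous.compMeasurePreservingLp (continuous_const (y := f)) hg (fun z => sub_mp z) hp

theorem eF_trL (n : ℤ) (s) (f : Lp ℂ p hT) : eF n (trL s f) = fourier (-n) s * eF n f := by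
  rw [eF_apply, eF_apply, ← integral_const_mul]
  have h1 : ∫ t, (fourier (-n) t : ℂ) * trL s f t ∂hT
      = ∫ t, (fourier (-n) t : ℂ) * f (t - s) ∂hT := by
    refine integral_congr_ae ?_
    filter_upwards [Lp.coeFn_compMeasurePreserving f (sub_mp s)] with t ht
    simp only [trL, ht, Function.comp]
  rw [h1, ← integral_sub_right_eq_self (fun t => fourier (-n) s * ((fourier (-n) t : ℂ) * f t)) s]
  refine integral_congr_ae (Eventually.of_forall fun t => ?_)
  simp only
  rw [← mul_assoc]
  congr 1
  simp only [fourier_apply, ← Circle.coe_mul, ← AddCircle.toCircle_add, ← smul_add]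
  simp

theorem conv_int (hp : p ≠ ∞) (g f : Lp ℂ p hT) : Integrable (fun s => g s • trL s f) hT :=
  (Lp_int1 g).smul_of_top_left (memLp_top_of_bound (trL_cont hp f).aestronglyMeasurable ‖f‖
    (Eventually.of_forall fun s => (trL_norm s f).le))

/-- convolution operator. -/
def convL (hp : p ≠ ∞) (g : Lp ℂ p hT) : Lp ℂ p hT →L[ℂ] Lp ℂ p hT :=
  LinearMap.mkContinuous
    { toFun := fun f => ∫ s, g s • trL s f ∂hT
      map_add' := fun f h => by
        rw [← integral_add (conv_int hp g f) (conv_int hp g h)]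
        simp only [trL_add, smul_add]
      map_smul' := fun c f => by
        rw [RingHom.id_apply, ← integral_smul]
        simp only [trL_smul, smul_comm c] } ‖g‖ (fun f => by
    simp only [LinearMap.coe_mk, AddHom.coe_mk]
    refine (norm_integral_le_integral_norm _).trans ?_
    simp only [norm_smul, trL_norm, integral_mul_const]
    exact mul_le_mul_of_nonneg_right (Lp_norm1 g) (norm_nonneg _))

theorem convL_norm (hp : p ≠ ∞) (g : Lp ℂ p hT) : ‖convL hp g‖ ≤ ‖g‖ :=
  LinearMap.mkContinuous_norm_le _ (norm_nonneg _) _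

theorem eF_convL (hp : p ≠ ∞) (g f : Lp ℂ p hT) (n : ℤ) :
    eF n (convL hp g f) = eF n g * eF n f := by
  have : convL hp g f = ∫ s, g s • trL s f ∂hT := rfl
  rw [this, ← ContinuousLinearMap.integral_comp_comm _ (conv_int hp g f)]
  simp only [map_smul, eF_trL, smul_eq_mul]
  rw [eF_apply n g, ← integral_mul_const]
  congr 1; ext s; ring

theorem eF_convL_pow (hp : p ≠ ∞) (g f : Lp ℂ p hT) (n : ℤ) (j : ℕ) :
    eF n (((convL hp g) ^ j) f) = eF n g ^ j * eF n f := by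
  induction j with
  | zero => simp
  | succ j ih => rw [pow_succ', mul_apply_eq_comp, eF_convL, ih]; ring

/-- the multiplier i(1-2τ). -/
def mm (t : AddCircle (1:ℝ)) : ℂ := I * (1 - 2 * tau t)

theorem mm_aesm : AEStronglyMeasurable mm hT := by
  have : Measurable mm := by
    unfold mm
    have := tau_meas
    fun_prop
  exact this.aestronglyMeasurable

theorem mm_norm (t) : ‖mm t‖ ≤ 1 := by
  have h := tau_mem t
  have : mm t = I * ((1 - 2 * tau t : ℝ) : ℂ) := by simp [mm]
  rw [this, norm_mul, norm_I, one_mul, norm_real, Real.norm_eq_abs, abs_le]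
  constructor <;> linarith [h.1, h.2]

/-- multiplication by `mm`. -/
def MM : Lp ℂ p hT →L[ℂ] Lp ℂ p hT := mulLp mm mm_aesm mm_norm

theorem MM_norm : ‖(MM : Lp ℂ p hT →L[ℂ] Lp ℂ p hT)‖ ≤ 1 := mulLp_norm _ _

/-- terms of the operator series. -/
def TT (hp : p ≠ ∞) (g : Lp ℂ p hT) (j : ℕ) : Lp ℂ p hT →L[ℂ] Lp ℂ p hT :=
  ((j.factorial : ℂ)⁻¹) • ((convL hp g) ^ j * MM ^ j)

theorem TT_zero (hp : p ≠ ∞) (g : Lp ℂ p hT) : TT hp g 0 = 1 := by simp [TT]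

theorem inv_fact_le (j : ℕ) : ‖((j.factorial : ℂ)⁻¹)‖ ≤ 1 := by
  rw [norm_inv, norm_natCast]
  apply inv_le_one_of_one_le₀
  exact_mod_cast j.factorial_pos

theorem opow_norm {X : Type*} [NormedAddCommGroup X] [NormedSpace ℂ X] (A : X →L[ℂ] X) {r : ℝ} (hA : ‖A‖ ≤ r) (j : ℕ) (f : X) :
    ‖(A ^ j) f‖ ≤ r ^ j * ‖f‖ := by
  have hr : 0 ≤ r := (norm_nonneg _).trans hA
  induction j with
  | zero => simp
  | succ j ih =>
    rw [pow_succ', mul_apply_eq_comp]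
    calc _ ≤ r * ‖(A ^ j) f‖ := A.le_of_opNorm_le hA _
      _ ≤ r * (r ^ j * ‖f‖) := by gcongr
      _ = _ := by ring

theorem TT_norm (hp : p ≠ ∞) (g : Lp ℂ p hT) (j : ℕ) : ‖TT hp g j‖ ≤ ‖g‖ ^ j := by
  refine ContinuousLinearMap.opNorm_le_bound _ (by positivity) fun f => ?_
  simp only [TT, FunLike.coe_smul, Pi.smul_apply, mul_apply_eq_comp, norm_smul]
  calc _ ≤ 1 * (‖g‖ ^ j * (1 ^ j * ‖f‖)) := by
        refine mul_le_mul (inv_fact_le j) ((opow_norm _ (convL_norm hp g) j _).trans ?_) (norm_nonneg _) zero_le_one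
        exact mul_le_mul_of_nonneg_left (opow_norm _ MM_norm j f) (by positivity)
    _ = _ := by simp


end circ

theorem hasSum_cast {E : Type*} [AddCommMonoid E] [TopologicalSpace E] {f g : ℕ → E} {a b : E}
    (h : HasSum f a) (hf : ∀ j, g j = f j) (hab : b = a) : HasSum g b := by
  rw [funext hf, hab]; exact h

section circ2
variable {p : ℝ≥0∞} [Fact (1 ≤ p)]

/-- the operator series. -/
def Tser (hp : p ≠ ∞) (g : Lp ℂ p hT) : Lp ℂ p hT →L[ℂ] Lp ℂ p hT := ∑' j, TT hp g j

theorem TT_summable (hp : p ≠ ∞) (g : Lp ℂ p hT) (hg : ‖g‖ ≤ 1/8) : Summable (TT hp g) :=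
  Summable.of_norm_bounded (summable_geometric_of_lt_one (norm_nonneg g) (by linarith)) (TT_norm hp g)

theorem Top_sub (hp : p ≠ ∞) (g : Lp ℂ p hT) (hg : ‖g‖ ≤ 1/8) : ‖1 - Tser hp g‖ ≤ 1/7 := by
  rw [Tser, (TT_summable hp g hg).tsum_eq_zero_add, TT_zero, sub_add_cancel_left, norm_neg]
  have h1 : HasSum (fun j : ℕ => (1/8:ℝ) ^ (j+1)) (1/7) := by
    have := (hasSum_geometric_of_lt_one (r := (1/8:ℝ)) (by norm_num) (by norm_num)).mul_left (1/8)
    exact hasSum_cast this (fun j => by ring) (by norm_num)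
  refine tsum_of_norm_bounded h1 fun j => (TT_norm hp g (j+1)).trans ?_
  gcongr

theorem fourier_mm_int (n : ℤ) (z : ℂ) (f : Lp ℂ p hT) :
    HasSum (fun j : ℕ => ((j.factorial : ℂ)⁻¹) * (z ^ j * eF n ((MM ^ j) f)))
      (∫ t, (fourier (-n) t : ℂ) * (Complex.exp (z * mm t) * f t) ∂hT) := by
  have hA : ∀ j : ℕ, Integrable (fun t => (fourier (-n) t : ℂ) * ((MM ^ j) f) t) hT := fun j =>
    ((Lp_int1 ((MM ^ j) f)).bdd_mul (c := 1) (fourier_aesm _) (Eventually.of_forall (fourier_nm _)))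
  have hae : ∀ j : ℕ, (fun t => (fourier (-n) t : ℂ) * ((MM ^ j) f) t) =ᵐ[hT]
      fun t => (fourier (-n) t : ℂ) * (mm t ^ j * f t) := fun j => by
    filter_upwards [mulLp_pow mm_aesm mm_norm j f] with t ht
    simp only [MM]; rw [ht]
  have hB : ∀ j : ℕ, Integrable (fun t => (fourier (-n) t : ℂ) * (mm t ^ j * f t)) hT := fun j =>
    (hA j).congr (hae j)
  have hbd : ∀ j : ℕ, ∀ t, ‖(fourier (-n) t : ℂ) * (mm t ^ j * f t)‖ ≤ ‖f t‖ := fun j t => by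
    rw [norm_mul, norm_mul, norm_pow]
    calc _ ≤ 1 * (1 ^ j * ‖f t‖) := by
          gcongr
          · exact fourier_nm _ _
          · exact mm_norm t
      _ = _ := by simp
  have key := hasSum_integral_of_summable_integral_norm (μ := hT)
    (F := fun (j : ℕ) t => ((j.factorial : ℂ)⁻¹ * z ^ j) * ((fourier (-n) t : ℂ) * (mm t ^ j * f t)))
    (fun j => (hB j).const_mul _) (by
      refine Summable.of_nonneg_of_le (fun j => integral_nonneg fun t => norm_nonneg _) (fun j => ?_)
        ((Real.summable_pow_div_factorial ‖z‖).mul_right (∫ t, ‖f t‖ ∂hT))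
      simp only [norm_mul ((_:ℂ) * _) _]
      rw [integral_const_mul]
      refine mul_le_mul (le_of_eq ?_) (integral_mono (hB j).norm (Lp_int1 f).norm fun t => hbd j t)
        (integral_nonneg fun t => norm_nonneg _) (by positivity)
      rw [norm_mul, norm_inv, norm_natCast, norm_pow, div_eq_inv_mul])
  refine hasSum_cast key (fun j => ?_) ?_
  · rw [integral_const_mul, eF_apply, integral_congr_ae (hae j), mul_assoc]
  · refine integral_congr_ae (Eventually.of_forall fun t => ?_)
    simp only
    have h2 := (NormedSpace.expSeries_div_hasSum_exp (z * mm t))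
    rw [← Complex.exp_eq_exp_ℂ] at h2
    have h3 := (h2.mul_right (f t)).mul_left (fourier (-n) t : ℂ)
    rw [← h3.tsum_eq]
    congr 1; ext j
    rw [mul_pow]
    field_simp

theorem eF_Top (hp : p ≠ ∞) (g f : Lp ℂ p hT) (hg : ‖g‖ ≤ 1/8) (n : ℤ) :
    eF n (Tser hp g f) = ∫ t, (fourier (-n) t : ℂ) * (Complex.exp (eF n g * mm t) * f t) ∂hT := by
  rw [← (fourier_mm_int n (eF n g) f).tsum_eq, Tser]
  have h1 := (TT_summable hp g hg).hasSum
  have h2 := (h1.mapL (ContinuousLinearMap.apply ℂ (Lp ℂ p hT) f)).mapL (eF n)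
  rw [← ContinuousLinearMap.apply_apply (𝕜 := ℂ) f, ← h2.tsum_eq]
  congr 1; ext j
  simp only [ContinuousLinearMap.apply_apply, TT, FunLike.coe_smul, Pi.smul_apply, mul_apply_eq_comp,
    map_smul, eF_convL_pow, smul_eq_mul]

theorem sin_series (hp : p ≠ ∞) (g : Lp ℂ p hT) (hg : ‖g‖ ≤ 1/8) :
    ∃ s : Lp ℂ p hT, ‖s‖ ≤ 2 * ‖g‖ ∧ ∀ n, eF n s = Complex.sin (eF n g) := by
  set F : ℕ → Lp ℂ p hT := fun j =>
    ((-1) ^ j * (((2 * j + 1).factorial : ℂ)⁻¹)) • ((convL hp g) ^ (2 * j)) g with hF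
  have hb : ∀ j, ‖F j‖ ≤ (1/2:ℝ) ^ j * ‖g‖ := fun j => by
    rw [hF]; simp only [norm_smul, norm_mul, norm_pow, norm_neg, norm_one, one_pow, one_mul]
    calc _ ≤ 1 * (‖g‖ ^ (2 * j) * ‖g‖) := by
          exact mul_le_mul (inv_fact_le _) (opow_norm _ (convL_norm hp g) _ _) (norm_nonneg _) zero_le_one
      _ ≤ _ := by
          rw [one_mul, pow_mul]
          gcongr
          nlinarith [norm_nonneg g]
  have hs2 : HasSum (fun j : ℕ => (1/2:ℝ) ^ j * ‖g‖) (2 * ‖g‖) := by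
    have := (hasSum_geometric_of_lt_one (r := (1/2:ℝ)) (by norm_num) (by norm_num)).mul_right ‖g‖
    exact hasSum_cast this (fun j => rfl) (by norm_num)
  have hsum : Summable F := Summable.of_norm_bounded hs2.summable hb
  refine ⟨∑' j, F j, tsum_of_norm_bounded hs2 hb, fun n => ?_⟩
  have h2 := hsum.hasSum.mapL (eF n)
  refine h2.unique ?_
  refine hasSum_cast (Complex.hasSum_sin (eF n g)) (fun j => ?_) rfl
  simp only [hF, map_smul, eF_convL_pow, smul_eq_mul]
  ring

theorem circ_solve0 (hp : p ≠ ∞) (g : Lp ℂ p hT) (hg : ‖g‖ ≤ 1/8) :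
    ∃ c : Lp ℂ p hT, ‖c‖ ≤ 3 * ‖g‖ ∧ ∀ n,
      ∫ t, (fourier (-n) t : ℂ) * (Complex.exp (eF n g * mm t) * c t) ∂hT = Complex.sin (eF n g) := by
  obtain ⟨s, hs, hs'⟩ := sin_series hp g hg
  have hT1 := Top_sub hp g hg
  let u := Units.oneSub (1 - Tser hp g) (by linarith)
  have hu : (u : Lp ℂ p hT →L[ℂ] Lp ℂ p hT) = Tser hp g := by simp [u]
  have hTc : Tser hp g ((↑u⁻¹ : Lp ℂ p hT →L[ℂ] Lp ℂ p hT) s) = s := by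
    rw [← hu, ← mul_apply_eq_comp, Units.mul_inv]; rfl
  generalize hc : (↑u⁻¹ : Lp ℂ p hT →L[ℂ] Lp ℂ p hT) s = c at hTc
  refine ⟨c, ?_, fun n => ?_⟩
  · have h1 : c = s + (1 - Tser hp g) c := by
      simp [hTc]
    have h2 : ‖c‖ ≤ ‖s‖ + 1/7 * ‖c‖ := by
      calc ‖c‖ = ‖s + (1 - Tser hp g) c‖ := by rw [← h1]
        _ ≤ ‖s‖ + ‖(1 - Tser hp g) c‖ := norm_add_le _ _
        _ ≤ _ := by gcongr; exact ContinuousLinearMap.le_of_opNorm_le _ hT1 c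
    have h3 : (0:ℝ) ≤ ‖g‖ := norm_nonneg g
    have h4 : ∀ x y z : ℝ, x ≤ y + 1/7 * x → y ≤ 2 * z → 0 ≤ z → x ≤ 3 * z := fun x y z _ _ _ => by linarith
    exact h4 _ _ _ h2 hs h3
  · rw [← eF_Top hp g c hg, hTc, hs']

end circ2

/-- Fourier uniqueness in L_1 of the circle. -/
theorem fourier_unique {f : AddCircle (1:ℝ) → ℂ} (hf : Integrable f hT)
    (h : ∀ n : ℤ, ∫ t, (fourier n t : ℂ) * f t ∂hT = 0) : f =ᵐ[hT] 0 := by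
  have hb : ∀ φ : C(AddCircle (1:ℝ), ℂ), Integrable (fun t => φ t * f t) hT := fun φ =>
    hf.bdd_mul (c := ‖φ‖) φ.continuous.aestronglyMeasurable (Eventually.of_forall φ.norm_coe_le_norm)
  have hcont : ∀ φ : C(AddCircle (1:ℝ), ℂ), ∫ t, φ t * f t ∂hT = 0 := by
    let Λ : C(AddCircle (1:ℝ), ℂ) →L[ℂ] ℂ := LinearMap.mkContinuous
      { toFun := fun φ => ∫ t, φ t * f t ∂hT
        map_add' := fun φ χ => by
          rw [← integral_add (hb φ) (hb χ)]; simp [add_mul]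
        map_smul' := fun c φ => by
          rw [RingHom.id_apply, smul_eq_mul, ← integral_const_mul]
          simp [mul_assoc] } (∫ t, ‖f t‖ ∂hT) (fun φ => by
        simp only [LinearMap.coe_mk, AddHom.coe_mk]
        refine (norm_integral_le_integral_norm _).trans ?_
        rw [← integral_mul_const]
        refine integral_mono (hb φ).norm (hf.norm.mul_const _) fun t => ?_
        simp only [norm_mul, mul_comm ‖f t‖]
        gcongr
        exact φ.norm_coe_le_norm t)
    have hle : (Submodule.span ℂ (Set.range (fourier (T := (1:ℝ))))).topologicalClosure ≤ LinearMap.ker Λ.toLinearMap := by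
      refine Submodule.topologicalClosure_minimal _ ?_ (ContinuousLinearMap.isClosed_ker Λ)
      rw [Submodule.span_le]
      rintro _ ⟨n, rfl⟩
      exact h n
    rw [span_fourier_closure_eq_top] at hle
    intro φ
    exact hle (Submodule.mem_top (x := φ))
  refine ae_eq_zero_of_forall_setIntegral_isClosed_eq_zero hf fun s hs => ?_
  have hlim : Tendsto (fun n => ∫ t, ((hs.apprSeq n t : ℝ) : ℂ) * f t ∂hT) atTop
      (𝓝 (∫ t, s.indicator f t ∂hT)) := by
    refine tendsto_integral_of_dominated_convergence (fun t => ‖f t‖) (fun n => ?_) hf.norm (fun n => ?_) ?_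
    · have : Continuous (fun t => ((hs.apprSeq n t : ℝ) : ℂ)) := by
        have := (hs.apprSeq n).continuous
        fun_prop
      exact this.aestronglyMeasurable.mul hf.1
    · refine Eventually.of_forall fun t => ?_
      rw [norm_mul]
      refine mul_le_of_le_one_left (norm_nonneg _) ?_
      simp only [norm_real, NNReal.norm_eq]
      exact_mod_cast HasOuterApproxClosed.apprSeq_apply_le_one hs n t
    · refine Eventually.of_forall fun t => ?_
      have h1 := (tendsto_pi_nhds.1 (HasOuterApproxClosed.tendsto_apprSeq hs)) t
      have h2 : Tendsto (fun n => ((hs.apprSeq n t : ℝ) : ℂ)) atTop (𝓝 (((s.indicator (fun _ => (1:NNReal)) t : NNReal) : ℝ) : ℂ)) := by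
        have hc : Continuous (fun x : NNReal => ((x : ℝ) : ℂ)) := by fun_prop
        exact (hc.tendsto _).comp h1
      have h3 := h2.mul_const (f t)
      convert h3 using 2
      by_cases ht : t ∈ s <;> simp [ht]
  rw [integral_indicator hs.measurableSet] at hlim
  refine tendsto_nhds_unique hlim ?_
  have : ∀ n, ∫ t, ((hs.apprSeq n t : ℝ) : ℂ) * f t ∂hT = 0 := fun n =>
    hcont ⟨fun t => ((hs.apprSeq n t : ℝ) : ℂ), by have := (hs.apprSeq n).continuous; fun_prop⟩
  simp [this]


/-- exponential transform. -/
def ES (c : ℝ → ℂ) (l : ℂ) : ℂ := ∫ x in (0:ℝ)..1, c x * Complex.exp (I * l * (1 - 2 * x))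

/-- circle version of a function on (0,1). -/
def toC {p : ℝ≥0∞} {g : ℝ → ℂ} (hg : MemLp g p μ01) : Lp ℂ p hT :=
  (hg.comp_measurePreserving tau_mp).toLp

theorem toC_coe {p : ℝ≥0∞} {g : ℝ → ℂ} (hg : MemLp g p μ01) : (toC hg : AddCircle (1:ℝ) → ℂ) =ᵐ[hT] fun t => g (tau t) :=
  (hg.comp_measurePreserving tau_mp).coeFn_toLp

theorem toC_norm {p : ℝ≥0∞} {g : ℝ → ℂ} (hg : MemLp g p μ01) : ‖toC hg‖ = (eLpNorm g p μ01).toReal := by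
  rw [toC, Lp.norm_toLp, eLpNorm_comp_measurePreserving hg.1 tau_mp]

theorem fourier_coe1 (n : ℤ) (x : ℝ) : (fourier (-n) (x : AddCircle (1:ℝ)) : ℂ) =
    Complex.exp (-2 * Real.pi * I * n * x) := by
  rw [fourier_coe_apply]; congr 1; push_cast; ring

theorem eF_toC {p : ℝ≥0∞} [Fact (1 ≤ p)] {g : ℝ → ℂ} (hg : MemLp g p μ01) (n : ℤ) : eF n (toC hg) = fc g n := by
  rw [eF_apply, fc]
  have h1 : ∫ t, (fourier (-n) t : ℂ) * toC hg t ∂hT =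
      ∫ t, (fun x : ℝ => Complex.exp (-2 * Real.pi * I * n * x) * g x) (tau t) ∂hT := by
    refine integral_congr_ae ?_
    filter_upwards [toC_coe hg] with t ht
    rw [ht, ← fourier_coe1, coe_tau]
  rw [h1]
  refine int_tau (g := fun x : ℝ => Complex.exp (-2 * Real.pi * I * n * x) * g x) ?_
  exact AEStronglyMeasurable.mul (Continuous.aestronglyMeasurable (by fun_prop)) hg.1

theorem expn_ne (n : ℤ) : Complex.exp (I * (Real.pi * n)) ≠ 0 := Complex.exp_ne_zero _

theorem ES_circ {p : ℝ≥0∞} [Fact (1 ≤ p)] (n : ℤ) (z : ℂ) (c : Lp ℂ p hT) :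
    ES (fun x => c (x : AddCircle (1:ℝ))) (Real.pi * n + z) = Complex.exp (I * (Real.pi * n)) *
      ∫ t, (fourier (-n) t : ℂ) * (Complex.exp (z * mm t) * c t) ∂hT := by
  rw [int_circ, ← intervalIntegral.integral_const_mul, ES]
  · refine intervalIntegral.integral_congr_ae (Eventually.of_forall fun x hx => ?_)
    rw [uIoc_of_le zero_le_one] at hx
    rw [fourier_coe1, mm, tau_coe hx]
    rw [mul_comm (c _), ← mul_assoc, ← mul_assoc, ← mul_assoc, ← Complex.exp_add, ← Complex.exp_add]
    congr 2
    ring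
  · refine (fourier_aesm _).mul (AEStronglyMeasurable.mul ?_ (Lp.aestronglyMeasurable c))
    exact Complex.continuous_exp.comp_aestronglyMeasurable (mm_aesm.const_mul z)

theorem sin_shift (n : ℤ) (z : ℂ) : Complex.sin (Real.pi * n + z) = Complex.exp (I * (Real.pi * n)) * Complex.sin z := by
  have h1 : Complex.sin (Real.pi * n) = 0 := by rw [mul_comm]; exact Complex.sin_int_mul_pi n
  rw [Complex.sin_add, h1, mul_comm I, Complex.exp_mul_I, h1]
  ring

theorem eLp_le_of_toReal {p : ℝ≥0∞} {f : ℝ → ℂ} (hf : MemLp f p μ01) {r : ℝ} (h : (eLpNorm f p μ01).toReal ≤ r) :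
    eLpNorm f p μ01 ≤ ENNReal.ofReal r :=
  (ENNReal.le_ofReal_iff_toReal_le hf.2.ne ((ENNReal.toReal_nonneg).trans h)).2 h

theorem comp_mk_norm {p : ℝ≥0∞} (c : Lp ℂ p hT) :
    (eLpNorm (fun x : ℝ => c (x : AddCircle (1:ℝ))) p μ01).toReal = ‖c‖ := by
  rw [Lp.norm_def]; congr 1
  exact eLpNorm_comp_measurePreserving (Lp.aestronglyMeasurable c) mk_mp

theorem comp_mk_memLp {p : ℝ≥0∞} (c : Lp ℂ p hT) : MemLp (fun x : ℝ => c (x : AddCircle (1:ℝ))) p μ01 :=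
  (Lp.memLp c).comp_measurePreserving mk_mp

theorem circ_solve {p : ℝ≥0∞} (hp : 1 ≤ p) (hp' : p ≠ ∞) {g : ℝ → ℂ} (hg : MemLp g p μ01)
    (hs : (eLpNorm g p μ01).toReal ≤ 1/8) :
    ∃ c, MemLp c p μ01 ∧ (eLpNorm c p μ01).toReal ≤ 3 * (eLpNorm g p μ01).toReal ∧
      ∀ n : ℤ, ES c (Real.pi * n + fc g n) = Complex.sin (Real.pi * n + fc g n) := by
  have : Fact (1 ≤ p) := ⟨hp⟩
  rw [← toC_norm hg] at hs ⊢
  obtain ⟨c, hc, hc'⟩ := circ_solve0 hp' (toC hg) hs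
  refine ⟨fun x => c x, comp_mk_memLp c, by rwa [comp_mk_norm], fun n => ?_⟩
  rw [ES_circ, sin_shift, ← eF_toC hg, hc']

theorem circ_inj {p : ℝ≥0∞} (hp : 1 ≤ p) {g : ℝ → ℂ} (hg : MemLp g p μ01)
    (hs : (eLpNorm g p μ01).toReal ≤ 1/8) {h : ℝ → ℂ} (hh : MemLp h 1 μ01)
    (h0 : ∀ n : ℤ, ES h (Real.pi * n + fc g n) = 0) : h =ᵐ[μ01] 0 := by
  have hg1 : MemLp g 1 μ01 := hg.mono_exponent hp
  have hs1 : ‖toC hg1‖ ≤ 1/8 := by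
    rw [toC_norm]
    exact (ENNReal.toReal_mono hg.2.ne (eLpNorm_le_eLpNorm_of_exponent_le hp hg.1)).trans hs
  have hae : (fun x : ℝ => (toC hh) (x : AddCircle (1:ℝ))) =ᵐ[μ01] h := by
    have h1 := mk_mp.quasiMeasurePreserving.ae_eq_comp (toC_coe hh)
    filter_upwards [h1, (by rw [mu01_Ioc]; exact ae_restrict_mem measurableSet_Ioc : ∀ᵐ x ∂μ01, x ∈ Ioc (0:ℝ) 1)] with x hx hx'
    simp only [Function.comp] at hx
    rw [hx, tau_coe hx']
  have hES : ∀ l, ES (fun x : ℝ => (toC hh) (x : AddCircle (1:ℝ))) l = ES h l := fun l => by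
    rw [ES, ES, intervalIntegral.integral_of_le zero_le_one, intervalIntegral.integral_of_le zero_le_one, ← mu01_Ioc]
    refine integral_congr_ae ?_
    filter_upwards [hae] with x hx
    rw [hx]
  have hz : Tser ENNReal.one_ne_top (toC hg1) (toC hh) = 0 := by
    rw [Lp.eq_zero_iff_ae_eq_zero]
    refine fourier_unique (Lp_int1 _) fun n => ?_
    have := eF_Top ENNReal.one_ne_top (toC hg1) (toC hh) hs1 (-n)
    rw [eF_apply, neg_neg] at this
    rw [this]
    have h2 := ES_circ (-n) (fc g (-n)) (toC hh)
    rw [hES, h0, ← eF_toC hg1, neg_neg] at h2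
    exact (mul_eq_zero.1 h2.symm).resolve_left (Complex.exp_ne_zero _)
  have hT1 := Top_sub ENNReal.one_ne_top (toC hg1) hs1
  have h3 : ‖toC hh‖ ≤ 1/7 * ‖toC hh‖ := by
    have := ContinuousLinearMap.le_of_opNorm_le _ hT1 (toC hh)
    simpa [hz] using this
  have h4 : toC hh = 0 := by
    rw [← norm_le_zero_iff]
    have h5 : ∀ x : ℝ, x ≤ 1/7 * x → x ≤ 0 := fun x _ => by linarith
    exact h5 _ h3
  have h6 := (Lp.eq_zero_iff_ae_eq_zero).1 h4
  have h7 := mk_mp.quasiMeasurePreserving.ae_eq_comp h6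
  filter_upwards [hae, h7] with x h1 h2
  simp only [Function.comp, Pi.zero_apply] at h2
  rw [← h1, h2]; rfl

theorem fc_zero (n : ℤ) : fc 0 n = 0 := by simp [fc]

theorem ES_unique {h : ℝ → ℂ} (hh : MemLp h 1 μ01) (h0 : ∀ n : ℤ, ES h (Real.pi * n) = 0) : h =ᵐ[μ01] 0 :=
  circ_inj (le_refl 1) (g := 0) MemLp.zero' (by simp) hh (fun n => by rw [fc_zero, add_zero, h0])


theorem refl_mp : MeasurePreserving (fun x : ℝ => 1 - x) μ01 μ01 := by
  have h := (Measure.measurePreserving_sub_left (volume : Measure ℝ) 1).restrict_preimage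
    (s := Ioo (0:ℝ) 1) measurableSet_Ioo
  have h2 : (fun x : ℝ => 1 - x) ⁻¹' Ioo (0:ℝ) 1 = Ioo 0 1 := by
    ext x; simp only [mem_preimage, mem_Ioo]; constructor <;> rintro ⟨h1, h2⟩ <;> constructor <;> linarith
  rw [h2] at h
  exact h

/-- conjugate reflection. -/
def crefl (h : ℝ → ℂ) (x : ℝ) : ℂ := conj (h (1 - x))

theorem crefl_memLp {p : ℝ≥0∞} {h : ℝ → ℂ} (hh : MemLp h p μ01) : MemLp (crefl h) p μ01 := by
  have := (hh.comp_measurePreserving refl_mp).star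
  exact this

theorem crefl_norm {p : ℝ≥0∞} {h : ℝ → ℂ} (hh : MemLp h p μ01) :
    eLpNorm (crefl h) p μ01 = eLpNorm h p μ01 := by
  rw [← eLpNorm_comp_measurePreserving hh.1 refl_mp]
  exact eLpNorm_congr_norm_ae (Eventually.of_forall fun x => by simp [crefl])

theorem ii01 {p : ℝ≥0∞} (hp : 1 ≤ p) {h : ℝ → ℂ} (hh : MemLp h p μ01) : IntervalIntegrable h volume 0 1 :=
  ii_of_memLp hp hh

theorem fc_int {p : ℝ≥0∞} (hp : 1 ≤ p) {h : ℝ → ℂ} (hh : MemLp h p μ01) (n : ℤ) :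
    IntervalIntegrable (fun x : ℝ => Complex.exp (-2 * Real.pi * I * n * x) * h x) volume 0 1 :=
  (ii01 hp hh).continuousOn_mul (Continuous.continuousOn (by fun_prop))

theorem fc_crefl (h : ℝ → ℂ) (n : ℤ) : fc (crefl h) n = conj (fc h n) := by
  rw [fc, fc]
  have h1 := intervalIntegral.integral_comp_sub_left
    (fun x : ℝ => conj (Complex.exp (-2 * Real.pi * I * n * x) * h x)) (a := 0) (b := 1) 1
  rw [sub_self, sub_zero] at h1
  have h2 : conj (∫ x in (0:ℝ)..1, Complex.exp (-2 * Real.pi * I * n * x) * h x) =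
      ∫ x in (0:ℝ)..1, conj (Complex.exp (-2 * Real.pi * I * n * x) * h x) := by
    rw [intervalIntegral.integral_of_le zero_le_one, intervalIntegral.integral_of_le zero_le_one]
    exact integral_conj.symm
  rw [h2, ← h1]
  refine intervalIntegral.integral_congr fun x _ => ?_
  simp only [crefl, map_mul]
  congr 1
  rw [← Complex.exp_conj]
  rw [Complex.exp_eq_exp_iff_exists_int]
  refine ⟨-n, ?_⟩
  have h3 : conj (2:ℂ) = 2 := Complex.conj_ofNat 2
  simp [h3]
  ring

theorem fc_half {p : ℝ≥0∞} (hp : 1 ≤ p) {h : ℝ → ℂ} (hh : MemLp h p μ01) (n : ℤ) :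
    fc (fun x => (1/2:ℂ) * (h x + crefl h x)) n = ((fc h n).re : ℂ) := by
  have h1 : fc (fun x => (1/2:ℂ) * (h x + crefl h x)) n = (1/2:ℂ) * (fc h n + fc (crefl h) n) := by
    rw [fc, fc, fc, ← intervalIntegral.integral_add (fc_int hp hh n) (fc_int hp (crefl_memLp hh) n),
      ← intervalIntegral.integral_const_mul]
    refine intervalIntegral.integral_congr fun x _ => ?_
    ring
  rw [h1, fc_crefl, Complex.add_conj]
  push_cast; ring

theorem half_memLp {p : ℝ≥0∞} {h : ℝ → ℂ} (hh : MemLp h p μ01) :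
    MemLp (fun x => (1/2:ℂ) * (h x + crefl h x)) p μ01 :=
  (hh.add (crefl_memLp hh)).const_mul _

theorem half_norm {p : ℝ≥0∞} (hp : 1 ≤ p) {h : ℝ → ℂ} (hh : MemLp h p μ01) :
    eLpNorm (fun x => (1/2:ℂ) * (h x + crefl h x)) p μ01 ≤ eLpNorm h p μ01 := by
  have h1 : eLpNorm (fun x => (1/2:ℂ) * (h x + crefl h x)) p μ01 = ‖(1/2:ℂ)‖ₑ * eLpNorm (h + crefl h) p μ01 :=
    eLpNorm_const_smul (1/2:ℂ) (h + crefl h) p μ01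
  rw [h1]
  calc _ ≤ ‖(1/2:ℂ)‖ₑ * (eLpNorm h p μ01 + eLpNorm (crefl h) p μ01) := by
        gcongr; exact eLpNorm_add_le hh.1 (crefl_memLp hh).1 hp
    _ = _ := by
        rw [crefl_norm hh, ← two_mul, ← mul_assoc]
        have : ‖(1/2:ℂ)‖ₑ * 2 = 1 := by
          rw [show (2:ℝ≥0∞) = ‖(2:ℂ)‖ₑ by rw [← ofReal_norm]; simp, ← enorm_mul]; simp
        rw [this, one_mul]

theorem fourier_span_fin {p : ℝ≥0∞} [Fact (1 ≤ p)] (P : Lp ℂ p hT)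
    (hP : P ∈ Submodule.span ℂ (Set.range (fourierLp (T := (1:ℝ)) p))) :
    ∃ s : Finset ℤ, ∀ n ∉ s, eF n P = 0 := by
  classical
  induction hP using Submodule.span_induction with
  | mem x hx =>
    obtain ⟨m, rfl⟩ := hx
    refine ⟨{m}, fun n hn => ?_⟩
    rw [eF_apply]
    have h1 : ∫ t, (fourier (-n) t : ℂ) * (fourierLp p m : Lp ℂ p hT) t ∂hT = fourierCoeff (fourier m (T := (1:ℝ))) n := by
      rw [fourierCoeff]
      refine integral_congr_ae ?_
      filter_upwards [coeFn_fourierLp p m] with t ht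
      rw [ht, smul_eq_mul]
    rw [h1, fourierCoeff_fourier, Pi.single_apply]
    simpa using hn
  | zero => exact ⟨∅, by simp⟩
  | add x y _ _ hx hy =>
    obtain ⟨s, hs⟩ := hx
    obtain ⟨s', hs'⟩ := hy
    refine ⟨s ∪ s', fun n hn => ?_⟩
    simp only [Finset.mem_union, not_or] at hn
    rw [map_add, hs n hn.1, hs' n hn.2, add_zero]
  | smul a x _ hx =>
    obtain ⟨s, hs⟩ := hx
    exact ⟨s, fun n hn => by rw [map_smul, hs n hn, smul_zero]⟩

theorem fc_mk {p : ℝ≥0∞} [Fact (1 ≤ p)] (c : Lp ℂ p hT) (n : ℤ) :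
    fc (fun x => c (x : AddCircle (1:ℝ))) n = eF n c := by
  rw [eF_apply, fc, int_circ (F := fun t => (fourier (-n) t : ℂ) * c t) ((fourier_aesm _).mul (Lp.aestronglyMeasurable c))]
  simp only [fourier_coe1]

theorem circ_small {p : ℝ≥0∞} (hp : 1 ≤ p) (hp' : p ≠ ∞) {g : ℝ → ℂ} (hg : MemLp g p μ01)
    (hre : ∀ n : ℤ, (fc g n).im = 0) {η : ℝ} (hη : 0 < η) :
    ∃ g', MemLp g' p μ01 ∧ (eLpNorm g' p μ01).toReal ≤ η ∧ (∀ n : ℤ, (fc g' n).im = 0) ∧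
      ∃ s : Finset ℤ, ∀ n ∉ s, fc g' n = fc g n := by
  have : Fact (1 ≤ p) := ⟨hp⟩
  have hmem : toC hg ∈ closure ((Submodule.span ℂ (Set.range (fourierLp (T := (1:ℝ)) p)) : Set (Lp ℂ p hT))) := by
    rw [← Submodule.topologicalClosure_coe, span_fourierLp_closure_eq_top hp']; trivial
  obtain ⟨P, hP, hd⟩ := Metric.mem_closure_iff.1 hmem η hη
  obtain ⟨s, hs⟩ := fourier_span_fin P hP
  have hh := comp_mk_memLp (toC hg - P)
  refine ⟨_, half_memLp hh, ?_, fun n => ?_, s, fun n hn => ?_⟩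
  · refine (ENNReal.toReal_mono hh.2.ne (half_norm hp hh)).trans ?_
    rw [comp_mk_norm, ← dist_eq_norm]
    exact hd.le
  · rw [fc_half hp hh]; simp
  · rw [fc_half hp hh, fc_mk, map_sub, hs n hn, sub_zero, eF_toC]
    apply Complex.ext <;> simp [hre]


section time
variable {p : ℝ≥0∞} [Fact (1 ≤ p)]

/-- the space L_p of the line. -/
abbrev EE (p : ℝ≥0∞) := Lp ℂ p (volume : Measure ℝ)

/-- conjugation on L_p. -/
def cj : EE p →L[ℝ] EE p := ContinuousLinearMap.compLpL p volume (Complex.conjCLE : ℂ →L[ℝ] ℂ)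

theorem cj_coe (e : EE p) : (cj e : ℝ → ℂ) =ᵐ[volume] fun t => conj (e t) := by
  filter_upwards [ContinuousLinearMap.coeFn_compLpL (p := p) (μ := volume) (Complex.conjCLE : ℂ →L[ℝ] ℂ) e] with t ht
  exact ht

theorem cj_norm (e : EE p) : ‖cj e‖ = ‖e‖ := by
  apply le_antisymm
  · apply Lp.norm_le_norm_of_ae_le
    filter_upwards [cj_coe e] with t ht
    rw [ht]; simp
  · apply Lp.norm_le_norm_of_ae_le
    filter_upwards [cj_coe e] with t ht
    rw [ht]; simp

theorem rs_mp (s : ℝ) : MeasurePreserving (fun t : ℝ => s - t) volume volume :=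
  Measure.measurePreserving_sub_left volume s

/-- conjugate reflection about s/2. -/
def Jr (s : ℝ) (e : EE p) : EE p := Lp.compMeasurePreserving (fun t => s - t) (rs_mp s) (cj e)

theorem Jr_coe (s : ℝ) (e : EE p) : (Jr s e : ℝ → ℂ) =ᵐ[volume] fun t => conj (e (s - t)) := by
  have h1 := Lp.coeFn_compMeasurePreserving (cj e) (rs_mp s)
  have h2 := (rs_mp s).quasiMeasurePreserving.ae_eq_comp (cj_coe e)
  filter_upwards [h1, h2] with t h1 h2
  rw [Jr, h1, h2]; rfl

theorem Jr_norm (s : ℝ) (e : EE p) : ‖Jr s e‖ = ‖e‖ := by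
  rw [Jr, Lp.norm_compMeasurePreserving, cj_norm]

theorem Jr_sub (s : ℝ) (e e' : EE p) : Jr s (e - e') = Jr s e - Jr s e' := by
  rw [Jr, map_sub, map_sub]; rfl

theorem Jr_zero (s : ℝ) : Jr s (0 : EE p) = 0 := by
  rw [Jr, map_zero, map_zero]

theorem Jr_cont (hp : p ≠ ∞) {f : ℝ → EE p} (hf : Continuous f) : Continuous (fun s => Jr s (f s)) := by
  have hg : Continuous (fun s : ℝ => (⟨fun t => s - t, by fun_prop⟩ : C(ℝ, ℝ))) :=
    ContinuousMap.continuous_of_continuous_uncurry _ (by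
      simp only [Function.uncurry_def, ContinuousMap.coe_mk]; fun_prop)
  exact Continuous.compMeasurePreservingLp (cj.continuous.comp hf) hg (fun z => rs_mp z) hp

theorem ind_norm (A : Set ℝ) (x : ℝ) : ‖A.indicator (fun _ => (1:ℂ)) x‖ ≤ 1 := by
  by_cases h : x ∈ A <;> simp [h]

/-- indicator multiplication. -/
def Ind (A : Set ℝ) (hA : MeasurableSet A) : EE p →L[ℂ] EE p :=
  mulLp (A.indicator (fun _ => (1:ℂ))) ((measurable_const.indicator hA).aestronglyMeasurable) (ind_norm A)

theorem Ind_coe {A : Set ℝ} (hA : MeasurableSet A) (e : EE p) :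
    (Ind A hA e : ℝ → ℂ) =ᵐ[volume] A.indicator e := by
  filter_upwards [mulLp_coe ((measurable_const.indicator hA).aestronglyMeasurable) (ind_norm A) e] with x hx
  rw [Ind, hx]
  by_cases h : x ∈ A <;> simp [h]

theorem Ind_norm_le {A : Set ℝ} (hA : MeasurableSet A) (e : EE p) : ‖Ind A hA e‖ ≤ ‖e‖ := by
  have h := ContinuousLinearMap.le_of_opNorm_le _ (mulLp_norm (p := p) (μ := (volume : Measure ℝ))
    ((measurable_const.indicator hA).aestronglyMeasurable) (ind_norm A)) e
  rw [one_mul] at h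
  exact h

theorem Ind_Ind {A B : Set ℝ} (hA : MeasurableSet A) (hB : MeasurableSet B) (e : EE p) :
    Ind A hA (Ind B hB e) = Ind (A ∩ B) (hA.inter hB) e := by
  apply Lp.ext
  filter_upwards [Ind_coe hA (Ind B hB e), Ind_coe hB e, Ind_coe (hA.inter hB) e] with x h1 h2 h3
  rw [h1, h3]
  by_cases h : x ∈ A <;> by_cases h' : x ∈ B <;> simp [h, h', h2]

theorem Ind_mono {A B : Set ℝ} (hA : MeasurableSet A) (hB : MeasurableSet B) (hAB : A ⊆ B) (e : EE p) :
    ‖Ind A hA e‖ ≤ ‖Ind B hB e‖ := by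
  have : Ind A hA e = Ind A hA (Ind B hB e) := by
    rw [Ind_Ind]; congr 2; exact (inter_eq_left.2 hAB).symm
  rw [this]; exact Ind_norm_le _ _

theorem Ind_compl {A : Set ℝ} (hA : MeasurableSet A) (e : EE p) : Ind Aᶜ hA.compl e = e - Ind A hA e := by
  apply Lp.ext
  filter_upwards [Ind_coe hA e, Ind_coe hA.compl e, Lp.coeFn_sub e (Ind A hA e)] with x h1 h2 h3
  rw [h2, h3, Pi.sub_apply, h1]
  by_cases h : x ∈ A <;> simp [h]

theorem Ind_Jr {A : Set ℝ} (hA : MeasurableSet A) (s : ℝ) (e : EE p) :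
    Ind A hA (Jr s e) = Jr s (Ind ((fun t => s - t) ⁻¹' A) (hA.preimage (by fun_prop)) e) := by
  have hB : MeasurableSet ((fun t => s - t) ⁻¹' A) := hA.preimage (by fun_prop)
  apply Lp.ext
  have h4 := (rs_mp s).quasiMeasurePreserving.ae_eq_comp (Ind_coe hB e)
  filter_upwards [Ind_coe hA (Jr s e), Jr_coe s e, Jr_coe s (Ind _ hB e), h4] with x h1 h2 h3 h4
  simp only [Function.comp] at h4
  rw [h1, h3, h4]
  have hx : (s - x ∈ (fun t => s - t) ⁻¹' A) ↔ x ∈ A := by simp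
  by_cases h : x ∈ A
  · rw [indicator_of_mem h, indicator_of_mem (hx.2 h), h2]
  · rw [indicator_of_notMem h, indicator_of_notMem (by rwa [hx])]; simp

/-- equi-smallness on small sets. -/
theorem Ind_small (hp : p ≠ ∞) (e : EE p) {ε : ℝ} (hε : 0 < ε) :
    ∃ δ > 0, ∀ (A : Set ℝ) (hA : MeasurableSet A), volume A ≤ ENNReal.ofReal δ → ‖Ind A hA e‖ ≤ ε := by
  obtain ⟨δ, hδ, h⟩ := MemLp.eLpNorm_indicator_le Fact.out hp (Lp.memLp e) hε
  refine ⟨δ, hδ, fun A hA hv => ?_⟩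
  rw [Lp.norm_def, eLpNorm_congr_ae (Ind_coe hA e)]
  exact ENNReal.toReal_le_of_le_ofReal hε.le (h A hA hv)

/-- truncation to `[0,x]`. -/
abbrev Pr (x : ℝ) : EE p →L[ℂ] EE p := Ind (Icc 0 x) measurableSet_Icc

theorem Pr_sub {x y : ℝ} (h : x ≤ y) (e : EE p) : ‖Pr y e - Pr x e‖ ≤ ‖Ind (Icc x y) measurableSet_Icc e‖ := by
  apply Lp.norm_le_norm_of_ae_le
  filter_upwards [Ind_coe (measurableSet_Icc (a := (0:ℝ)) (b := x)) e, Ind_coe (measurableSet_Icc (a := (0:ℝ)) (b := y)) e,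
    Ind_coe (measurableSet_Icc (a := x) (b := y)) e, Lp.coeFn_sub (Pr y e) (Pr x e)] with t h1 h2 h3 h4
  rw [h4, h3, Pi.sub_apply, h2, h1]
  by_cases ht : t ∈ Icc x y
  · rw [indicator_of_mem ht]
    by_cases ha : t ∈ Icc 0 y <;> by_cases hb : t ∈ Icc 0 x <;> simp [ha, hb]
  · rw [indicator_of_notMem ht]
    have : t ∈ Icc 0 y ↔ t ∈ Icc 0 x := by
      simp only [mem_Icc] at ht ⊢
      constructor
      · rintro ⟨h1, h2⟩; exact ⟨h1, by by_contra h3; exact ht ⟨by linarith, h2⟩⟩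
      · rintro ⟨h1, h2⟩; exact ⟨h1, h2.trans h⟩
    by_cases hb : t ∈ Icc 0 x
    · simp [indicator_of_mem hb, indicator_of_mem (this.2 hb)]
    · simp [indicator_of_notMem hb, indicator_of_notMem (this.not.2 hb)]

theorem Pr_cont1 (hp : p ≠ ∞) (e : EE p) : Continuous (fun x => Pr x e) := by
  rw [Metric.continuous_iff]
  intro x ε hε
  obtain ⟨δ, hδ, h⟩ := Ind_small hp e (half_pos hε)
  refine ⟨δ, hδ, fun y hy => ?_⟩
  rw [dist_eq_norm]
  rw [Real.dist_eq] at hy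
  have key : ∀ a b : ℝ, a ≤ b → b - a ≤ δ → ‖Pr b e - Pr a e‖ < ε := fun a b hab hd => by
    refine ((Pr_sub hab e).trans (h _ _ ?_)).trans_lt (half_lt_self hε)
    rw [Real.volume_Icc]; exact ENNReal.ofReal_le_ofReal hd
  rcases le_total x y with hxy | hxy
  · exact key x y hxy ((le_abs_self _).trans hy.le)
  · rw [norm_sub_rev]; exact key y x hxy (by rw [abs_sub_comm] at hy; exact (le_abs_self _).trans hy.le)

theorem Pr_cont (hp : p ≠ ∞) {f : ℝ → EE p} (hf : Continuous f) : Continuous (fun x => Pr x (f x)) := by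
  rw [continuous_iff_continuousAt]
  intro x
  have h1 : Tendsto (fun y => Pr y (f x)) (𝓝 x) (𝓝 (Pr x (f x))) := (Pr_cont1 hp (f x)).tendsto x
  have h2 : Tendsto (fun y => Pr y (f y - f x)) (𝓝 x) (𝓝 0) := by
    have h3 : Tendsto (fun y => ‖f y - f x‖) (𝓝 x) (𝓝 0) := by
      have := ((hf.sub continuous_const).norm (f := fun y => f y - f x)).tendsto x
      simpa using this
    exact squeeze_zero_norm (fun y => Ind_norm_le _ _) h3
  have h4 := h2.add h1
  simp only [← map_add, sub_add_cancel, zero_add] at h4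
  exact h4

theorem EE_ii (ψ : EE p) : IntervalIntegrable ψ volume 0 1 := by
  have h := ((Lp.memLp ψ).restrict (Ioo (0:ℝ) 1))
  exact ii_of_memLp Fact.out h

theorem EE_norm1 (ψ : EE p) : ∫ s in (0:ℝ)..1, ‖ψ s‖ ≤ ‖ψ‖ := by
  rw [intervalIntegral.integral_of_le zero_le_one, ← mu01_Ioc]
  have h := ((Lp.memLp ψ).restrict (Ioo (0:ℝ) 1))
  change MemLp ψ p μ01 at h
  rw [integral_norm_eq_lintegral_enorm h.1, ← eLpNorm_one_eq_lintegral_enorm, Lp.norm_def]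
  exact ENNReal.toReal_mono (Lp.eLpNorm_ne_top ψ)
    ((eLpNorm_le_eLpNorm_of_exponent_le Fact.out h.1).trans (eLpNorm_mono_measure _ Measure.restrict_le_self))
end time


section time2
variable {p : ℝ≥0∞} [Fact (1 ≤ p)]

/-- kernel solution. -/
def KS (ψ : EE p) (f : ℝ → EE p) : Prop :=
  Continuous f ∧ ∀ x ∈ Icc (0:ℝ) 1, f x = Pr x ψ + ∫ s in (0:ℝ)..x, ψ s • Jr s (f s)

theorem KS_ii0 (hp : p ≠ ∞) (ψ : EE p) {f : ℝ → EE p} (hf : Continuous f) :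
    IntervalIntegrable (fun s => ψ s • Jr s (f s)) volume 0 1 :=
  (EE_ii ψ).smul_continuousOn (Jr_cont hp hf).continuousOn

theorem KS_exists (hp : p ≠ ∞) (ψ : EE p) : ∃ f, KS ψ f := by
  obtain ⟨f, hf, -, h⟩ := volterra (E := EE p) (m := fun s => ‖ψ s‖) (fun s => norm_nonneg _) (EE_ii ψ).norm
    (fun s e => ψ s • Jr s e) (fun s _ e e' => by
      rw [← smul_sub, ← Jr_sub, norm_smul, Jr_norm]) (fun s => by rw [Jr_zero, smul_zero])
    (fun f hf => ((intervalIntegrable_iff_integrableOn_Ioc_of_le zero_le_one).1 (KS_ii0 hp ψ hf)).1)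
    (fun x => Pr x ψ) (Pr_cont1 hp ψ)
  exact ⟨f, hf, h⟩

theorem bdd01 {E : Type*} [NormedAddCommGroup E] {f : ℝ → E} (hf : Continuous f) : ∃ b, ∀ x ∈ Icc (0:ℝ) 1, ‖f x‖ ≤ b := by
  obtain ⟨b, hb⟩ := (isCompact_Icc (a := (0:ℝ)) (b := 1)).exists_bound_of_continuousOn hf.continuousOn
  exact ⟨b, hb⟩

/-- support of the kernel -/
theorem KS_supp (hp : p ≠ ∞) {ψ : EE p} {f : ℝ → EE p} (h : KS ψ f) : ∀ x ∈ Icc (0:ℝ) 1, Pr x (f x) = f x := by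
  obtain ⟨hf, he⟩ := h
  set o : ℝ → EE p := fun x => f x - Pr x (f x) with ho
  have hoc : Continuous o := hf.sub (Pr_cont hp hf)
  have ho' : ∀ x, o x = Ind (Icc 0 x)ᶜ measurableSet_Icc.compl (f x) := fun x => by
    rw [Ind_compl]
  obtain ⟨b, hb⟩ := bdd01 hoc
  obtain ⟨κ, hκ, hG⟩ := gronwall (m := fun s => ‖ψ s‖) (fun s => norm_nonneg _) (EE_ii ψ).norm
  have h1 := hG (fun x => ‖o x‖) 0 b le_rfl (fun x _ => norm_nonneg _) hb (fun x hx => by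
    rw [zero_add, ho']
    conv_lhs => rw [he x hx]
    rw [map_add, Ind_Ind]
    have hz : Ind ((Icc 0 x)ᶜ ∩ Icc 0 x) (measurableSet_Icc.compl.inter measurableSet_Icc) ψ = 0 := by
      apply Lp.ext
      filter_upwards [Ind_coe (measurableSet_Icc.compl.inter measurableSet_Icc : MeasurableSet ((Icc 0 x)ᶜ ∩ Icc 0 x)) ψ,
        Lp.coeFn_zero ℂ p (volume : Measure ℝ)] with t h1 h2
      rw [h1, h2]; simp
    have hii : IntervalIntegrable (fun s => ψ s • Jr s (f s)) volume 0 x := ii_sub (KS_ii0 hp ψ hf) (by simp) hx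
    rw [hz, zero_add, ← ContinuousLinearMap.intervalIntegral_comp_comm _ hii]
    have hm : IntervalIntegrable (fun s => ‖ψ s‖ * ‖o s‖) volume 0 x := by
      refine ii_sub ?_ (by simp) hx
      exact (EE_ii ψ).norm.mul_continuousOn hoc.norm.continuousOn
    refine intervalIntegral.norm_integral_le_of_norm_le hx.1 ?_ hm
    refine Eventually.of_forall fun s hs => ?_
    rw [map_smul, norm_smul]
    refine mul_le_mul_of_nonneg_left ?_ (norm_nonneg _)
    rw [ho', Ind_Jr, Jr_norm]
    refine Ind_mono _ _ ?_ _
    intro t ht hn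
    apply ht
    simp only [mem_Icc] at hn ⊢
    constructor <;> linarith [hs.2])
  intro x hx
  have h2 := h1 x hx
  simp only [mul_zero, zero_mul] at h2
  exact (sub_eq_zero.1 (norm_le_zero_iff.1 h2)).symm

instance instProb01 : IsProbabilityMeasure (volume.restrict (Ioo (0:ℝ) 1)) := ⟨by simp⟩

/-- the transform functional. -/
def FTl (l : ℝ) : EE p →L[ℂ] ℂ :=
  (intLp (μ := volume.restrict (Ioo (0:ℝ) 1))).comp ((mulLp (μ := volume.restrict (Ioo (0:ℝ) 1)) (fun t : ℝ => Complex.exp ((-2 * l * t : ℝ) * I))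
    (Continuous.aestronglyMeasurable (by fun_prop)) (fun t => by rw [Complex.norm_exp_ofReal_mul_I])).comp
    (LpToLpRestrictCLM ℝ ℂ ℂ volume p (Ioo (0:ℝ) 1)))

theorem FTl_apply (l : ℝ) (e : EE p) : FTl l e = ∫ t in (0:ℝ)..1, Complex.exp ((-2 * l * t : ℝ) * I) * e t := by
  rw [intervalIntegral.integral_of_le zero_le_one, ← mu01_Ioc, FTl]
  simp only [ContinuousLinearMap.comp_apply]
  rw [intLp_apply]
  refine integral_congr_ae ?_
  have h1 := mulLp_coe (μ := volume.restrict (Ioo (0:ℝ) 1)) (p := p) (m := (fun t : ℝ => Complex.exp ((-2 * l * t : ℝ) * I)))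
    (Continuous.aestronglyMeasurable (by fun_prop)) (fun t => by rw [Complex.norm_exp_ofReal_mul_I])
    (LpToLpRestrictCLM ℝ ℂ ℂ volume p (Ioo (0:ℝ) 1) e)
  have h2 := LpToLpRestrictCLM_coeFn (F := ℂ) (μ := volume) (p := p) ℂ (Ioo (0:ℝ) 1) e
  filter_upwards [h1, h2] with t h1 h2
  rw [h1, h2]

theorem FTl_Pr (l : ℝ) (e : EE p) {x : ℝ} (hx : x ∈ Icc (0:ℝ) 1) :
    FTl l (Pr x e) = ∫ t in (0:ℝ)..x, Complex.exp ((-2 * l * t : ℝ) * I) * e t := by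
  rw [FTl_apply]
  have h1 : ∫ t in (0:ℝ)..1, Complex.exp ((-2 * l * t : ℝ) * I) * Pr x e t =
      ∫ t in (0:ℝ)..1, (Ioc (0:ℝ) x).indicator (fun t : ℝ => Complex.exp ((-2 * l * t : ℝ) * I) * e t) t := by
    refine intervalIntegral.integral_congr_ae ?_
    filter_upwards [Ind_coe (measurableSet_Icc (a := (0:ℝ)) (b := x)) e] with t h1 ht
    rw [uIoc_of_le zero_le_one] at ht
    rw [Pr, h1]
    by_cases h : t ≤ x
    · rw [indicator_of_mem (show t ∈ Icc 0 x from ⟨ht.1.le, h⟩), indicator_of_mem (show t ∈ Ioc 0 x from ⟨ht.1, h⟩)]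
    · rw [indicator_of_notMem (fun hh => h hh.2), indicator_of_notMem (fun hh => h hh.2), mul_zero]
  rw [h1, intervalIntegral.integral_of_le zero_le_one, intervalIntegral.integral_of_le hx.1,
    setIntegral_indicator measurableSet_Ioc, Ioc_inter_Ioc]
  congr 2
  simp [hx.2]

theorem Pr_Jr (s : ℝ) (e : EE p) : Pr s (Jr s e) = Jr s (Pr s e) := by
  rw [Pr, Ind_Jr]
  congr 2
  simp
  
theorem FTl_Jr (l : ℝ) {e : EE p} {s : ℝ} (hs : s ∈ Icc (0:ℝ) 1) (he : Pr s e = e) :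
    FTl l (Jr s e) = Complex.exp ((-2 * l * s : ℝ) * I) * conj (FTl l e) := by
  rw [← he, ← Pr_Jr, FTl_Pr l _ hs, FTl_Pr l _ hs]
  have h1 : ∫ t in (0:ℝ)..s, Complex.exp ((-2 * l * t : ℝ) * I) * Jr s e t =
      ∫ t in (0:ℝ)..s, (fun r : ℝ => Complex.exp ((-2 * l * (s - r) : ℝ) * I) * conj (e r)) (s - t) := by
    refine intervalIntegral.integral_congr_ae ?_
    filter_upwards [Jr_coe s e] with t h1 _
    rw [h1]; simp
  rw [h1, intervalIntegral.integral_comp_sub_left (fun r : ℝ => Complex.exp ((-2 * l * (s - r) : ℝ) * I) * conj (e r))]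
  rw [sub_self, sub_zero, ← intervalIntegral.intervalIntegral_conj, ← intervalIntegral.integral_const_mul]
  refine intervalIntegral.integral_congr fun t _ => ?_
  simp only [map_mul]
  rw [← Complex.exp_conj, ← mul_assoc, ← Complex.exp_add]
  congr 2
  simp only [map_mul, conj_ofReal, conj_I]
  push_cast
  ring

end time2


section time3
variable {p : ℝ≥0∞} [Fact (1 ≤ p)]

theorem KS_w (hp : p ≠ ∞) {ψ : EE p} {f : ℝ → EE p} (h : KS ψ f) (l : ℝ) :
    AC1 (fun x => 1 + FTl l (f x))
      (fun s => Complex.exp ((-2 * l * s : ℝ) * I) * ψ s * conj (1 + FTl l (f s))) := by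
  have hii : IntervalIntegrable (fun s => Complex.exp ((-2 * l * s : ℝ) * I) * ψ s * conj (1 + FTl l (f s))) volume 0 1 := by
    refine IntervalIntegrable.mul_continuousOn (IntervalIntegrable.continuousOn_mul (EE_ii ψ) (Continuous.continuousOn (by fun_prop))) (Continuous.continuousOn ?_)
    exact Complex.continuous_conj.comp (continuous_const.add ((FTl l).continuous.comp h.1))
  have key : ∀ x ∈ Icc (0:ℝ) 1, FTl l (f x) =
      ∫ s in (0:ℝ)..x, Complex.exp ((-2 * l * s : ℝ) * I) * ψ s * conj (1 + FTl l (f s)) := by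
    intro x hx
    have hx' : IntervalIntegrable (fun s => ψ s • Jr s (f s)) volume 0 x := ii_sub (KS_ii0 hp ψ h.1) (by simp) hx
    have hi1 : IntervalIntegrable (fun t : ℝ => Complex.exp ((-2 * l * t : ℝ) * I) * ψ t) volume 0 x :=
      ii_sub (IntervalIntegrable.continuousOn_mul (EE_ii ψ) (Continuous.continuousOn (by fun_prop))) (by simp) hx
    have hi2 : IntervalIntegrable (fun s => FTl l (ψ s • Jr s (f s))) volume 0 x :=
      ⟨(FTl l).integrable_comp hx'.1, (FTl l).integrable_comp hx'.2⟩
    rw [h.2 x hx, map_add, FTl_Pr l _ hx, ← ContinuousLinearMap.intervalIntegral_comp_comm _ hx',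
      ← intervalIntegral.integral_add hi1 hi2]
    refine intervalIntegral.integral_congr fun s hs => ?_
    rw [uIcc_of_le hx.1] at hs
    have hs1 : s ∈ Icc (0:ℝ) 1 := ⟨hs.1, hs.2.trans hx.2⟩
    rw [map_smul, FTl_Jr l hs1 (KS_supp hp h s hs1), smul_eq_mul, map_add, map_one]
    ring
  refine ⟨hii, fun x hx => ?_⟩
  simp only
  rw [key x hx, key 0 (by simp)]
  simp

theorem KS_V1 (hp : p ≠ ∞) {ψ : EE p} {f : ℝ → EE p} (h : KS ψ f) (l : ℝ) :
    V1 ψ l = Complex.exp (I * l) * (1 + FTl l (f 1)) := by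
  have h1 : AC1 (fun x : ℝ => Complex.exp (I * l * x)) (fun x : ℝ => I * l * Complex.exp (I * l * x)) := by
    refine AC1.of_hasDeriv (fun x _ => HasDerivAt.hasDerivWithinAt ?_) (by fun_prop)
    have := ((hasDerivAt_id (x:ℂ)).const_mul (I * l)).cexp.comp_ofReal
    simp only [id] at this
    exact this.congr_deriv (by ring)
  have h2 := h1.mul (KS_w hp h l)
  have h3 : IsSol ψ l (fun x => Complex.exp (I * l * x) * (1 + FTl l (f x))) := by
    refine AC1.congr h2 (fun x _ => rfl) fun x _ => ?_
    have e1 : Complex.exp (I * l * x) * Complex.exp ((-2 * l * x : ℝ) * I) = conj (Complex.exp (I * l * x)) := by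
      rw [← Complex.exp_add, ← Complex.exp_conj]
      congr 1
      simp only [map_mul, conj_ofReal, conj_I]
      push_cast
      ring
    simp only [map_mul]
    rw [← e1]
    ring
  have h4 := Sol_eq (EE_ii ψ) h3 (c := 1) (by
    have : FTl l (f 0) = 0 := by rw [h.2 0 (by simp), intervalIntegral.integral_same, add_zero, FTl_Pr _ _ (by simp)]; simp
    simp [this]) 1 (by simp)
  rw [V1, ← h4]; simp

theorem V1_congr {ψ ψ' : ℝ → ℂ} (hψ : IntervalIntegrable ψ volume 0 1) (h : ψ =ᵐ[μ01] ψ') (l : ℝ) : V1 ψ l = V1 ψ' l := by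
  have h' : ∀ᵐ x : ℝ, x ∈ Ioc (0:ℝ) 1 → ψ x = ψ' x := by
    rw [mu01_Ioc] at h
    exact (ae_restrict_iff' measurableSet_Ioc).1 h
  have h0 : ∀ᵐ x : ℝ, x ≠ 0 := by simp [ae_iff, measure_singleton]
  have hψ' : IntervalIntegrable ψ' volume 0 1 := hψ.congr_ae (by rw [uIoc_of_le zero_le_one, ← mu01_Ioc]; exact h)
  have h1 : IsSol ψ' l (Sol ψ 1 l) := by
    refine AC1.congr_ae (Sol_sol 1 l hψ) ?_
    filter_upwards [h', h0] with x h1 h2 hx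
    rw [h1 ⟨lt_of_le_of_ne hx.1 (Ne.symm h2), hx.2⟩]
  exact Sol_eq hψ' h1 (Sol_zero (hψ := hψ) ..) 1 (by simp)

/-- embed function on (0,1) in the space. -/
def emb {ψ : ℝ → ℂ} (h : MemLp ψ p μ01) : EE p := ((memLp_indicator_iff_restrict measurableSet_Ioo).2 h : MemLp ((Ioo (0:ℝ) 1).indicator ψ) p volume).toLp

theorem emb_coe {ψ : ℝ → ℂ} (h : MemLp ψ p μ01) : (emb h : ℝ → ℂ) =ᵐ[volume] (Ioo (0:ℝ) 1).indicator ψ := MemLp.coeFn_toLp _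

theorem emb_coe' {ψ : ℝ → ℂ} (h : MemLp ψ p μ01) : (emb h : ℝ → ℂ) =ᵐ[μ01] ψ := by
  filter_upwards [ae_restrict_of_ae (emb_coe h), ae_restrict_mem (measurableSet_Ioo)] with x h1 h2
  rw [h1, indicator_of_mem h2]

theorem emb_norm {ψ : ℝ → ℂ} (h : MemLp ψ p μ01) : ‖emb h‖ = (eLpNorm ψ p μ01).toReal := by
  rw [emb, Lp.norm_toLp, eLpNorm_indicator_eq_eLpNorm_restrict measurableSet_Ioo]; rfl

theorem EE_memLp (e : EE p) : MemLp e p μ01 := (Lp.memLp e).restrict _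

theorem FTl_ES (l : ℝ) (e : EE p) : Complex.exp (I * l) * FTl l e = ES e l := by
  rw [FTl_apply, ES, ← intervalIntegral.integral_const_mul]
  refine intervalIntegral.integral_congr fun t _ => ?_
  rw [← mul_assoc, ← Complex.exp_add, mul_comm]
  congr 2
  push_cast; ring

end time3

theorem ES_congr {c d : ℝ → ℂ} (h : c =ᵐ[μ01] d) (l : ℂ) : ES c l = ES d l := by
  rw [ES, ES, intervalIntegral.integral_of_le zero_le_one, intervalIntegral.integral_of_le zero_le_one, ← mu01_Ioc]
  refine integral_congr_ae ?_
  filter_upwards [h] with x hx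
  rw [hx]

/-- representation of V1 -/
theorem rep {ψ : ℝ → ℂ} (h : MemLp ψ 1 μ01) : ∃ k, MemLp k 1 μ01 ∧ ∀ l : ℝ, V1 ψ l = Complex.exp (I * l) + ES k l := by
  obtain ⟨f, hf⟩ := KS_exists (p := 1) (by simp) (emb h)
  refine ⟨f 1, EE_memLp _, fun l => ?_⟩
  rw [← FTl_ES, ← V1_congr (EE_ii (emb h)) (emb_coe' h), KS_V1 (by simp) hf]
  ring


section time4
variable {p : ℝ≥0∞} [Fact (1 ≤ p)]

theorem sup_boot {E : Type*} [NormedAddCommGroup E] {o : ℝ → E} (ho : Continuous o) {a : ℝ}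
    (h : ∀ b, 0 ≤ b → (∀ x ∈ Icc (0:ℝ) 1, ‖o x‖ ≤ b) → ∀ x ∈ Icc (0:ℝ) 1, ‖o x‖ ≤ a + 1/2 * b) :
    ∀ x ∈ Icc (0:ℝ) 1, ‖o x‖ ≤ 2 * a := by
  obtain ⟨x0, hx0, hm⟩ := (isCompact_Icc (a := (0:ℝ)) (b := 1)).exists_isMaxOn ⟨0, by simp⟩ ho.norm.continuousOn
  have h1 := h ‖o x0‖ (norm_nonneg _) (fun x hx => hm hx) x0 hx0
  intro x hx
  have h2 : ‖o x‖ ≤ ‖o x0‖ := hm hx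
  linarith

theorem int_bd (hp : p ≠ ∞) (ψ : EE p) {g : ℝ → EE p} {b : ℝ} (hb0 : 0 ≤ b)
    (hb : ∀ x ∈ Icc (0:ℝ) 1, ‖g x‖ ≤ b) {x : ℝ} (hx : x ∈ Icc (0:ℝ) 1) :
    ‖∫ s in (0:ℝ)..x, ψ s • Jr s (g s)‖ ≤ ‖ψ‖ * b := by
  have h1 : ‖∫ s in (0:ℝ)..x, ψ s • Jr s (g s)‖ ≤ ∫ s in (0:ℝ)..x, ‖ψ s‖ * b := by
    refine intervalIntegral.norm_integral_le_of_norm_le hx.1 (Eventually.of_forall fun s hs => ?_)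
      (ii_sub ((EE_ii ψ).norm.mul_const b) (by simp) hx)
    rw [norm_smul, Jr_norm]
    exact mul_le_mul_of_nonneg_left (hb s ⟨hs.1.le, hs.2.trans hx.2⟩) (norm_nonneg _)
  refine h1.trans ?_
  rw [intervalIntegral.integral_mul_const]
  refine mul_le_mul_of_nonneg_right (le_trans ?_ (EE_norm1 ψ)) hb0
  exact intervalIntegral.integral_mono_interval le_rfl hx.1 hx.2 (Eventually.of_forall fun s => norm_nonneg _) (EE_ii ψ).norm

theorem coe_sub01 (ψ ψ' : EE p) : ∀ᵐ s : ℝ, (ψ - ψ' : EE p) s = ψ s - ψ' s := by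
  filter_upwards [Lp.coeFn_sub ψ ψ'] with s hs
  rw [hs]; rfl

theorem int_diff_eq (hp : p ≠ ∞) (ψ ψ' : EE p) {f f' : ℝ → EE p} (hf : Continuous f) (hf' : Continuous f')
    {x y : ℝ} (hx : x ∈ Icc (0:ℝ) 1) (hy : y ∈ Icc (0:ℝ) 1) :
    (∫ s in x..y, ψ s • Jr s (f s)) - (∫ s in x..y, ψ' s • Jr s (f' s)) =
    (∫ s in x..y, (ψ - ψ' : EE p) s • Jr s (f s)) + (∫ s in x..y, ψ' s • Jr s (f s - f' s)) := by
  rw [← intervalIntegral.integral_sub (ii_sub (KS_ii0 hp ψ hf) hx hy) (ii_sub (KS_ii0 hp ψ' hf') hx hy),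
    ← intervalIntegral.integral_add (ii_sub (KS_ii0 hp (ψ - ψ') hf) hx hy) (ii_sub (KS_ii0 hp ψ' (f := fun s => f s - f' s) (hf.sub hf')) hx hy)]
  refine intervalIntegral.integral_congr_ae ?_
  filter_upwards [coe_sub01 ψ ψ'] with s hs _
  rw [hs, Jr_sub, sub_smul, smul_sub]; abel

theorem int_diff (hp : p ≠ ∞) (ψ ψ' : EE p) {f f' : ℝ → EE p} (hf : Continuous f) (hf' : Continuous f')
    {b b' : ℝ} (hb0 : 0 ≤ b) (hb0' : 0 ≤ b') (hb : ∀ x ∈ Icc (0:ℝ) 1, ‖f x‖ ≤ b)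
    (hb' : ∀ x ∈ Icc (0:ℝ) 1, ‖f x - f' x‖ ≤ b') {x : ℝ} (hx : x ∈ Icc (0:ℝ) 1) :
    ‖(∫ s in (0:ℝ)..x, ψ s • Jr s (f s)) - (∫ s in (0:ℝ)..x, ψ' s • Jr s (f' s))‖ ≤ ‖ψ - ψ'‖ * b + ‖ψ'‖ * b' := by
  rw [int_diff_eq hp ψ ψ' hf hf' (by simp) hx]
  exact (norm_add_le _ _).trans (add_le_add (int_bd hp _ hb0 hb hx) (int_bd hp _ hb0' hb' hx))

theorem Pr_le (x : ℝ) (e : EE p) : ‖Pr x e‖ ≤ ‖e‖ := Ind_norm_le _ _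

theorem KS_bd (hp : p ≠ ∞) {ψ : EE p} {f : ℝ → EE p} (h : KS ψ f) (hψ : ‖ψ‖ ≤ 1/16) :
    ∀ x ∈ Icc (0:ℝ) 1, ‖f x‖ ≤ 2 * ‖ψ‖ := by
  refine sup_boot h.1 fun b hb0 hb x hx => ?_
  rw [h.2 x hx]
  have h4 : ∀ u v w : ℝ, u ≤ v + w → v ≤ ‖ψ‖ → w ≤ ‖ψ‖ * b → u ≤ ‖ψ‖ + 1/2 * b := by
    intro u v w h1 h2 h3
    nlinarith
  exact h4 _ _ _ (norm_add_le _ _) (Pr_le _ _) (int_bd hp ψ hb0 hb hx)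

theorem KS_lip (hp : p ≠ ∞) {ψ ψ' : EE p} {f f' : ℝ → EE p} (h : KS ψ f) (h' : KS ψ' f') (hψ : ‖ψ‖ ≤ 1/16)
    (hψ' : ‖ψ'‖ ≤ 1/16) : ∀ x ∈ Icc (0:ℝ) 1, ‖f x - f' x‖ ≤ 2 * (2 * ‖ψ - ψ'‖) := by
  refine sup_boot (o := fun x => f x - f' x) (h.1.sub h'.1) fun b hb0 hb x hx => ?_
  rw [h.2 x hx, h'.2 x hx, add_sub_add_comm, ← map_sub]
  have hbd : ∀ x ∈ Icc (0:ℝ) 1, ‖f x‖ ≤ 1/8 := fun x hx => (KS_bd hp h hψ x hx).trans (by linarith)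
  have h4 : ∀ u v w : ℝ, u ≤ v + w → v ≤ ‖ψ - ψ'‖ → w ≤ ‖ψ - ψ'‖ * (1/8) + ‖ψ'‖ * b → u ≤ 2 * ‖ψ - ψ'‖ + 1/2 * b := by
    intro u v w h1 h2 h3
    nlinarith [norm_nonneg (ψ - ψ')]
  exact h4 _ _ _ (norm_add_le _ _) (Pr_le _ _) (int_diff hp ψ ψ' h.1 h'.1 (by norm_num) hb0 hbd hb hx)

theorem small_ex (hp : p ≠ ∞) (k : EE p) (hk : ‖k‖ ≤ 1/32) :
    ∃ ψ : EE p, ∀ l : ℝ, V1 ψ l = Complex.exp (I * l) + ES k l := by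
  choose f hf using fun ψ : EE p => KS_exists hp ψ
  set G : EE p → EE p := fun ψ => k - ∫ s in (0:ℝ)..1, ψ s • Jr s (f ψ s) with hG
  set B : Set (EE p) := Metric.closedBall 0 (1/16) with hB
  have h1 : (1:ℝ) ∈ Icc (0:ℝ) 1 := by simp
  have hmem : ∀ ψ, ψ ∈ B ↔ ‖ψ‖ ≤ 1/16 := fun ψ => mem_closedBall_zero_iff
  have hbd : ∀ ψ ∈ B, ∀ x ∈ Icc (0:ℝ) 1, ‖f ψ x‖ ≤ 1/8 := fun ψ hψ x hx =>
    (KS_bd hp (hf ψ) ((hmem ψ).1 hψ) x hx).trans (by linarith [(hmem ψ).1 hψ])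
  have hmaps : MapsTo G B B := by
    intro ψ hψ
    have h3 := (hmem ψ).1 hψ
    rw [hmem]
    have h4 : ∀ u v : ℝ, u ≤ ‖k‖ + v → v ≤ ‖ψ‖ * (1/8) → u ≤ 1/16 := by
      intro u v h1 h2; linarith
    exact h4 _ _ (norm_sub_le _ _) (int_bd hp ψ (by norm_num) (hbd ψ hψ) h1)
  have hlip : ∀ ψ ∈ B, ∀ ψ' ∈ B, dist (G ψ) (G ψ') ≤ 1/2 * dist ψ ψ' := by
    intro ψ hψ ψ' hψ'
    rw [dist_comm, dist_eq_norm, dist_eq_norm, hG]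
    simp only [sub_sub_sub_cancel_left]
    refine (int_diff hp ψ ψ' (hf ψ).1 (hf ψ').1 (by norm_num) (by positivity) (hbd ψ hψ)
      (KS_lip hp (hf ψ) (hf ψ') ((hmem ψ).1 hψ) ((hmem ψ').1 hψ')) h1).trans ?_
    have := (hmem ψ').1 hψ'
    nlinarith [norm_nonneg (ψ - ψ')]
  have hc : ContractingWith (1/2) (hmaps.restrict G B B) := by
    refine ⟨by norm_num, LipschitzWith.of_dist_le_mul fun a b => ?_⟩
    have := hlip a a.2 b b.2
    rw [Subtype.dist_eq, Subtype.dist_eq]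
    simpa using this
  obtain ⟨ψ, hψB, hfix, -⟩ := hc.exists_fixedPoint' (Metric.isClosed_closedBall.isComplete) hmaps
    (x := 0) ((hmem 0).2 (by simp)) (edist_ne_top _ _)
  refine ⟨ψ, fun l => ?_⟩
  have h5 : f ψ 1 = Pr 1 k := by
    rw [← KS_supp hp (hf ψ) 1 h1, (hf ψ).2 1 h1, map_add]
    have h6 : k = ψ + ∫ s in (0:ℝ)..1, ψ s • Jr s (f ψ s) := by
      have : G ψ = ψ := hfix
      rw [hG] at this
      simp only at this
      exact sub_eq_iff_eq_add.1 this
    conv_rhs => rw [h6, map_add]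
    congr 1
    rw [Pr, Ind_Ind]; simp
  have h7 : FTl l (f ψ 1) = FTl l k := by rw [h5, FTl_Pr l _ h1, FTl_apply]
  rw [KS_V1 hp (hf ψ), h7, ← FTl_ES]; ring

end time4


section time5
variable {p : ℝ≥0∞} [Fact (1 ≤ p)]

theorem Pr_diff {x y : ℝ} (hx : 0 ≤ x) (h : x ≤ y) (e : EE p) : Pr y e - Pr x e = Ind (Ioc x y) measurableSet_Ioc e := by
  apply Lp.ext
  filter_upwards [Ind_coe (measurableSet_Icc (a := (0:ℝ)) (b := x)) e, Ind_coe (measurableSet_Icc (a := (0:ℝ)) (b := y)) e,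
    Ind_coe (measurableSet_Ioc (a := x) (b := y)) e, Lp.coeFn_sub (Pr y e) (Pr x e)] with t h1 h2 h3 h4
  rw [h4, h3, Pi.sub_apply, Pr, Pr, h2, h1]
  simp only [indicator_apply, mem_Icc, mem_Ioc]
  by_cases h5 : t ≤ x
  · have h6 : t ≤ y := h5.trans h
    simp [h5, h6, not_lt.2 h5]
  · have h7 : x < t := not_le.1 h5
    have h8 : 0 ≤ t := hx.trans h7.le
    simp [h5, h7, h8]

theorem Ind_int_bd (ψ : EE p) {h : ℝ → EE p} {b : ℝ} (hb0 : 0 ≤ b) {x s y : ℝ} (hx : 0 ≤ x) (hxs : x ≤ s) (hsy : s ≤ y)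
    (hy : y ≤ 1) (hb : ∀ r ∈ Ioc s y, ‖h r‖ ≤ b) :
    ‖∫ r in s..y, ψ r • h r‖ ≤ ‖Ind (Ioc x y) measurableSet_Ioc ψ‖ * b := by
  set e := Ind (Ioc x y) measurableSet_Ioc ψ with he
  have hs1 : s ∈ Icc (0:ℝ) 1 := ⟨hx.trans hxs, hsy.trans hy⟩
  have hy1 : y ∈ Icc (0:ℝ) 1 := ⟨hs1.1.trans hsy, hy⟩
  have h1 : ‖∫ r in s..y, ψ r • h r‖ ≤ ∫ r in s..y, ‖e r‖ * b := by
    refine intervalIntegral.norm_integral_le_of_norm_le hsy ?_ (ii_sub ((EE_ii e).norm.mul_const b) hs1 hy1)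
    filter_upwards [Ind_coe (measurableSet_Ioc (a := x) (b := y)) ψ] with r hr hrs
    rw [he, hr, indicator_of_mem (show r ∈ Ioc x y from ⟨hxs.trans_lt hrs.1, hrs.2⟩), norm_smul]
    exact mul_le_mul_of_nonneg_left (hb r hrs) (norm_nonneg _)
  refine h1.trans ?_
  rw [intervalIntegral.integral_mul_const]
  refine mul_le_mul_of_nonneg_right (le_trans ?_ (EE_norm1 e)) hb0
  exact intervalIntegral.integral_mono_interval hs1.1 hsy hy (Eventually.of_forall fun s => norm_nonneg _) (EE_ii e).norm

theorem Ind_small_unif (hp : p ≠ ∞) {f : ℝ → EE p} (hf : Continuous f) {ε : ℝ} (hε : 0 < ε) :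
    ∃ δ > 0, ∀ r ∈ Icc (0:ℝ) 1, ∀ (A : Set ℝ) (hA : MeasurableSet A), volume A ≤ ENNReal.ofReal δ → ‖Ind A hA (f r)‖ ≤ ε := by
  refine IsCompact.induction_on (isCompact_Icc (a := (0:ℝ)) (b := 1))
    (p := fun s => ∃ δ > 0, ∀ r ∈ s, ∀ (A : Set ℝ) (hA : MeasurableSet A), volume A ≤ ENNReal.ofReal δ → ‖Ind A hA (f r)‖ ≤ ε)
    ⟨1, one_pos, fun r hr => absurd hr (notMem_empty r)⟩ ?_ ?_ ?_
  · rintro s t hst ⟨δ, h, h'⟩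
    exact ⟨δ, h, fun r hr => h' r (hst hr)⟩
  · rintro s t ⟨δ, h, h'⟩ ⟨δ2, h2, h2'⟩
    refine ⟨min δ δ2, lt_min h h2, fun r hr A hA hv => ?_⟩
    rcases hr with hr | hr
    · exact h' r hr A hA (hv.trans (ENNReal.ofReal_le_ofReal (min_le_left _ _)))
    · exact h2' r hr A hA (hv.trans (ENNReal.ofReal_le_ofReal (min_le_right _ _)))
  · intro x _
    obtain ⟨δ, hδ, h⟩ := Ind_small hp (f x) (half_pos hε)
    have hn : {r | ‖f r - f x‖ < ε / 2} ∈ 𝓝 x := by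
      have : Continuous fun r => ‖f r - f x‖ := (hf.sub continuous_const).norm
      exact (isOpen_lt this continuous_const).mem_nhds (by simp [hε])
    refine ⟨_, mem_nhdsWithin_of_mem_nhds hn, δ, hδ, fun r hr A hA hv => ?_⟩
    have e1 : Ind A hA (f r) = Ind A hA (f r - f x) + Ind A hA (f x) := by rw [map_sub]; abel
    rw [e1]
    have h4 : ∀ u v w : ℝ, u ≤ v + w → v ≤ ‖f r - f x‖ → w ≤ ε / 2 → u ≤ ε := by
      intro u v w h1 h2 h3
      have : ‖f r - f x‖ < ε / 2 := hr
      linarith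
    exact h4 _ _ _ (norm_add_le _ _) (Ind_norm_le _ _) (h A hA hv)

theorem KS_back (hp : p ≠ ∞) {ψ : EE p} {f : ℝ → EE p} (h : KS ψ f) {s y : ℝ} (hs : s ∈ Icc (0:ℝ) 1) (hy : y ∈ Icc (0:ℝ) 1) (hsy : s ≤ y) :
    f s = f y - Ind (Ioc s y) measurableSet_Ioc ψ - ∫ r in s..y, ψ r • Jr r (f r) := by
  have h0 : (0:ℝ) ∈ Icc (0:ℝ) 1 := by simp
  rw [h.2 s hs, h.2 y hy, ← Pr_diff hs.1 hsy, ← intervalIntegral.integral_add_adjacent_intervals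
    (ii_sub (KS_ii0 hp ψ h.1) h0 hs) (ii_sub (KS_ii0 hp ψ h.1) hs hy)]
  abel

theorem KS_diff (hp : p ≠ ∞) {ψ ψ' : EE p} {f f' : ℝ → EE p} (h : KS ψ f) (h' : KS ψ' f') {s y : ℝ}
    (hs : s ∈ Icc (0:ℝ) 1) (hy : y ∈ Icc (0:ℝ) 1) (hsy : s ≤ y) (he : f y = f' y) :
    Ind (Ioc s y) measurableSet_Ioc (ψ - ψ') + (f s - f' s) =
      -((∫ r in s..y, (ψ - ψ' : EE p) r • Jr r (f r)) + (∫ r in s..y, ψ' r • Jr r (f r - f' r))) := by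
  rw [← int_diff_eq hp ψ ψ' h.1 h'.1 hs hy, KS_back hp h hs hy hsy, KS_back hp h' hs hy hsy, he, map_sub]
  abel

end time5


section time6
variable {p : ℝ≥0∞} [Fact (1 ≤ p)]

theorem Ind_Ioc_zero {x y : ℝ} {e : EE p} (he : Pr x e = e) : Ind (Ioc x y) measurableSet_Ioc e = 0 := by
  rw [← he, Pr, Ind_Ind]
  have : Ioc x y ∩ Icc 0 x = ∅ := by
    ext t; simp only [mem_inter_iff, mem_Ioc, mem_Icc, mem_empty_iff_false, iff_false]
    intro ht; linarith [ht.1.1, ht.2.2]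
  apply Lp.ext
  filter_upwards [Ind_coe (measurableSet_Ioc.inter measurableSet_Icc : MeasurableSet (Ioc x y ∩ Icc 0 x)) e,
        Lp.coeFn_zero ℂ p (volume : Measure ℝ)] with t h1 h2
  rw [h1, h2, this]; simp

theorem int_Ind (hp : p ≠ ∞) (ψ : EE p) {f : ℝ → EE p} (hf : Continuous f) {A : Set ℝ} (hA : MeasurableSet A) {x y : ℝ}
    (hx : x ∈ Icc (0:ℝ) 1) (hy : y ∈ Icc (0:ℝ) 1) :
    Ind A hA (∫ r in x..y, ψ r • Jr r (f r)) = ∫ r in x..y, ψ r • Ind A hA (Jr r (f r)) := by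
  rw [← ContinuousLinearMap.intervalIntegral_comp_comm _ (ii_sub (KS_ii0 hp ψ hf) hx hy)]
  simp only [map_smul]

theorem KS_diff_Ind (hp : p ≠ ∞) {ψ ψ' : EE p} {f f' : ℝ → EE p} (h : KS ψ f) (h' : KS ψ' f') {x y : ℝ}
    (hx : x ∈ Icc (0:ℝ) 1) (hy : y ∈ Icc (0:ℝ) 1) (hxy : x ≤ y) (he : f y = f' y) :
    Ind (Ioc x y) measurableSet_Ioc (ψ - ψ') =
      -((∫ r in x..y, (ψ - ψ' : EE p) r • Ind (Ioc x y) measurableSet_Ioc (Jr r (f r))) +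
        (∫ r in x..y, ψ' r • Ind (Ioc x y) measurableSet_Ioc (Jr r (f r - f' r)))) := by
  have e1 := KS_diff hp h h' hx hy hxy he
  rw [← int_Ind hp (ψ - ψ') h.1 _ hx hy, ← int_Ind hp ψ' (f := fun r => f r - f' r) (h.1.sub h'.1) _ hx hy,
    ← map_add, ← map_neg, ← e1, map_add, Ind_Ind, map_sub (Ind (Ioc x y) measurableSet_Ioc) (f x),
    Ind_Ioc_zero (KS_supp hp h x hx), Ind_Ioc_zero (KS_supp hp h' x hx), sub_zero, add_zero]
  simp only [inter_self]

theorem KS_step (hp : p ≠ ∞) {ψ ψ' : EE p} {f f' : ℝ → EE p} (h : KS ψ f) (h' : KS ψ' f') {F η x y : ℝ}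
    (hF0 : 0 ≤ F) (hF : ∀ r ∈ Icc (0:ℝ) 1, ‖f r‖ ≤ F)
    (hω : ∀ r ∈ Icc (0:ℝ) 1, ‖Ind (Icc (-η) η) measurableSet_Icc (f r)‖ ≤ 1/2)
    (hx : 0 ≤ x) (hxy : x ≤ y) (hy : y ≤ 1) (hη : y - x ≤ η)
    (hP : ‖Ind (Ioc x y) measurableSet_Ioc ψ'‖ * (3 + 2 * F) ≤ 1/2) (he : f y = f' y) :
    f x = f' x ∧ Ind (Ioc x y) measurableSet_Ioc (ψ - ψ') = 0 := by
  have hx1 : x ∈ Icc (0:ℝ) 1 := ⟨hx, hxy.trans hy⟩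
  have hy1 : y ∈ Icc (0:ℝ) 1 := ⟨hx.trans hxy, hy⟩
  set P := ‖Ind (Ioc x y) measurableSet_Ioc ψ'‖ with hPd
  have hP0 : 0 ≤ P := norm_nonneg _
  set dd := Ind (Ioc x y) measurableSet_Ioc (ψ - ψ') with hdd
  obtain ⟨s0, hs0, hm⟩ := (isCompact_Icc (a := x) (b := y)).exists_isMaxOn ⟨x, left_mem_Icc.2 hxy⟩ (h.1.sub h'.1).norm.continuousOn
  set N := ‖f s0 - f' s0‖ with hN
  have hN0 : 0 ≤ N := norm_nonneg _
  have hNm : ∀ r ∈ Icc x y, ‖f r - f' r‖ ≤ N := fun r hr => hm hr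
  have hNb : N ≤ ‖dd‖ + (‖dd‖ * F + P * N) := by
    have hs1 : s0 ∈ Icc (0:ℝ) 1 := ⟨hx.trans hs0.1, hs0.2.trans hy⟩
    have e1 := KS_diff hp h h' hs1 hy1 hs0.2 he
    have e2 : f s0 - f' s0 = -Ind (Ioc s0 y) measurableSet_Ioc (ψ - ψ') -
        ((∫ r in s0..y, (ψ - ψ' : EE p) r • Jr r (f r)) + (∫ r in s0..y, ψ' r • Jr r (f r - f' r))) := by
      rw [eq_sub_iff_add_eq, ← neg_eq_iff_eq_neg.2 e1]; abel
    have b1 : ‖∫ r in s0..y, (ψ - ψ' : EE p) r • Jr r (f r)‖ ≤ ‖dd‖ * F :=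
      Ind_int_bd (ψ - ψ') hF0 hx hs0.1 hs0.2 hy (fun r hr => by
        rw [Jr_norm]; exact hF r ⟨hs1.1.trans hr.1.le, hr.2.trans hy⟩)
    have b2 : ‖∫ r in s0..y, ψ' r • Jr r (f r - f' r)‖ ≤ P * N :=
      Ind_int_bd ψ' hN0 hx hs0.1 hs0.2 hy (fun r hr => by
        rw [Jr_norm]; exact hNm r ⟨hs0.1.trans hr.1.le, hr.2⟩)
    have b3 : ‖Ind (Ioc s0 y) measurableSet_Ioc (ψ - ψ')‖ ≤ ‖dd‖ := Ind_mono _ _ (Ioc_subset_Ioc_left hs0.1) _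
    have e3 : N = ‖-Ind (Ioc s0 y) measurableSet_Ioc (ψ - ψ') -
        ((∫ r in s0..y, (ψ - ψ' : EE p) r • Jr r (f r)) + (∫ r in s0..y, ψ' r • Jr r (f r - f' r)))‖ := by
      rw [← e2]
    refine e3.le.trans ?_
    refine (norm_sub_le _ _).trans (add_le_add (by rw [norm_neg]; exact b3) ?_)
    exact (norm_add_le _ _).trans (add_le_add b1 b2)
  have hDb : ‖dd‖ ≤ ‖dd‖ * (1/2) + P * N := by
    have e2 := KS_diff_Ind hp h h' hx1 hy1 hxy he
    have e3 := congrArg (fun e => ‖e‖) e2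
    simp only [norm_neg] at e3
    refine e3.le.trans ?_
    refine (norm_add_le _ _).trans (add_le_add ?_ ?_)
    · refine Ind_int_bd (ψ - ψ') (by norm_num) hx le_rfl hxy hy (fun r hr => ?_)
      rw [Ind_Jr, Jr_norm]
      refine (Ind_mono _ measurableSet_Icc ?_ _).trans (hω r ⟨hx.trans hr.1.le, hr.2.trans hy⟩)
      intro t ht
      simp only [mem_preimage, mem_Ioc, mem_Icc] at ht ⊢
      constructor <;> linarith [hr.1, hr.2]
    · refine Ind_int_bd ψ' hN0 hx le_rfl hxy hy (fun r hr => ?_)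
      refine (Ind_norm_le _ _).trans ?_
      rw [Jr_norm]; exact hNm r ⟨hr.1.le, hr.2⟩
  have hdn : 0 ≤ ‖dd‖ := norm_nonneg _
  have hND : N ≤ 0 := by
    have h1 : ‖dd‖ ≤ 2 * (P * N) := by linarith
    have h2 : N ≤ P * (3 + 2 * F) * N := by nlinarith
    nlinarith
  have hN00 : N = 0 := le_antisymm hND hN0
  refine ⟨sub_eq_zero.1 (norm_le_zero_iff.1 ((hNm x (left_mem_Icc.2 hxy)).trans hND)), norm_le_zero_iff.1 ?_⟩
  rw [hN00] at hDb
  linarith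

theorem KS_uniq (hp : p ≠ ∞) {ψ ψ' : EE p} {f f' : ℝ → EE p} (h : KS ψ f) (h' : KS ψ' f') (he : f 1 = f' 1) :
    Pr 1 (ψ - ψ') = 0 := by
  obtain ⟨F, hF⟩ := bdd01 h.1
  have hF0 : 0 ≤ F := (norm_nonneg _).trans (hF 0 (by simp))
  obtain ⟨δ1, hδ1, hs1⟩ := Ind_small_unif hp h.1 (ε := 1/2) (by norm_num)
  obtain ⟨δ2, hδ2, hs2⟩ := Ind_small hp ψ' (ε := 1/2 / (3 + 2 * F)) (by positivity)
  set η := min (δ1 / 2) δ2 with hη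
  have hη0 : 0 < η := lt_min (by positivity) hδ2
  have hω : ∀ r ∈ Icc (0:ℝ) 1, ‖Ind (Icc (-η) η) measurableSet_Icc (f r)‖ ≤ 1/2 := fun r hr => by
    refine hs1 r hr _ _ ?_
    rw [Real.volume_Icc]
    refine ENNReal.ofReal_le_ofReal ?_
    have : η ≤ δ1 / 2 := min_le_left _ _
    linarith
  have key : ∀ n : ℕ, ∀ x ∈ Icc (0:ℝ) 1, 1 - x ≤ n * η → f x = f' x ∧ Pr 1 (ψ - ψ') = Pr x (ψ - ψ') := by
    intro n
    induction n with
    | zero =>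
      intro x hx hn
      have : x = 1 := by
        refine le_antisymm hx.2 ?_
        simp only [Nat.cast_zero, zero_mul] at hn
        linarith
      rw [this]
      exact ⟨he, rfl⟩
    | succ n ih =>
      intro x hx hn
      push_cast at hn
      set y := min (x + η) 1 with hy
      have hxy : x ≤ y := le_min (by linarith) hx.2
      have hyx : y - x ≤ η := by linarith [min_le_left (x + η) 1]
      have hy1 : y ≤ 1 := min_le_right _ _
      have hyn : 1 - y ≤ n * η := by
        rcases min_choice (x + η) 1 with hc | hc
        · rw [hy, hc]; linarith
        · rw [hy, hc]; simp; positivity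
      obtain ⟨i1, i2⟩ := ih y ⟨hx.1.trans hxy, hy1⟩ hyn
      obtain ⟨j1, j2⟩ := KS_step hp h h' hF0 hF hω hx.1 hxy hy1 hyx (by
        rw [← le_div_iff₀ (by positivity)]
        refine hs2 _ _ ?_
        rw [Real.volume_Ioc]
        exact ENNReal.ofReal_le_ofReal (hyx.trans (min_le_right _ _))) i1
      refine ⟨j1, ?_⟩
      rw [← Pr_diff hx.1 hxy] at j2
      rw [i2]
      exact sub_eq_zero.1 j2
  obtain ⟨n, hn⟩ := exists_nat_ge (1 / η)
  have h1 := (key n 0 (by simp) (by rw [div_le_iff₀ hη0] at hn; linarith)).2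
  rw [h1]
  apply Lp.ext
  have h0 : ∀ᵐ x : ℝ, x ≠ 0 := by simp [ae_iff, measure_singleton]
  filter_upwards [Ind_coe (measurableSet_Icc (a := (0:ℝ)) (b := 0)) (ψ - ψ'), h0,
        Lp.coeFn_zero ℂ p (volume : Measure ℝ)] with t h1 h2 h3
  rw [Pr, h1, h3, indicator_of_notMem]
  · rfl
  · intro h; exact h2 (le_antisymm h.2 h.1)

end time6

theorem ii_ES {c : ℝ → ℂ} (hc : MemLp c 1 μ01) (l : ℂ) :
    IntervalIntegrable (fun x : ℝ => c x * Complex.exp (I * l * (1 - 2 * x))) volume 0 1 :=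
  IntervalIntegrable.mul_continuousOn (ii_of_memLp le_rfl hc) (Continuous.continuousOn (by fun_prop))

theorem ES_sub {c d : ℝ → ℂ} (hc : MemLp c 1 μ01) (hd : MemLp d 1 μ01) (l : ℂ) :
    ES (fun x => c x - d x) l = ES c l - ES d l := by
  rw [ES, ES, ES, ← intervalIntegral.integral_sub (ii_ES hc l) (ii_ES hd l)]
  refine intervalIntegral.integral_congr fun x _ => ?_
  ring

theorem BU {ψ ψ' : ℝ → ℂ} (h : MemLp ψ 1 μ01) (h' : MemLp ψ' 1 μ01) (hV : ∀ l : ℝ, V1 ψ l = V1 ψ' l) : ψ =ᵐ[μ01] ψ' := by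
  have h11 : (1:ℝ) ∈ Icc (0:ℝ) 1 := by simp
  obtain ⟨f, hf⟩ := KS_exists (p := 1) (by simp) (emb h)
  obtain ⟨f', hf'⟩ := KS_exists (p := 1) (by simp) (emb h')
  have h1 : ∀ l : ℝ, ES (f 1) l = ES (f' 1) l := fun l => by
    have h2 := hV l
    rw [← V1_congr (EE_ii (emb h)) (emb_coe' h), ← V1_congr (EE_ii (emb h')) (emb_coe' h'),
      KS_V1 (by simp) hf, KS_V1 (by simp) hf', mul_add, mul_add, FTl_ES, FTl_ES] at h2
    exact add_left_cancel h2
  have h2 := ES_unique (h := fun x => f 1 x - f' 1 x) ((EE_memLp (f 1)).sub (EE_memLp (f' 1))) (fun n => by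
    have h3 := h1 (Real.pi * n)
    push_cast at h3
    rw [ES_sub (EE_memLp (f 1)) (EE_memLp (f' 1)), h3, sub_self])
  have h3 : f 1 = f' 1 := by
    rw [← KS_supp (by simp) hf 1 h11, ← KS_supp (by simp) hf' 1 h11]
    apply Lp.ext
    rw [mu01_Ioc] at h2
    have h4 := (ae_restrict_iff' measurableSet_Ioc).1 h2
    have h0 : ∀ᵐ x : ℝ, x ≠ 0 := by simp [ae_iff, measure_singleton]
    filter_upwards [Ind_coe (measurableSet_Icc (a := (0:ℝ)) (b := 1)) (f 1), Ind_coe (measurableSet_Icc (a := (0:ℝ)) (b := 1)) (f' 1), h0, h4] with t a1 a2 a3 a4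
    rw [Pr, a1, a2]
    by_cases ht : t ∈ Icc (0:ℝ) 1
    · rw [indicator_of_mem ht, indicator_of_mem ht]
      exact sub_eq_zero.1 (a4 ⟨lt_of_le_of_ne ht.1 (Ne.symm a3), ht.2⟩)
    · rw [indicator_of_notMem ht, indicator_of_notMem ht]
  have h5 := KS_uniq (by simp) hf hf' h3
  have h6 := Ind_coe (measurableSet_Icc (a := (0:ℝ)) (b := 1)) (emb h - emb h')
  filter_upwards [emb_coe' h, emb_coe' h', ae_restrict_of_ae h6, ae_restrict_of_ae (coe_sub01 (emb h) (emb h')),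
    ae_restrict_of_ae (Lp.coeFn_zero ℂ 1 (volume : Measure ℝ)), ae_restrict_mem measurableSet_Ioo] with t a1 a2 a3 a4 a5 a6
  change (Pr 1 (emb h - emb h') : EE 1) t = _ at a3
  rw [h5, a5, indicator_of_mem (Ioo_subset_Icc_self a6), a4, a1, a2] at a3
  exact (sub_eq_zero.1 a3.symm)


theorem ES_crefl (h : ℝ → ℂ) (l : ℝ) : ES (crefl h) l = conj (ES h l) := by
  rw [ES, ES, ← intervalIntegral.intervalIntegral_conj]
  have h1 := intervalIntegral.integral_comp_sub_left
    (fun x : ℝ => conj (h x * Complex.exp (I * l * (1 - 2 * x)))) (a := 0) (b := 1) 1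
  rw [sub_self, sub_zero] at h1
  rw [← h1]
  refine intervalIntegral.integral_congr fun x _ => ?_
  simp only [map_mul, crefl]
  rw [← Complex.exp_conj]
  congr 2
  simp only [map_mul, map_sub, map_one, conj_ofReal, conj_I, map_ofNat]
  push_cast
  ring

theorem ES_add {c d : ℝ → ℂ} (hc : MemLp c 1 μ01) (hd : MemLp d 1 μ01) (l : ℂ) :
    ES (fun x => c x + d x) l = ES c l + ES d l := by
  rw [ES, ES, ES, ← intervalIntegral.integral_add (ii_ES hc l) (ii_ES hd l)]
  refine intervalIntegral.integral_congr fun x _ => ?_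
  ring

theorem ES_mul (a : ℂ) (c : ℝ → ℂ) (l : ℂ) : ES (fun x => a * c x) l = a * ES c l := by
  rw [ES, ES, ← intervalIntegral.integral_const_mul]
  refine intervalIntegral.integral_congr fun x _ => ?_
  ring

theorem ES_half {h : ℝ → ℂ} (hh : MemLp h 1 μ01) (l : ℝ) :
    ES (fun x => (1/2:ℂ) * (h x + crefl h x)) l = ((ES h l).re : ℂ) := by
  rw [ES_mul, ES_add hh (crefl_memLp hh), ES_crefl, Complex.add_conj]
  push_cast; ring

/-- twist -/
def tw (θ : ℂ) (c : ℝ → ℂ) (x : ℝ) : ℂ := c x * Complex.exp (I * θ * (1 - 2 * x))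

theorem ES_tw (θ : ℂ) (c : ℝ → ℂ) (l : ℂ) : ES (tw θ c) l = ES c (l + θ) := by
  rw [ES, ES]
  refine intervalIntegral.integral_congr fun x _ => ?_
  simp only [tw]
  rw [mul_assoc, ← Complex.exp_add]
  congr 2
  ring

theorem tw_norm (θ : ℝ) (c : ℝ → ℂ) (x : ℝ) : ‖tw θ c x‖ = ‖c x‖ := by
  rw [tw, norm_mul]
  have : I * (θ:ℂ) * (1 - 2 * (x:ℂ)) = ((θ * (1 - 2 * x) : ℝ) : ℂ) * I := by push_cast; ring
  rw [this, Complex.norm_exp_ofReal_mul_I, mul_one]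

theorem tw_memLp {p : ℝ≥0∞} (θ : ℝ) {c : ℝ → ℂ} (hc : MemLp c p μ01) : MemLp (tw θ c) p μ01 := by
  refine hc.of_le (hc.1.mul (Continuous.aestronglyMeasurable (by fun_prop))) (Eventually.of_forall fun x => ?_)
  exact (tw_norm θ c x).le

theorem tw_eLp {p : ℝ≥0∞} (θ : ℝ) (c : ℝ → ℂ) : eLpNorm (tw θ c) p μ01 = eLpNorm c p μ01 :=
  eLpNorm_congr_norm_ae (Eventually.of_forall fun x => tw_norm θ c x)

/-- determining sequences. -/
def Det (t : ℤ → ℝ) : Prop := ∀ h : ℝ → ℂ, MemLp h 1 μ01 → (∀ n, ES h (t n) = 0) → h =ᵐ[μ01] 0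

theorem ES_zero (l : ℂ) : ES 0 l = 0 := by simp [ES]

theorem det_mu {p : ℝ≥0∞} (hp : 1 ≤ p) {g : ℝ → ℂ} (hg : MemLp g p μ01)
    (hs : (eLpNorm g p μ01).toReal ≤ 1/8) {t : ℤ → ℝ} (ht : ∀ n : ℤ, (t n : ℂ) = Real.pi * n + fc g n) : Det t :=
  fun h hh h0 => circ_inj hp hg hs hh fun n => by rw [← ht, h0]

theorem det_lam {p : ℝ≥0∞} (hp : 1 ≤ p) {g : ℝ → ℂ} (hg : MemLp g p μ01)
    (hs : (eLpNorm g p μ01).toReal ≤ 1/8) {t : ℤ → ℝ} (ht : ∀ n : ℤ, (t n : ℂ) = Real.pi * (n + 1/2) + fc g n) : Det t := by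
  intro h hh h0
  have h1 := circ_inj hp hg hs (tw_memLp (Real.pi / 2) hh) fun n => by
    rw [ES_tw, ← h0 n, ht]; congr 1; push_cast; ring
  filter_upwards [h1] with x hx
  have := tw_norm (Real.pi / 2) h x
  rw [hx] at this
  simpa using this.symm

theorem diff_ES {ψ φ : ℝ → ℂ} (hψ : MemLp ψ 1 μ01) (hφ : MemLp φ 1 μ01) (ω : ℂ) :
    ∃ h, MemLp h 1 μ01 ∧ ∀ l : ℝ, (((conj ω * V1 ψ l).re - (conj ω * V1 φ l).re : ℝ) : ℂ) = ES h l := by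
  obtain ⟨k, hk, hk'⟩ := rep hψ
  obtain ⟨m, hm, hm'⟩ := rep hφ
  have hh : MemLp (fun x => conj ω * (k x - m x)) 1 μ01 := (hk.sub hm).const_mul _
  refine ⟨_, half_memLp hh, fun l => ?_⟩
  rw [ES_half hh, ES_mul, ES_sub hk hm, hk', hm', ← Complex.sub_re]
  congr 2
  ring

theorem det_eq {t : ℤ → ℝ} (ht : Det t) {ψ φ : ℝ → ℂ} (hψ : MemLp ψ 1 μ01) (hφ : MemLp φ 1 μ01) (ω : ℂ)
    (h1 : ∀ n, (conj ω * V1 ψ (t n)).re = 0) (h2 : ∀ n, (conj ω * V1 φ (t n)).re = 0) :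
    ∀ l, (conj ω * V1 ψ l).re = (conj ω * V1 φ l).re := by
  obtain ⟨h, hh, he⟩ := diff_ES hψ hφ ω
  have h3 := ht h hh fun n => by rw [← he, h1, h2]; simp
  intro l
  have h4 := he l
  rw [ES_congr h3, ES_zero] at h4
  exact sub_eq_zero.1 (by exact_mod_cast h4)

theorem det_zero {t : ℤ → ℝ} (ht : Det t) {ψ : ℝ → ℂ} (hψ : MemLp ψ 1 μ01) (ω : ℂ) (hω : conj ω * ω = 1)
    (h1 : ∀ n, (conj ω * V1 ψ (t n)).re = 0) {ν : ℝ} (h2 : (conj ω * V1 ψ ν).re = 0) : ∃ n, t n = ν := by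
  by_contra hne
  push Not at hne
  have hi := ii_of_memLp le_rfl hψ
  have hω0 : conj ω ≠ 0 := fun h => by rw [h, zero_mul] at hω; exact zero_ne_one hω
  have him : (conj ω * V1 ψ ν).im ≠ 0 := fun h => mul_ne_zero hω0 (V1_ne_zero hi ν) (Complex.ext h2 h)
  have hc : Continuous fun l => (conj ω * V1 ψ l).im := Complex.continuous_im.comp (continuous_const.mul (V1_cont hi))
  have hn : {l | (conj ω * V1 ψ l).im ≠ 0} ∈ 𝓝 ν := (isOpen_ne_fun hc continuous_const).mem_nhds him
  obtain ⟨ε, hε, hball⟩ := Metric.mem_nhds_iff.1 hn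
  obtain ⟨χ, hχ, hd⟩ := darboux hi ω hω ν (ν + ε / 2) h2 (fun l hl => by
    apply hball
    rw [uIcc_of_le (by linarith)] at hl
    rw [Metric.mem_ball, Real.dist_eq, abs_lt]
    constructor <;> linarith [hl.1, hl.2])
  obtain ⟨-, d2, d3⟩ := hd _ rfl
  have h4 := det_eq ht (hψ.add (cont_memLp hχ 1)) hψ ω (fun n => by
    have := d2 (t n)
    rw [h1, mul_zero] at this
    exact (mul_eq_zero.1 this).resolve_left (sub_ne_zero.2 (hne n))) h1 ν
  exact d3 (by linarith) (by rw [← h2, ← h4]; rfl)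

theorem memLp1_of_ii {ψ : ℝ → ℂ} (h : IntervalIntegrable ψ volume 0 1) : MemLp ψ 1 μ01 := by
  rw [memLp_one_iff_integrable, mu01_Ioc]
  exact (intervalIntegrable_iff_integrableOn_Ioc_of_le zero_le_one).1 h

theorem re_one (z : ℂ) : (conj (1:ℂ) * z).re = z.re := by simp
theorem re_I (z : ℂ) : (conj (I:ℂ) * z).re = z.im := by simp

theorem uniq_det {a : ℤ → ℝ} (h1 : Det fun n => a (2 * n + 1)) (h2 : Det fun n => a (2 * n)) : UniqV a := by
  intro ψ ψ' hψ hψ' hd hd' l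
  have m := memLp1_of_ii hψ
  have m' := memLp1_of_ii hψ'
  apply Complex.ext
  · have := det_eq h1 m m' 1 (fun n => by rw [re_one]; exact (hd.1 _).2 ⟨n, rfl⟩) (fun n => by rw [re_one]; exact (hd'.1 _).2 ⟨n, rfl⟩) l
    simpa using this
  · have := det_eq h2 m m' I (fun n => by rw [re_I]; exact (hd.2 _).2 ⟨n, rfl⟩) (fun n => by rw [re_I]; exact (hd'.2 _).2 ⟨n, rfl⟩) l
    simpa using this

theorem data_det {a : ℤ → ℝ} (h1 : Det fun n => a (2 * n + 1)) (h2 : Det fun n => a (2 * n)) {ψ : ℝ → ℂ} (hψ : MemLp ψ 1 μ01)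
    (z1 : ∀ n, (V1 ψ (a (2 * n + 1))).re = 0) (z2 : ∀ n, (V1 ψ (a (2 * n))).im = 0) : Data ψ a := by
  refine ⟨fun l => ⟨fun h => ?_, ?_⟩, fun l => ⟨fun h => ?_, ?_⟩⟩
  · exact det_zero h1 hψ 1 (by simp) (fun n => by rw [re_one]; exact z1 n) (by rw [re_one]; exact h)
  · rintro ⟨n, rfl⟩; exact z1 n
  · exact det_zero h2 hψ I (by simp) (fun n => by rw [re_I]; exact z2 n) (by rw [re_I]; exact h)
  · rintro ⟨n, rfl⟩; exact z2 n

theorem fc_bound {p : ℝ≥0∞} (hp : 1 ≤ p) {g : ℝ → ℂ} (hg : MemLp g p μ01) (n : ℤ) : ‖fc g n‖ ≤ (eLpNorm g p μ01).toReal := by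
  have h1 : ‖fc g n‖ ≤ ∫ x in (0:ℝ)..1, ‖g x‖ := by
    refine intervalIntegral.norm_integral_le_of_norm_le zero_le_one (Eventually.of_forall fun x _ => ?_) (ii_of_memLp hp hg).norm
    rw [norm_mul]
    have : -2 * (Real.pi:ℂ) * I * n * x = ((-2 * Real.pi * n * x : ℝ) : ℂ) * I := by push_cast; ring
    rw [this, Complex.norm_exp_ofReal_mul_I, one_mul]
  refine h1.trans ?_
  rw [intervalIntegral.integral_of_le zero_le_one, ← mu01_Ioc, integral_norm_eq_lintegral_enorm hg.1, ← eLpNorm_one_eq_lintegral_enorm]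
  exact ENNReal.toReal_mono hg.2.ne (eLpNorm_le_eLpNorm_of_exponent_le hp hg.1)

/-- small data: existence -/
theorem small_data {p : ℝ≥0∞} (hp : 1 ≤ p) (hp' : p ≠ ∞) {g1 g2 : ℝ → ℂ} (hg1 : MemLp g1 p μ01) (hg2 : MemLp g2 p μ01)
    (hs1 : (eLpNorm g1 p μ01).toReal ≤ 1/200) (hs2 : (eLpNorm g2 p μ01).toReal ≤ 1/200) {a : ℤ → ℝ}
    (ha1 : ∀ n : ℤ, (a (2 * n + 1) : ℂ) = Real.pi * (n + 1/2) + fc g1 n)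
    (ha2 : ∀ n : ℤ, (a (2 * n) : ℂ) = Real.pi * n + fc g2 n) : ∃ ψ, MemLp ψ p μ01 ∧ Data ψ a := by
  have : Fact (1 ≤ p) := ⟨hp⟩
  obtain ⟨c, hc, nc, ec⟩ := circ_solve hp hp' hg1 (by linarith)
  obtain ⟨d, hd, nd, ed⟩ := circ_solve hp hp' hg2 (by linarith)
  have hb := tw_memLp (-(Real.pi / 2)) hc
  have nb := tw_eLp (p := p) (-(Real.pi / 2)) c
  set b := tw ((-(Real.pi / 2) : ℝ) : ℂ) c with hbd
  set C : ℝ → ℂ := fun x => (1/2:ℂ) * (b x + crefl b x) with hC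
  set D : ℝ → ℂ := fun x => (1/2:ℂ) * (d x + crefl d x) with hD
  have mC : MemLp C p μ01 := half_memLp hb
  have mD : MemLp D p μ01 := half_memLp hd
  have nC : (eLpNorm C p μ01).toReal ≤ 3/200 := by
    refine (ENNReal.toReal_mono hb.2.ne (half_norm hp hb)).trans ?_
    rw [nb]; linarith
  have nD : (eLpNorm D p μ01).toReal ≤ 3/200 :=
    (ENNReal.toReal_mono hd.2.ne (half_norm hp hd)).trans (by linarith)
  set k : EE p := emb mC - I • emb mD with hk
  have nk : ‖k‖ ≤ 1/32 := by
    have h4 : ∀ u v : ℝ, u ≤ (eLpNorm C p μ01).toReal + v → v ≤ (eLpNorm D p μ01).toReal → u ≤ 1/32 := by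
      intro u v h1 h2; linarith
    refine h4 _ ‖I • emb mD‖ ?_ ?_
    · rw [← emb_norm mC]; exact norm_sub_le _ _
    · rw [norm_smul, Complex.norm_I, one_mul, emb_norm mD]
  obtain ⟨ψ, hψ⟩ := small_ex hp' k nk
  have mC1 := mC.mono_exponent hp
  have mD1 := mD.mono_exponent hp
  have hkc : (k : ℝ → ℂ) =ᵐ[μ01] fun x => C x - I * D x := by
    filter_upwards [ae_restrict_of_ae (Lp.coeFn_sub (emb mC) (I • emb mD)), ae_restrict_of_ae (Lp.coeFn_smul I (emb mD)),
      emb_coe' mC, emb_coe' mD] with x h1 h2 h3 h4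
    rw [hk, h1, Pi.sub_apply, h2, Pi.smul_apply, h3, h4, smul_eq_mul]
  have hV : ∀ l : ℝ, V1 ψ l = ((Real.cos l + (ES c ((l - Real.pi / 2 : ℝ) : ℂ)).re : ℝ) : ℂ) + ((Real.sin l - (ES d l).re : ℝ) : ℂ) * I := by
    intro l
    have e1 : ES C l = ((ES b l).re : ℂ) := ES_half (hb.mono_exponent hp) l
    have e2 : ES D l = ((ES d l).re : ℂ) := ES_half (hd.mono_exponent hp) l
    have e3 : ES b l = ES c ((l - Real.pi / 2 : ℝ) : ℂ) := by
      rw [hbd, ES_tw]; congr 1; push_cast; ring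
    rw [hψ, ES_congr hkc, ES_sub mC1 (mD1.const_mul I), e1, ES_mul I D, e2, e3, mul_comm I (l:ℂ), Complex.exp_mul_I]
    push_cast
    ring
  refine ⟨ψ, EE_memLp ψ, data_det (det_lam hp hg1 (by linarith) ha1) (det_mu hp hg2 (by linarith) ha2) (EE_memLp ψ |>.mono_exponent hp)
    (fun n => ?_) (fun n => ?_)⟩
  · have h1 : ES c ((a (2 * n + 1) - Real.pi / 2 : ℝ) : ℂ) = ((Real.sin (a (2 * n + 1) - Real.pi / 2) : ℝ) : ℂ) := by
      have e : ((a (2 * n + 1) - Real.pi / 2 : ℝ) : ℂ) = Real.pi * n + fc g1 n := by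
        push_cast; rw [ha1]; ring
      rw [Complex.ofReal_sin, e, ec]
    rw [hV, h1, Complex.ofReal_re, Real.sin_sub_pi_div_two]
    simp
  · have h1 : ES d (a (2 * n)) = ((Real.sin (a (2 * n)) : ℝ) : ℂ) := by
      rw [Complex.ofReal_sin, ha2, ed]
    rw [hV, h1, Complex.ofReal_re]
    simp

/-- Merge two sequences into one indexed by all integers. -/
def mrg (lam mu : ℤ → ℝ) (k : ℤ) : ℝ := if k % 2 = 0 then mu (k / 2) else lam (k / 2)

theorem mrg_even (lam mu : ℤ → ℝ) (n : ℤ) : mrg lam mu (2 * n) = mu n := by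
  have h1 : (2 * n) % 2 = 0 := by omega
  have h2 : (2 * n) / 2 = n := by omega
  rw [mrg, h1, h2]; simp

theorem mrg_odd (lam mu : ℤ → ℝ) (n : ℤ) : mrg lam mu (2 * n + 1) = lam n := by
  have h1 : (2 * n + 1) % 2 = 1 := by omega
  have h2 : (2 * n + 1) / 2 = n := by omega
  rw [mrg, h1, h2]; simp

theorem mrg_mono {lam mu : ℤ → ℝ} (h : ∀ n : ℤ, lam (n - 1) < mu n ∧ mu n < lam n) : StrictMono (mrg lam mu) := by
  refine strictMono_int_of_lt_succ fun k => ?_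
  rcases Int.even_or_odd' k with ⟨n, rfl | rfl⟩
  · rw [mrg_even, mrg_odd]; exact (h n).2
  · have e : 2 * n + 1 + 1 = 2 * (n + 1) := by ring
    rw [e, mrg_even, mrg_odd]
    have := (h (n + 1)).1
    rwa [add_sub_cancel_right] at this

theorem ofReal_re_of {z : ℂ} (h : z.im = 0) : ((z.re : ℝ) : ℂ) = z := by
  apply Complex.ext <;> simp [h]

theorem sd_all {p : ℝ≥0∞} (hp : 1 ≤ p) (hp' : p ≠ ∞) {lam mu : ℤ → ℝ} (hSD : MemSD p lam mu) :
    (∃ ψ, MemLp ψ p μ01 ∧ Data ψ (mrg lam mu)) ∧ UniqV (mrg lam mu) := by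
  obtain ⟨hint, ⟨g1, hg1, h1⟩, ⟨g2, hg2, h2⟩⟩ := hSD
  have r1 : ∀ n : ℤ, fc g1 n = ((lam n - Real.pi * (n + 1/2) : ℝ) : ℂ) := fun n => by
    push_cast; rw [h1]; ring
  have r2 : ∀ n : ℤ, fc g2 n = ((mu n - Real.pi * n : ℝ) : ℂ) := fun n => by
    push_cast; rw [h2]; ring
  obtain ⟨k1, hk1, b1, i1, s1, e1⟩ := circ_small hp hp' hg1 (fun n => by rw [r1, ofReal_im]) (η := 1/200) (by norm_num)
  obtain ⟨k2, hk2, b2, i2, s2, e2⟩ := circ_small hp hp' hg2 (fun n => by rw [r2, ofReal_im]) (η := 1/200) (by norm_num)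
  set lam' : ℤ → ℝ := fun n => Real.pi * (n + 1/2) + (fc k1 n).re with hlam'
  set mu' : ℤ → ℝ := fun n => Real.pi * n + (fc k2 n).re with hmu'
  have B1 : ∀ n, |(fc k1 n).re| ≤ 1/200 := fun n => (Complex.abs_re_le_norm _).trans ((fc_bound hp hk1 n).trans b1)
  have B2 : ∀ n, |(fc k2 n).re| ≤ 1/200 := fun n => (Complex.abs_re_le_norm _).trans ((fc_bound hp hk2 n).trans b2)
  have hint' : ∀ n : ℤ, lam' (n - 1) < mu' n ∧ mu' n < lam' n := by
    intro n
    have c1 := abs_le.1 (B1 n)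
    have c2 := abs_le.1 (B1 (n - 1))
    have c3 := abs_le.1 (B2 n)
    have := Real.pi_gt_three
    simp only [hlam', hmu']
    push_cast
    constructor <;> nlinarith
  have A1 : ∀ n : ℤ, ((mrg lam' mu' (2 * n + 1) : ℝ) : ℂ) = Real.pi * (n + 1/2) + fc k1 n := fun n => by
    rw [mrg_odd, hlam']; push_cast; rw [ofReal_re_of (i1 n)]
  have A2 : ∀ n : ℤ, ((mrg lam' mu' (2 * n) : ℝ) : ℂ) = Real.pi * n + fc k2 n := fun n => by
    rw [mrg_even, hmu']; push_cast; rw [ofReal_re_of (i2 n)]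
  have hoff : ∀ k, k ∉ (s1.image (fun n => 2 * n + 1) ∪ s2.image (fun n => 2 * n)) → mrg lam' mu' k = mrg lam mu k := by
    intro k hk
    simp only [Finset.mem_union, Finset.mem_image, not_or, not_exists, not_and] at hk
    rcases Int.even_or_odd' k with ⟨n, rfl | rfl⟩
    · have hn : n ∉ s2 := fun h => hk.2 n h rfl
      rw [mrg_even, mrg_even]
      simp only [hmu']
      rw [e2 n hn, r2, ofReal_re]; ring
    · have hn : n ∉ s1 := fun h => hk.1 n h rfl
      rw [mrg_odd, mrg_odd]
      simp only [hlam']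
      rw [e1 n hn, r1, ofReal_re]; ring
  refine ⟨chain (ex_closed hp) (mrg_mono hint') (mrg_mono hint) _ hoff (small_data hp hp' hk1 hk2 b1 b2 A1 A2),
    chain uniq_closed (mrg_mono hint') (mrg_mono hint) _ hoff
      (uniq_det (det_lam hp hk1 (by linarith) A1) (det_mu hp hk2 (by linarith) A2))⟩

/-- For every element of `SD_p` there is a unique real Dirac-form potential
`Q ∈ L_p(M₂)` whose operators `A₁` and `A₂` have exactly these eigenvalues. -/
theorem statement9 (p : ℝ≥0∞) (hp : 1 ≤ p) (hp' : p ≠ ∞)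
    (lam mu : ℤ → ℝ) (hSD : MemSD p lam mu) :
    ∃ Q : ℝ → M2,
      (IsRealDiracForm Q ∧ MemLp Q p μ01 ∧
        (∀ l : ℝ, IsEigenvalue Q 0 l ↔ ∃ n : ℤ, lam n = l) ∧
        (∀ l : ℝ, IsEigenvalue Q 1 l ↔ ∃ n : ℤ, mu n = l)) ∧
      ∀ Q' : ℝ → M2,
        (IsRealDiracForm Q' ∧ MemLp Q' p μ01 ∧
          (∀ l : ℝ, IsEigenvalue Q' 0 l ↔ ∃ n : ℤ, lam n = l) ∧
          (∀ l : ℝ, IsEigenvalue Q' 1 l ↔ ∃ n : ℤ, mu n = l)) →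
        Q' =ᵐ[μ01] Q := by
  have hfin : IsFiniteMeasure μ01 := by unfold μ01; infer_instance
  obtain ⟨⟨ψ, hψ, hd⟩, hU⟩ := sd_all hp hp' hSD
  have hcr : ∀ (Q : ℝ → M2) (q1 q2 : ℝ → ℝ),
      (∀ x, Q x = !![(q1 x : ℂ), (q2 x : ℂ); (q2 x : ℂ), -(q1 x : ℂ)]) → MemLp (psiOf q1 q2) p μ01 →
      (Data (psiOf q1 q2) (mrg lam mu) ↔ (∀ l : ℝ, IsEigenvalue Q 0 l ↔ ∃ n : ℤ, lam n = l) ∧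
        (∀ l : ℝ, IsEigenvalue Q 1 l ↔ ∃ n : ℤ, mu n = l)) := by
    intro Q q1 q2 hQ hm
    have h := eig_iff hQ (ii_of_memLp hp hm)
    unfold Data
    simp only [mrg_even, mrg_odd, (h _).1, (h _).2]
  have hψe : psiOf (fun x => -(ψ x).im) (fun x => (ψ x).re) = ψ := by
    funext x
    apply Complex.ext <;> simp [psiOf]
  have hQ : ∀ x, (fun x => (!![((-(ψ x).im : ℝ) : ℂ), (((ψ x).re : ℝ) : ℂ); (((ψ x).re : ℝ) : ℂ), -((-(ψ x).im : ℝ) : ℂ)] : M2)) x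
      = !![(((fun x => -(ψ x).im) x : ℝ) : ℂ), (((fun x => (ψ x).re) x : ℝ) : ℂ); (((fun x => (ψ x).re) x : ℝ) : ℂ), -(((fun x => -(ψ x).im) x : ℝ) : ℂ)] :=
    fun x => rfl
  refine ⟨_, ⟨⟨_, _, hQ⟩, (memLp_of_Q hQ).2 (by rw [hψe]; exact hψ), (hcr _ _ _ hQ (by rw [hψe]; exact hψ)).1 (by rw [hψe]; exact hd)⟩, ?_⟩
  rintro Q' ⟨⟨q1, q2, hQ'⟩, hm', hE⟩
  have hm := (memLp_of_Q hQ').1 hm'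
  have hd' := (hcr _ _ _ hQ' hm).2 hE
  have hae := BU (hm.mono_exponent hp) (hψ.mono_exponent hp)
    (fun l => hU _ _ (ii_of_memLp hp hm) (ii_of_memLp hp hψ) hd' hd l)
  filter_upwards [hae] with x hx
  have hr : (ψ x).re = q2 x := by rw [← hx]; simp [psiOf]
  have hi : -(ψ x).im = q1 x := by rw [← hx]; simp [psiOf]
  rw [hQ' x, hr, hi]
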